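/- arXiv:1901.06668 — 4 statements merged into one kernel-verified Lean document; each statement's English description precedes it below -/
import Mathlib

section
/- Let (S, n) be a regular local ring of dimension 4 and let x, y, u, v be a regular system of parameters for S. Then the element a := x·u + y·v is a prime element of S. -/
open IsLocalRing in
/-- A principal-multiple version of Nakayama. -/
lemma aux_nak {R : Type*} [CommRing R] [IsNoetherianRing R] [IsLocalRing R]
    (x : R) (hx : x ∈ maximalIdeal R) (q : Ideal R) [q.IsPrime] (hxq : x ∉ q)
    (h : ∀ p ∈ q, ∃ e, p = x * e) : q = ⊥ := by
  refine Submodule.eq_bot_of_le_smul_of_le_jacobson_bot (Ideal.span {x}) q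
    (IsNoetherian.noetherian q) ?_ ?_
  · intro p hp
    obtain ⟨e, rfl⟩ := h p hp
    have he : e ∈ q := (Ideal.IsPrime.mem_or_mem ‹_› hp).resolve_left hxq
    exact Submodule.smul_mem_smul (Ideal.mem_span_singleton_self x) he
  · rw [IsLocalRing.jacobson_eq_maximalIdeal _ bot_ne_top, Ideal.span_singleton_le_iff_mem]
    exact hx

open IsLocalRing in
lemma aux_cusp {R : Type*} [CommRing R] [IsNoetherianRing R] [IsLocalRing R]
    (x y : R) (hm : maximalIdeal R = Ideal.span {x, y}) (hf : x * x ^ 2 + y * y = 0)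
    (hd : 1 ≤ ringKrullDim R) : IsDomain R ∧ ringKrullDim R ≤ 1 := by
  have hxm : x ∈ maximalIdeal R := hm ▸ Ideal.subset_span (by simp)
  have hkey : ∀ p : Ideal R, p.IsPrime → x ∈ p → maximalIdeal R ≤ p := by
    intro p hp hx
    rw [hm, Ideal.span_le]
    have hy : y * y ∈ p := by
      have : y * y = x * (-x ^ 2) := by linear_combination hf
      rw [this]
      exact Ideal.mul_mem_right _ _ hx
    have hy : y ∈ p := by simpa using hp.mem_or_mem hy
    simp [Set.insert_subset_iff, hx, hy]
  constructor
  · obtain ⟨l, hl⟩ := Order.le_krullDim_iff.mp (show ((1 : ℕ) : WithBot ℕ∞) ≤ _ from hd)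
    have hlt : l.head < l.last := l.strictMono (by rw [Fin.lt_def]; simp [hl])
    have hqp : l.head.asIdeal.IsPrime := l.head.isPrime
    have hqm : ¬ maximalIdeal R ≤ l.head.asIdeal := by
      intro h
      have h1 : l.last.asIdeal ≤ l.head.asIdeal := (le_maximalIdeal l.last.isPrime.ne_top).trans h
      exact absurd h1 (not_le_of_gt hlt)
    generalize l.head.asIdeal = q at hqp hqm
    have hxq : x ∉ q := fun h => hqm (hkey q hqp h)
    have hbot : q = ⊥ := by
      refine aux_nak x hxm q hxq ?_
      intro p hp
      have hpm : p ∈ maximalIdeal R := le_maximalIdeal hqp.ne_top hp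
      rw [hm, Ideal.mem_span_pair] at hpm
      obtain ⟨e, c, rfl⟩ := hpm
      by_cases hc : IsUnit c
      · exfalso
        obtain ⟨c', hc'⟩ := hc.exists_right_inv
        obtain ⟨g, hg⟩ : ∃ g, g = c' * e := ⟨_, rfl⟩
        have h1 : y + x * g ∈ q := by
          have := q.mul_mem_left c' hp
          convert this using 1
          rw [hg]; linear_combination (-y) * hc'
        have h2 : x + g ^ 2 ∈ q := by
          have h3 : x * (x * (x + g ^ 2)) ∈ q := by
            have := q.mul_mem_left (x * g - y) h1
            convert this using 1
            linear_combination hf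
          exact (hqp.mem_or_mem ((hqp.mem_or_mem h3).resolve_left hxq)).resolve_left hxq
        have h4 : g ∈ maximalIdeal R := by
          have : g ^ 2 ∈ maximalIdeal R := by
            have := sub_mem (le_maximalIdeal hqp.ne_top h2) hxm
            simpa using this
          exact Ideal.IsPrime.mem_of_pow_mem inferInstance _ this
        rw [hm, Ideal.mem_span_pair] at h4
        obtain ⟨α, β, hab⟩ := h4
        -- modulo q, g = x * s
        have h5 : g - x * (α - β * g) ∈ q := by
          have := q.mul_mem_left β h1
          convert this using 1
          linear_combination -hab
        have h6 : x * (1 + x * (α - β * g) ^ 2) ∈ q := by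
          have := sub_mem h2 (q.mul_mem_left (g + x * (α - β * g)) h5)
          convert this using 1
          ring
        have h7 := (hqp.mem_or_mem h6).resolve_left hxq
        have h8 : (1 : R) ∈ maximalIdeal R := by
          have := sub_mem (le_maximalIdeal hqp.ne_top h7)
            (Ideal.mul_mem_right ((α - β * g) ^ 2) _ hxm)
          simpa using this
        exact (maximalIdeal.isMaximal R).ne_top ((Ideal.eq_top_iff_one _).2 h8)
      · have hcm : c ∈ maximalIdeal R := hc
        rw [hm, Ideal.mem_span_pair] at hcm
        obtain ⟨a, b, rfl⟩ := hcm
        exact ⟨e + a * y - b * x ^ 2, by linear_combination b * hf⟩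
    have : (⊥ : Ideal R).IsPrime := hbot ▸ hqp
    exact IsDomain.of_bot_isPrime R
  · rw [← maximalIdeal_height_eq_ringKrullDim]
    have := Ideal.height_le_one_of_isPrincipal_of_mem_minimalPrimes_of_isLocalRing
      (Ideal.span {x}) ⟨⟨inferInstance, by simpa using hxm⟩, fun p hp _ =>
        hkey p hp.1 (hp.2 (Ideal.mem_span_singleton_self x))⟩
    exact_mod_cast this

open IsLocalRing in
lemma aux_dim {R : Type*} [CommRing R] [IsNoetherianRing R] [IsLocalRing R]
    (t : R) (ht : t ∈ maximalIdeal R) :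
    ringKrullDim R ≤ ringKrullDim (R ⧸ Ideal.span {t}) + 1 := by
  rw [← maximalIdeal_height_eq_ringKrullDim]
  exact Ideal.height_le_ringKrullDim_quotient_add_one ht

open IsLocalRing in
lemma aux_up {R : Type*} [CommRing R] [IsNoetherianRing R] [IsLocalRing R]
    (t : R) (ht : t ∈ maximalIdeal R) (n : ℕ) (hR : ((n + 1 : ℕ) : WithBot ℕ∞) ≤ ringKrullDim R)
    (hD : IsDomain (R ⧸ Ideal.span {t})) (hn : ringKrullDim (R ⧸ Ideal.span {t}) ≤ n) :
    IsDomain R ∧ ringKrullDim R ≤ (n + 1 : ℕ) := by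
  constructor
  · obtain ⟨l, hl⟩ := Order.le_krullDim_iff.mp hR
    have hqp : l.head.asIdeal.IsPrime := l.head.isPrime
    have hdq : ((n + 1 : ℕ) : WithBot ℕ∞) ≤ ringKrullDim (R ⧸ l.head.asIdeal) := by
      rw [ringKrullDim_quotient, Order.le_krullDim_iff]
      refine ⟨⟨l.length, fun i => ⟨l i, ?_⟩, fun i => l.step i⟩, hl⟩
      exact l.head_le i
    generalize l.head.asIdeal = q at hqp hdq
    have lt_absurd : ∀ {d : WithBot ℕ∞}, ((n + 1 : ℕ) : WithBot ℕ∞) ≤ d → d ≤ n → False := by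
      intro d h1 h2
      have h3 := h1.trans h2
      have : n + 1 ≤ n := by exact_mod_cast h3
      omega
    have htq : t ∉ q := by
      intro h
      refine lt_absurd hdq (le_trans ?_ hn)
      exact ringKrullDim_le_of_surjective
        (Ideal.Quotient.factor (S := Ideal.span {t}) (T := q) (by simpa using h))
        (Ideal.Quotient.factor_surjective _)
    have hbot : q = ⊥ := by
      refine aux_nak t ht q htq ?_
      intro r hr
      by_contra hcon
      have hr' : Ideal.Quotient.mk (Ideal.span {t}) r ≠ 0 := by
        rw [Ne, Ideal.Quotient.eq_zero_iff_mem, Ideal.mem_span_singleton]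
        exact fun ⟨e, he⟩ => hcon ⟨e, he⟩
      have h1 := ringKrullDim_quotient_succ_le_of_nonZeroDivisor
        (mem_nonZeroDivisors_of_ne_zero hr')
      have : IsLocalRing (R ⧸ q) := .of_surjective' _ Ideal.Quotient.mk_surjective
      have htm : Ideal.Quotient.mk q t ∈ maximalIdeal (R ⧸ q) := by
        rw [mem_maximalIdeal, mem_nonunits_iff]
        intro hu
        have := IsLocalHom.of_surjective _ (Ideal.Quotient.mk_surjective (I := q))
        exact ht (isUnit_of_map_unit _ _ hu)
      have h2 := aux_dim (Ideal.Quotient.mk q t) htm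
      refine lt_absurd (hdq.trans h2) (le_trans ?_ (h1.trans hn))
      gcongr
      let f : R →+* (R ⧸ q) ⧸ Ideal.span {Ideal.Quotient.mk q t} :=
        (Ideal.Quotient.mk _).comp (Ideal.Quotient.mk q)
      have hf : Function.Surjective f :=
        Ideal.Quotient.mk_surjective.comp Ideal.Quotient.mk_surjective
      have hft : f t = 0 := Ideal.Quotient.eq_zero_iff_mem.2 (Ideal.mem_span_singleton_self _)
      have hfr : f r = 0 := by
        simp [f, Ideal.Quotient.eq_zero_iff_mem.2 hr]
      let g : R ⧸ Ideal.span {t} →+* _ := Ideal.Quotient.lift (Ideal.span {t}) f (by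
        intro a ha
        obtain ⟨b, rfl⟩ := Ideal.mem_span_singleton.1 ha
        simp [hft])
      have hg : Function.Surjective g := Ideal.Quotient.lift_surjective_of_surjective _ _ hf
      refine ringKrullDim_le_of_surjective (Ideal.Quotient.lift
        (Ideal.span {Ideal.Quotient.mk (Ideal.span {t}) r}) g ?_)
        (Ideal.Quotient.lift_surjective_of_surjective _ _ hg)
      intro a ha
      obtain ⟨b, rfl⟩ := Ideal.mem_span_singleton.1 ha
      rw [map_mul, show g (Ideal.Quotient.mk _ r) = f r from rfl, hfr, zero_mul]
    have : (⊥ : Ideal R).IsPrime := hbot ▸ hqp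
    exact IsDomain.of_bot_isPrime R
  · refine (aux_dim t ht).trans ?_
    push_cast
    gcongr

open IsLocalRing in
lemma aux_quot {R : Type*} [CommRing R] [IsLocalRing R]
    (t : R) (ht : t ∈ maximalIdeal R) :
    ∃ _ : IsLocalRing (R ⧸ Ideal.span {t}), maximalIdeal (R ⧸ Ideal.span {t}) =
      (maximalIdeal R).map (Ideal.Quotient.mk (Ideal.span {t})) := by
  have : Nontrivial (R ⧸ Ideal.span {t}) := Ideal.Quotient.nontrivial_iff.2 fun h =>
    (maximalIdeal.isMaximal R).ne_top (top_le_iff.1 (h ▸ by simpa using ht))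
  have hL : IsLocalRing (R ⧸ Ideal.span {t}) := .of_surjective' _ Ideal.Quotient.mk_surjective
  refine ⟨hL, ?_⟩
  have := IsLocalHom.of_surjective _ (Ideal.Quotient.mk_surjective (I := Ideal.span {t}))
  rw [← maximalIdeal_comap (Ideal.Quotient.mk (Ideal.span {t})),
    Ideal.map_comap_of_surjective _ Ideal.Quotient.mk_surjective]

lemma aux_arith {n : ℕ} {d e : WithBot ℕ∞} (h : ((n + 1 : ℕ) : WithBot ℕ∞) ≤ d)
    (h' : d ≤ e + 1) : (n : WithBot ℕ∞) ≤ e := by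
  have := h.trans h'
  push_cast at this
  exact ENat.WithBot.add_le_add_one_right_iff.1 this

open IsLocalRing in
lemma aux_three {R : Type*} [CommRing R] [IsNoetherianRing R] [IsLocalRing R]
    (x y u : R) (hm : maximalIdeal R = Ideal.span {x, y, u}) (hf : x * u + y * y = 0)
    (hd : ((1 + 1 : ℕ) : WithBot ℕ∞) ≤ ringKrullDim R) :
    IsDomain R ∧ ringKrullDim R ≤ (1 + 1 : ℕ) := by
  have hxm : x ∈ maximalIdeal R := hm ▸ Ideal.subset_span (by simp)
  have hum : u ∈ maximalIdeal R := hm ▸ Ideal.subset_span (by simp)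
  have ht : u - x ^ 2 ∈ maximalIdeal R :=
    sub_mem hum (Ideal.pow_mem_of_mem _ hxm 2 (by norm_num))
  obtain ⟨hL, hmax⟩ := aux_quot _ ht
  have hq : Ideal.Quotient.mk (Ideal.span {u - x ^ 2}) u =
      Ideal.Quotient.mk (Ideal.span {u - x ^ 2}) x ^ 2 := by
    rw [← map_pow, Ideal.Quotient.eq]
    exact Ideal.mem_span_singleton_self _
  have := aux_cusp (R := R ⧸ Ideal.span {u - x ^ 2}) (Ideal.Quotient.mk _ x)
    (Ideal.Quotient.mk _ y) ?_ ?_ ?_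
  · exact aux_up _ ht 1 hd this.1 (by exact_mod_cast this.2)
  · rw [hmax, hm, Ideal.map_span]
    simp only [Set.image_insert_eq, Set.image_singleton, hq]
    apply le_antisymm
    · rw [Ideal.span_le]
      have h1 : Ideal.Quotient.mk (Ideal.span {u - x ^ 2}) x ∈ Ideal.span
        {Ideal.Quotient.mk (Ideal.span {u - x ^ 2}) x,
          Ideal.Quotient.mk (Ideal.span {u - x ^ 2}) y} := Ideal.subset_span (by simp)
      rintro z (rfl | rfl | rfl)
      · exact h1
      · exact Ideal.subset_span (by simp)
      · exact Ideal.pow_mem_of_mem _ h1 2 (by norm_num)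
    · apply Ideal.span_mono
      rintro z (rfl | rfl) <;> simp
  · rw [← hq, ← map_mul, ← map_mul, ← map_add, hf, map_zero]
  · exact_mod_cast aux_arith hd (aux_dim _ ht)

open IsLocalRing in
lemma aux_four {R : Type*} [CommRing R] [IsNoetherianRing R] [IsLocalRing R]
    (x y u v : R) (hm : maximalIdeal R = Ideal.span {x, y, u, v}) (hf : x * u + y * v = 0)
    (hd : ((2 + 1 : ℕ) : WithBot ℕ∞) ≤ ringKrullDim R) :
    IsDomain R ∧ ringKrullDim R ≤ (2 + 1 : ℕ) := by
  have hvm : v ∈ maximalIdeal R := hm ▸ Ideal.subset_span (by simp)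
  have hym : y ∈ maximalIdeal R := hm ▸ Ideal.subset_span (by simp)
  have ht : v - y ∈ maximalIdeal R := sub_mem hvm hym
  obtain ⟨hL, hmax⟩ := aux_quot _ ht
  have hq : Ideal.Quotient.mk (Ideal.span {v - y}) v = Ideal.Quotient.mk (Ideal.span {v - y}) y := by
    rw [Ideal.Quotient.eq]
    exact Ideal.mem_span_singleton_self _
  have := aux_three (R := R ⧸ Ideal.span {v - y}) (Ideal.Quotient.mk _ x)
    (Ideal.Quotient.mk _ y) (Ideal.Quotient.mk _ u) ?_ ?_ ?_
  · exact aux_up _ ht 2 hd this.1 this.2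
  · rw [hmax, hm, Ideal.map_span]
    simp only [Set.image_insert_eq, Set.image_singleton, hq]
    congr 1
    ext z
    simp only [Set.mem_insert_iff, Set.mem_singleton_iff]
    tauto
  · nth_rw 2 [← hq]
    rw [← map_mul, ← map_mul, ← map_add, hf, map_zero]
  · exact aux_arith hd (aux_dim _ ht)

/-- Let `(S, n)` be a regular local ring of dimension 4 (i.e. a Noetherian
local ring of Krull dimension 4 whose maximal ideal is generated by the regular system of
parameters `x, y, u, v`). Then `a := x*u + y*v` is a prime element of `S`. -/
theorem prime_xu_add_yv {S : Type*} [CommRing S] [IsNoetherianRing S] [IsLocalRing S]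
    (x y u v : S)
    (hgen : IsLocalRing.maximalIdeal S = Ideal.span {x, y, u, v})
    (hdim : ringKrullDim S = 4) :
    Prime (x * u + y * v) := by
  have hxm : x ∈ IsLocalRing.maximalIdeal S := hgen ▸ Ideal.subset_span (by simp)
  have hym : y ∈ IsLocalRing.maximalIdeal S := hgen ▸ Ideal.subset_span (by simp)
  have ha : x * u + y * v ∈ IsLocalRing.maximalIdeal S :=
    add_mem (Ideal.mul_mem_right _ _ hxm) (Ideal.mul_mem_right _ _ hym)
  have hne : x * u + y * v ≠ 0 := by
    intro h0
    have h := (aux_four x y u v hgen h0 (by rw [hdim]; norm_cast)).2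
    rw [hdim] at h
    exact absurd h (by norm_cast)
  obtain ⟨hL, hmax⟩ := aux_quot _ ha
  have := aux_four (R := S ⧸ Ideal.span {x * u + y * v}) (Ideal.Quotient.mk _ x)
    (Ideal.Quotient.mk _ y) (Ideal.Quotient.mk _ u) (Ideal.Quotient.mk _ v) ?_ ?_ ?_
  · have hD := this.1
    rw [← Ideal.span_singleton_prime hne]
    exact (Ideal.Quotient.isDomain_iff_prime _).1 hD
  · rw [hmax, hgen, Ideal.map_span]
    simp only [Set.image_insert_eq, Set.image_singleton]
  · rw [← map_mul, ← map_mul, ← map_add]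
    exact Ideal.Quotient.eq_zero_iff_mem.2 (Ideal.mem_span_singleton_self _)
  · refine aux_arith (n := 3) ?_ (aux_dim _ ha)
    rw [hdim]; norm_cast
end

section
/- Let (S, n) be a regular local ring of dimension 4, let x, y, u, v be a regular system of parameters for S, and set a := x·u + y·v. Then cd((u,v)S, S/aS) = 2, i.e., H^2_{(u,v)S}(S/aS) ≠ 0 and H^i_{(u,v)S}(S/aS) = 0 for all i > 2. -/
universe u
open IsLocalRing in
theorem quot_step {R : Type u} [CommRing R] [IsNoetherianRing R] [IsLocalRing R] (z : R) (s : Set R)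
    (d : ℕ) (hm : maximalIdeal R = Ideal.span (insert z s)) (hd : ((d + 1 : ℕ) : WithBot ℕ∞) ≤ ringKrullDim R) :
    ∃ _ : IsLocalRing (R ⧸ Ideal.span {z}),
      maximalIdeal (R ⧸ Ideal.span {z}) = Ideal.span (Ideal.Quotient.mk (Ideal.span {z}) '' s) ∧
      (d : WithBot ℕ∞) ≤ ringKrullDim (R ⧸ Ideal.span {z}) := by
  have hz : z ∈ maximalIdeal R := hm ▸ Ideal.subset_span (Set.mem_insert _ _)
  have hne : Ideal.span {z} ≠ ⊤ := fun h =>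
    (Ideal.IsPrime.ne_top (inferInstance : (maximalIdeal R).IsPrime))
      (top_le_iff.1 (h ▸ (Ideal.span_singleton_le_iff_mem _).2 hz))
  have : Nontrivial (R ⧸ Ideal.span {z}) := Ideal.Quotient.nontrivial_iff.2 hne
  have hl : IsLocalRing (R ⧸ Ideal.span {z}) :=
    IsLocalRing.of_surjective' _ Ideal.Quotient.mk_surjective
  refine ⟨hl, ?_, ?_⟩
  · have h1 : maximalIdeal (R ⧸ Ideal.span {z}) = (maximalIdeal R).map (Ideal.Quotient.mk _) := by
      symm
      apply IsLocalRing.eq_maximalIdeal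
      have := Ideal.map_eq_top_or_isMaximal_of_surjective (Ideal.Quotient.mk (Ideal.span {z}))
        Ideal.Quotient.mk_surjective (inferInstance : (maximalIdeal R).IsMaximal)
      refine this.resolve_left fun h => ?_
      have h2 := congrArg (Ideal.comap (Ideal.Quotient.mk (Ideal.span {z}))) h
      rw [Ideal.comap_map_of_surjective _ Ideal.Quotient.mk_surjective, Ideal.comap_top,
        ← RingHom.ker_eq_comap_bot, Ideal.mk_ker, sup_eq_left.2 
        ((Ideal.span_singleton_le_iff_mem _).2 hz)] at h2
      exact (Ideal.IsPrime.ne_top (inferInstance : (maximalIdeal R).IsPrime)) h2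
    rw [h1, hm, Ideal.map_span, Set.image_insert_eq]
    rw [(Ideal.Quotient.eq_zero_iff_mem).2 (Ideal.mem_span_singleton_self z)]
    simp
  · have h3 := ringKrullDim_le_ringKrullDim_quotient_add_encard {z} (by simpa [IsLocalRing.ringJacobson_eq_maximalIdeal] using hz)
    have h4 := hd.trans h3
    simp only [Set.encard_singleton, Nat.cast_add, Nat.cast_one] at h4
    exact (ENat.WithBot.add_le_add_one_right_iff).1 (by simpa using h4)

open IsLocalRing in
theorem ne_zero_step {R : Type u} [CommRing R] [IsNoetherianRing R] [IsLocalRing R] (z : R) (s : Set R)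
    (hs : s.Finite)
    (d : ℕ) (hc : s.ncard ≤ d) (hm : maximalIdeal R = Ideal.span (insert z s))
    (hd : ((d + 1 : ℕ) : WithBot ℕ∞) ≤ ringKrullDim R) : z ≠ 0 := by
  rintro rfl
  have h := hd.trans (ringKrullDim_le_spanFinrank_maximalIdeal R)
  rw [hm, Ideal.span_insert_zero] at h
  have := Submodule.spanFinrank_span_le_ncard_of_finite (R := R) hs
  have h2 : d + 1 ≤ (Ideal.span s).spanFinrank := by exact_mod_cast h
  change (Ideal.span s).spanFinrank ≤ _ at this
  omega

open IsLocalRing in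
theorem isDomain_of_reg (d : ℕ) : ∀ (R : Type u) [CommRing R] [IsNoetherianRing R] [IsLocalRing R]
    (s : Set R) (_ : s.Finite) (_ : s.ncard ≤ d) (_ : maximalIdeal R = Ideal.span s)
    (_ : (d : WithBot ℕ∞) ≤ ringKrullDim R), IsDomain R := by
  induction d with
  | zero =>
    intro R _ _ _ s hs hc hm _
    have : s = ∅ := (Set.ncard_eq_zero hs).1 (by omega)
    subst this
    rw [Ideal.span_empty] at hm
    have := IsLocalRing.isField_iff_maximalIdeal_eq.2 hm
    exact this.isDomain
  | succ d ih =>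
    intro R _ _ _ s hs hc hm hd
    have hfin := minimalPrimes.finite_of_isNoetherianRing R
    -- choose z
    obtain ⟨z, hzm, hz2, hzP⟩ : ∃ z ∈ maximalIdeal R, z ∉ (maximalIdeal R) ^ 2 ∧
        ∀ P ∈ minimalPrimes R, z ∉ P := by
      by_contra! hcon
      have hne : maximalIdeal R ∉ minimalPrimes R := fun h => by
        have h0 := Ideal.height_eq_zero_iff.2 h
        have := IsLocalRing.maximalIdeal_height_eq_ringKrullDim (R := R)
        rw [h0] at this
        rw [← this] at hd
        have : d + 1 ≤ 0 := by exact_mod_cast hd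
        omega
      have hsub : ((maximalIdeal R : Ideal R) : Set R) ⊆ ⋃ i ∈ (↑(insert ((maximalIdeal R)^2) hfin.toFinset) : Set (Ideal R)), (id i : Ideal R) := by
        intro z hz
        by_cases h2 : z ∈ (maximalIdeal R)^2
        · exact Set.mem_biUnion (by simp) h2
        · obtain ⟨P, hP, hzP⟩ := hcon z hz h2
          exact Set.mem_biUnion (by simp [hP]) hzP
      rw [Ideal.subset_union_prime ((maximalIdeal R)^2) ((maximalIdeal R)^2)] at hsub
      · obtain ⟨P, hP, hle⟩ := hsub
        simp only [Finset.mem_insert, Set.Finite.mem_toFinset, id] at hP hle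
        rcases hP with rfl | hP
        · have : maximalIdeal R = ⊥ := by
            apply Submodule.eq_bot_of_le_smul_of_le_jacobson_bot (maximalIdeal R) _ (IsNoetherian.noetherian _)
            · rw [smul_eq_mul, ← pow_two]; exact hle
            · exact IsLocalRing.maximalIdeal_le_jacobson _
          have := IsLocalRing.isField_iff_maximalIdeal_eq.2 this
          rw [ringKrullDim_eq_zero_of_isField this] at hd
          have : d + 1 ≤ 0 := by exact_mod_cast hd
          omega
        · have : P.IsPrime := hP.1.1
          have := (IsLocalRing.eq_maximalIdeal (R := R) (I := P))
          have h1 : P = maximalIdeal R := le_antisymm (IsLocalRing.le_maximalIdeal (Ideal.IsPrime.ne_top')) hle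
          exact hne (h1 ▸ hP)
      · intro i hi h1 _
        simp only [Finset.mem_insert, Set.Finite.mem_toFinset, h1, false_or] at hi
        exact hi.1.1
    -- exchange
    obtain ⟨i, his, hmi⟩ : ∃ i ∈ s, maximalIdeal R = Ideal.span (insert z (s \ {i})) := by
      have hzs := hzm
      rw [hm] at hzs
      classical
      obtain ⟨c, hcs, hsum⟩ := Submodule.mem_span_set.1 hzs
      have hsm : ∀ i ∈ s, i ∈ maximalIdeal R := fun i hi => hm ▸ Ideal.subset_span hi
      obtain ⟨i, hic, hu⟩ : ∃ i ∈ c.support, IsUnit (c i) := by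
        by_contra! hcon
        apply hz2
        rw [← hsum, pow_two]
        refine Ideal.sum_mem _ fun i hi => Ideal.mul_mem_mul ?_ (hsm i (hcs hi))
        exact (IsLocalRing.mem_maximalIdeal _).2 (hcon i hi)
      refine ⟨i, hcs hic, le_antisymm ?_ ?_⟩
      · rw [hm, Ideal.span_le]
        intro j hj
        by_cases hji : j = i
        · subst hji
          have hw : ∑ k ∈ c.support \ {j}, c k • k ∈ Ideal.span (insert z (s \ {j})) := by
            refine Ideal.sum_mem _ fun k hk => Ideal.mul_mem_left _ _ (Ideal.subset_span ?_)
            simp only [Finset.mem_sdiff, Finset.mem_singleton] at hk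
            exact Or.inr ⟨hcs hk.1, hk.2⟩
          have hz' : z ∈ Ideal.span (insert z (s \ {j})) := Ideal.subset_span (Or.inl rfl)
          have h5 : c j * j = z - ∑ k ∈ c.support \ {j}, c k • k := by
            rw [← hsum, Finsupp.sum, ← Finset.sum_sdiff (Finset.singleton_subset_iff.2 hic)]
            simp
          have h6 := Ideal.sub_mem _ hz' hw
          rw [← h5] at h6
          exact (Ideal.unit_mul_mem_iff_mem _ hu).1 h6
        · exact Ideal.subset_span (Or.inr ⟨hj, hji⟩)
      · rw [Ideal.span_le]
        rintro j (rfl | hj)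
        · exact hzm
        · exact hsm j hj.1
    obtain ⟨hl, hm', hd'⟩ := quot_step z _ d hmi hd
    have hdom := ih (R ⧸ Ideal.span {z}) _ ((hs.sdiff).image _) 
      ((Set.ncard_image_le hs.sdiff).trans (by rw [Set.ncard_sdiff_singleton_of_mem his]; omega)) hm' hd'
    have hprime : (Ideal.span {z}).IsPrime := (Ideal.Quotient.isDomain_iff_prime _).1 hdom
    obtain ⟨q, hq, hqz⟩ := Ideal.exists_minimalPrimes_le (bot_le : ⊥ ≤ Ideal.span {z})
    have := hq.1.1
    have hqbot : q = ⊥ := by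
      apply Submodule.eq_bot_of_le_smul_of_le_jacobson_bot (maximalIdeal R) _ (IsNoetherian.noetherian _)
      · intro w hw
        obtain ⟨c, rfl⟩ := Ideal.mem_span_singleton'.1 (hqz hw)
        have := (hq.1.1.mem_or_mem hw).resolve_right (hzP q hq)
        rw [mul_comm]
        exact Ideal.mul_mem_mul hzm this
      · exact IsLocalRing.maximalIdeal_le_jacobson _
    subst hqbot
    exact IsDomain.of_bot_isPrime R

open IsLocalRing in
/-- Regular pair data from a regular system of parameters starting with `u, v`. -/
theorem prime_pair {R : Type u} [CommRing R] [IsNoetherianRing R] [IsLocalRing R] (d : ℕ)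
    (p q : R) (s : Set R) (hs : s.Finite) (hc : s.ncard ≤ d)
    (hm : maximalIdeal R = Ideal.span (insert p (insert q s)))
    (hd : ((d + 1 + 1 : ℕ) : WithBot ℕ∞) ≤ ringKrullDim R) :
    IsDomain R ∧ Prime p ∧ ¬ p ∣ q := by
  have hc1 : (insert q s).ncard ≤ d + 1 := (Set.ncard_insert_le _ _).trans (by omega)
  have hc2 : (insert p (insert q s)).ncard ≤ d + 1 + 1 := (Set.ncard_insert_le _ _).trans (by omega)
  have h1 := isDomain_of_reg (d + 1 + 1) R _ ((hs.insert q).insert p) hc2 hm hd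
  have hp0 := ne_zero_step p _ (hs.insert q) (d + 1) hc1 hm hd
  obtain ⟨hl, hm', hd'⟩ := quot_step p _ (d + 1) hm hd
  have hdom := isDomain_of_reg (d + 1) _ _ ((hs.insert q).image _)
    ((Set.ncard_image_le (hs.insert q)).trans hc1) hm' hd'
  rw [Set.image_insert_eq] at hm'
  have hq0 := ne_zero_step _ _ (hs.image _) d ((Set.ncard_image_le hs).trans hc) hm' hd'
  refine ⟨h1, ?_, ?_⟩
  · exact (Ideal.span_singleton_prime hp0).1 ((Ideal.Quotient.isDomain_iff_prime _).1 hdom)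
  · intro h
    exact hq0 (Ideal.Quotient.eq_zero_iff_mem.2 (Ideal.mem_span_singleton.2 h))

open IsLocalRing in
theorem monomial_aux {T : Type u} [CommRing T] [IsDomain T] [IsLocalRing T] (p q : T) (hp : Prime p)
    (hq : ¬ p ∣ q) (hqm : q ∈ maximalIdeal T) (k : ℕ) (a b : T)
    (h : (p * q) ^ k = a * p ^ (k + 1) + b * q ^ (k + 1)) : False := by
  have hpk : p ^ k ∣ b * q ^ (k + 1) := by
    refine ⟨q ^ k - a * p, ?_⟩
    linear_combination -h
  obtain ⟨b', rfl⟩ := hp.pow_dvd_of_dvd_mul_right k (fun h => hq (hp.dvd_of_dvd_pow h)) hpk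
  have h2 : q ^ k = a * p + b' * q ^ (k + 1) := by
    apply mul_left_cancel₀ (pow_ne_zero k hp.ne_zero)
    linear_combination h
  have h3 : p ∣ q ^ k * (1 - b' * q) := ⟨a, by linear_combination h2⟩
  rcases hp.dvd_or_dvd h3 with h4 | h4
  · exact hq (hp.dvd_of_dvd_pow h4)
  · have h5 : p ∈ maximalIdeal T := (mem_maximalIdeal _).2 hp.not_isUnit
    have h6 : (1 - b' * q) ∈ maximalIdeal T := Ideal.mem_of_dvd _ h4 h5
    have h7 : (1 : T) ∈ maximalIdeal T := by
      have := Ideal.add_mem _ h6 (Ideal.mul_mem_left _ b' hqm)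
      rwa [sub_add_cancel] at this
    exact (Ideal.ne_top_iff_one _).1 (Ideal.IsPrime.ne_top') h7

open IsLocalRing in
theorem monomial_main {S : Type u} [CommRing S] [IsNoetherianRing S] [IsLocalRing S]
    (x y u v : S)
    (hgen : IsLocalRing.maximalIdeal S = Ideal.span {x, y, u, v})
    (hdim : ringKrullDim S = 4) (k : ℕ) :
    (u * v) ^ k ∉ Ideal.span {u ^ (k + 1), v ^ (k + 1), x * u + y * v} := by
  obtain ⟨hl, hm, hd⟩ := quot_step x _ 3 hgen (by rw [hdim]; rfl)
  rw [Set.image_insert_eq, Set.image_insert_eq, Set.image_singleton] at hm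
  obtain ⟨hl2, hm2, hd2⟩ := quot_step _ _ 2 hm hd
  rw [Set.image_insert_eq, Set.image_singleton] at hm2
  obtain ⟨hD, hP, hV⟩ := prime_pair 0 _ _ ∅ Set.finite_empty (by simp) (by simpa using hm2) hd2
  intro h
  have h2 := Ideal.mem_map_of_mem ((Ideal.Quotient.mk (Ideal.span {Ideal.Quotient.mk (Ideal.span {x}) y})).comp
    (Ideal.Quotient.mk (Ideal.span {x}))) h
  have hx : Ideal.Quotient.mk (Ideal.span {x}) x = 0 :=
    Ideal.Quotient.eq_zero_iff_mem.2 (Ideal.mem_span_singleton_self _)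
  have hy : Ideal.Quotient.mk (Ideal.span {Ideal.Quotient.mk (Ideal.span {x}) y})
    (Ideal.Quotient.mk (Ideal.span {x}) y) = 0 :=
    Ideal.Quotient.eq_zero_iff_mem.2 (Ideal.mem_span_singleton_self _)
  rw [Ideal.map_span, Set.image_insert_eq, Set.image_insert_eq, Set.image_singleton] at h2
  simp only [RingHom.comp_apply, map_mul, map_add, map_pow, hx, hy, zero_mul, map_zero, add_zero] at h2
  rw [Ideal.mem_span_insert] at h2
  obtain ⟨a, w, hw, h2⟩ := h2
  rw [Ideal.mem_span_insert] at hw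
  obtain ⟨b, w', hw', rfl⟩ := hw
  simp only [Ideal.mem_span_singleton, zero_dvd_iff] at hw'
  subst hw'
  rw [add_zero] at h2
  refine monomial_aux _ _ hP hV ?_ k a b h2
  rw [hm2]
  exact Ideal.subset_span (by simp)

theorem prime_uv {S : Type u} [CommRing S] [IsNoetherianRing S] [IsLocalRing S]
    (x y u v : S)
    (hgen : IsLocalRing.maximalIdeal S = Ideal.span {x, y, u, v})
    (hdim : ringKrullDim S = 4) : IsDomain S ∧ Prime u ∧ ¬ u ∣ v := by
  refine prime_pair 2 u v {x, y} (Set.toFinite _) (Set.ncard_insert_le _ _ |>.trans (by simp)) ?_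
    (by rw [hdim]; rfl)
  rw [hgen]
  congr 1
  ext; simp; tauto
open CategoryTheory Limits Opposite
namespace Kos
variable {S : Type u} [CommRing S]

def X (S : Type u) [CommRing S] : ℕ → ModuleCat.{u} S
  | 0 => ModuleCat.of S S
  | 1 => ModuleCat.of S (S × S)
  | 2 => ModuleCat.of S S
  | _ + 3 => ModuleCat.of S PUnit

/-- `(r,s) ↦ r a + s b`. -/
def l1 (a b : S) : S × S →ₗ[S] S := (LinearMap.mulRight S a).coprod (LinearMap.mulRight S b)
/-- `r ↦ (r b, - r a)`. -/
def l2 (a b : S) : S →ₗ[S] S × S := (LinearMap.mulRight S b).prod (LinearMap.mulRight S (-a))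

def d (a b : S) : ∀ n, X S (n + 1) ⟶ X S n
  | 0 => ModuleCat.ofHom (l1 a b)
  | 1 => ModuleCat.ofHom (l2 a b)
  | _ + 2 => 0

theorem d_d (a b : S) : ∀ n, d a b (n + 1) ≫ d a b n = 0
  | 0 => by
    change ModuleCat.ofHom (l2 a b) ≫ ModuleCat.ofHom (l1 a b) = 0
    rw [← ModuleCat.ofHom_comp]
    ext
    simp [l1, l2, mul_comm]
  | _ + 1 => zero_comp

noncomputable def cx (a b : S) : ChainComplex (ModuleCat.{u} S) ℕ := ChainComplex.of (X S) (d a b) (d_d a b)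

theorem cx_d (a b : S) (n : ℕ) : (cx a b).d (n + 1) n = d a b n := ChainComplex.of_d _ _ _

/-- Koszul-exactness data. -/
structure Good (a b : S) : Prop where
  inj : ∀ r : S, r * b = 0 → r * a = 0 → r = 0
  ex : ∀ r s : S, r * a + s * b = 0 → ∃ c, r = c * b ∧ s = - (c * a)

theorem exactAt {a b : S} (h : Good a b) (n : ℕ) : (cx a b).ExactAt (n + 1) := by
  rw [HomologicalComplex.exactAt_iff' _ (n + 1 + 1) (n + 1) n (by simp) (by simp)]
  match n with
  | 0 =>
    rw [ShortComplex.moduleCat_exact_iff]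
    change ∀ x : S × S, (cx a b).d 1 0 x = 0 → ∃ y : S, (cx a b).d 2 1 y = x
    rw [cx_d, cx_d]
    rintro ⟨r, s⟩ hx
    obtain ⟨c, rfl, rfl⟩ := h.ex r s hx
    refine ⟨c, ?_⟩
    change l2 a b c = _
    simp [l2]
  | 1 =>
    rw [ShortComplex.moduleCat_exact_iff]
    change ∀ x : S, (cx a b).d 2 1 x = 0 → ∃ y : PUnit, (cx a b).d 3 2 y = x
    rw [cx_d, cx_d]
    intro r hx
    have : l2 a b r = 0 := hx
    simp [l2] at this
    obtain rfl := h.inj r this.1 this.2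
    exact ⟨⟨⟩, rfl⟩
  | n + 2 =>
    apply ShortComplex.exact_of_isZero_X₂
    change IsZero (ModuleCat.of S PUnit)
    exact ModuleCat.isZero_of_subsingleton _

instance (n : ℕ) : Projective (X S n) := by
  match n with
  | 0 => exact ModuleCat.projective_of_free (Module.Basis.singleton Unit S)
  | 1 => exact (IsProjective.iff_projective (R := S) (S × S)).1 inferInstance
  | 2 => exact ModuleCat.projective_of_free (Module.Basis.singleton Unit S)
  | n + 3 => exact (IsProjective.iff_projective (R := S) PUnit).1 inferInstance

def aug (a b : S) : X S 0 ⟶ ModuleCat.of S (S ⧸ Ideal.span {a, b}) :=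
  ModuleCat.ofHom (Submodule.mkQ (Ideal.span {a, b}))

theorem d_aug (a b : S) : (cx a b).d 1 0 ≫ aug a b = 0 := by
  rw [cx_d]
  change ModuleCat.ofHom (l1 a b) ≫ ModuleCat.ofHom _ = 0
  rw [← ModuleCat.ofHom_comp]
  have : (Submodule.mkQ (Ideal.span {a, b})).comp (l1 a b) = 0 := by
    apply LinearMap.ext
    rintro ⟨r, s⟩
    simp only [LinearMap.comp_apply, Submodule.mkQ_apply, LinearMap.zero_apply, Submodule.Quotient.mk_eq_zero]
    simp only [l1, LinearMap.coprod_apply, LinearMap.mulRight_apply]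
    exact Ideal.mem_span_pair.2 ⟨r, s, rfl⟩
  rw [this]; rfl

theorem exact0 (a b : S) : (ShortComplex.mk _ _ (d_aug a b)).Exact := by
  rw [ShortComplex.moduleCat_exact_iff]
  change ∀ x : S, aug a b x = 0 → ∃ y : S × S, (cx a b).d 1 0 y = x
  rw [cx_d]
  intro x hx
  have : x ∈ Ideal.span {a, b} := (Submodule.Quotient.mk_eq_zero _).1 hx
  obtain ⟨r, s, rfl⟩ := Ideal.mem_span_pair.1 this
  exact ⟨(r, s), rfl⟩

instance (a b : S) : Epi (aug a b) := (ModuleCat.epi_iff_surjective _).2 (Submodule.mkQ_surjective _)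

noncomputable def res {a b : S} (h : Good a b) : ProjectiveResolution (ModuleCat.of S (S ⧸ Ideal.span {a, b})) where
  complex := cx a b
  projective n := inferInstanceAs (Projective (X S n))
  π := (ChainComplex.toSingle₀Equiv _ _).symm ⟨aug a b, d_aug a b⟩
  quasiIso := ⟨fun n => by
    cases n
    · rw [ChainComplex.quasiIsoAt₀_iff, ShortComplex.quasiIso_iff_of_zeros']
      · refine (ShortComplex.exact_and_epi_g_iff_of_iso ?_).2
          ⟨exact0 a b, inferInstanceAs (Epi (aug a b))⟩
        exact ShortComplex.isoMk (Iso.refl _) (Iso.refl _) (Iso.refl _)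
          ((Category.id_comp _).trans (Category.comp_id _).symm) ((Category.id_comp _).trans (Category.comp_id _).symm)
      all_goals rfl
    · rw [quasiIsoAt_iff_exactAt']
      · exact exactAt h _
      · apply ChainComplex.exactAt_succ_single_obj⟩

/-- comparison -/
def homf (p q : S) : ∀ n, X S n ⟶ X S n
  | 0 => 𝟙 _
  | 1 => ModuleCat.ofHom ((LinearMap.mulRight S p).prodMap (LinearMap.mulRight S q))
  | 2 => ModuleCat.ofHom (LinearMap.mulRight S (p * q))
  | _ + 3 => 0

noncomputable def hom (a b p q : S) : cx (a * p) (b * q) ⟶ cx a b :=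
  ChainComplex.ofHom (homf p q) (by
    intro n
    match n with
    | 0 =>
      change ModuleCat.ofHom _ ≫ ModuleCat.ofHom (l1 a b) = ModuleCat.ofHom (l1 (a * p) (b * q)) ≫ 𝟙 _
      rw [← ModuleCat.ofHom_comp, Category.comp_id]
      congr 1
      ext <;> simp [l1, mul_comm]
    | 1 =>
      change ModuleCat.ofHom _ ≫ ModuleCat.ofHom (l2 a b) = ModuleCat.ofHom (l2 (a * p) (b * q)) ≫ ModuleCat.ofHom _
      rw [← ModuleCat.ofHom_comp, ← ModuleCat.ofHom_comp]
      congr 1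
      ext <;> simp [l2] <;> ring
    | n + 2 =>
      rw [cx_d, cx_d]
      exact (zero_comp (X := X S (n + 3)) (Y := X S (n + 3)) (Z := X S (n + 2))).trans
        (zero_comp (X := X S (n + 3)) (Y := X S (n + 2)) (Z := X S (n + 2))).symm)

theorem res_comm {a b p q : S} (h : Good a b) (h' : Good (a * p) (b * q))
    (hle : Ideal.span {a * p, b * q} ≤ Ideal.span {a, b}) :
    (hom a b p q).f 0 ≫ (res h).π.f 0 = (res h').π.f 0 ≫
      ModuleCat.ofHom (Submodule.mapQ _ (Ideal.span {a, b}) LinearMap.id hle) := by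
  have h1 : (res h).π.f 0 = aug a b := by
    exact ChainComplex.toSingle₀Equiv_symm_apply_f_zero _ _
  have h2 : (res h').π.f 0 = aug (a * p) (b * q) := by
    exact ChainComplex.toSingle₀Equiv_symm_apply_f_zero _ _
  rw [h1, h2]
  rfl
end Kos

namespace Kos
variable {S : Type u} [CommRing S]
section
variable {D : Type*} [Category D] [Abelian D]

noncomputable def homι (K : ChainComplex D ℕ) (h : K.d 3 2 = 0) : K.homology 2 ⟶ K.X 2 :=
  haveI := K.isIso_homologyπ 3 2 (by simp) h
  inv (K.homologyπ 2) ≫ K.iCycles 2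

theorem homι_d (K : ChainComplex D ℕ) (h : K.d 3 2 = 0) : homι K h ≫ K.d 2 1 = 0 := by
  simp [homι]

theorem homι_exact (K : ChainComplex D ℕ) (h : K.d 3 2 = 0) :
    (ShortComplex.mk _ _ (homι_d K h)).Exact := by
  have := K.isIso_homologyπ 3 2 (by simp) h
  have h1 : (ShortComplex.mk (K.iCycles 2) (K.d 2 1) (by simp)).Exact :=
    ShortComplex.exact_of_f_is_kernel _ (K.cyclesIsKernel 2 1 (by simp))
  refine ShortComplex.exact_of_iso ?_ h1
  exact ShortComplex.isoMk (asIso (K.homologyπ 2)) (Iso.refl _) (Iso.refl _) (by simp [homι]) (by simp)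

theorem homι_nat {K L : ChainComplex D ℕ} (φ : K ⟶ L) (h : K.d 3 2 = 0) (h' : L.d 3 2 = 0) :
    HomologicalComplex.homologyMap φ 2 ≫ homι L h' = homι K h ≫ φ.f 2 := by
  have := K.isIso_homologyπ 3 2 (by simp) h
  have := L.isIso_homologyπ 3 2 (by simp) h'
  rw [← cancel_epi (K.homologyπ 2)]
  simp [homι, HomologicalComplex.homologyπ_naturality_assoc]

variable {C : Type*} [Category C] [Abelian C] [HasProjectiveResolutions C] (F : C ⥤ D) [F.Additive]

theorem map_d_zero {Y : C} (Q : ProjectiveResolution Y) (hQ : Q.complex.d 3 2 = 0) :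
    ((F.mapHomologicalComplex (ComplexShape.down ℕ)).obj Q.complex).d 3 2 = 0 :=
  (congrArg F.map hQ).trans (F.map_zero _ _)

noncomputable def leftι {Y : C} (Q : ProjectiveResolution Y) (hQ : Q.complex.d 3 2 = 0) :
    (F.leftDerived 2).obj Y ⟶ F.obj (Q.complex.X 2) :=
  (Q.isoLeftDerivedObj F 2).hom ≫
    homι ((F.mapHomologicalComplex _).obj Q.complex) (map_d_zero F Q hQ)

theorem leftι_d {Y : C} (Q : ProjectiveResolution Y) (hQ : Q.complex.d 3 2 = 0) :
    leftι F Q hQ ≫ F.map (Q.complex.d 2 1) = 0 := by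
  have := homι_d ((F.mapHomologicalComplex _).obj Q.complex) (map_d_zero F Q hQ)
  refine (Category.assoc _ _ _).trans ?_
  exact (congrArg (fun t => (Q.isoLeftDerivedObj F 2).hom ≫ t) this).trans comp_zero

theorem leftι_exact {Y : C} (Q : ProjectiveResolution Y) (hQ : Q.complex.d 3 2 = 0) :
    (ShortComplex.mk _ _ (leftι_d F Q hQ)).Exact := by
  refine ShortComplex.exact_of_iso ?_
    (homι_exact ((F.mapHomologicalComplex _).obj Q.complex) (map_d_zero F Q hQ))
  refine ShortComplex.isoMk (Q.isoLeftDerivedObj F 2).symm (Iso.refl _) (Iso.refl _) ?_ ?_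
  · exact ((Q.isoLeftDerivedObj F 2).inv_hom_id_assoc _).trans (Category.comp_id _).symm
  · exact (Category.id_comp _).trans (Category.comp_id _).symm

theorem leftι_nat {X Y : C} (h : X ⟶ Y) (P : ProjectiveResolution X) (Q : ProjectiveResolution Y)
    (hP : P.complex.d 3 2 = 0) (hQ : Q.complex.d 3 2 = 0)
    (φ : P.complex ⟶ Q.complex) (comm : φ.f 0 ≫ Q.π.f 0 = P.π.f 0 ≫ h) :
    (F.leftDerived 2).map h ≫ leftι F Q hQ = leftι F P hP ≫ F.map (φ.f 2) := by
  have h1 := homι_nat ((F.mapHomologicalComplex _).map φ) (map_d_zero F P hP) (map_d_zero F Q hQ)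
  refine (ProjectiveResolution.isoLeftDerivedObj_hom_naturality_assoc h P Q φ comm F 2 _).trans ?_
  exact (congrArg (fun t => (P.isoLeftDerivedObj F 2).hom ≫ t) h1).trans (Category.assoc _ _ _).symm
end

theorem ext_class {X' : ModuleCat.{u} S} (M : ModuleCat.{u} S) (P' : ProjectiveResolution X')
    (hP' : P'.complex.d 3 2 = 0) (f : P'.complex.X 2 ⟶ M) :
    ∃ c : ((Ext S (ModuleCat.{u} S) 2).obj (op X')).obj M,
      ∀ (X : ModuleCat.{u} S) (h : X ⟶ X') (P : ProjectiveResolution X)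
        (φ : P.complex ⟶ P'.complex) (_ : φ.f 0 ≫ P'.π.f 0 = P.π.f 0 ≫ h)
        (_ : P.complex.d 3 2 = 0),
        ((Ext S (ModuleCat.{u} S) 2).map h.op).app M c = 0 →
        ∃ g : P.complex.X 1 ⟶ M, φ.f 2 ≫ f = P.complex.d 2 1 ≫ g := by
  let F := ((linearYoneda S (ModuleCat.{u} S)).obj M).rightOp
  refine ⟨(leftι F P' hP').unop f, ?_⟩
  intro X h P φ comm hP hzero
  have hnat := leftι_nat F h P P' hP hP' φ comm
  have hex := leftι_exact F P hP
  have hz2 : (leftι F P hP).unop ((F.map (φ.f 2)).unop f) = 0 := by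
    have := congrArg (fun t => t.unop f) hnat
    exact this.symm.trans hzero
  obtain ⟨g, hg⟩ := (ShortComplex.moduleCat_exact_iff _).1 hex.unop _ hz2
  exact ⟨g, hg.symm⟩

theorem ext_zero {X M : ModuleCat.{u} S} (P : ProjectiveResolution X) (n : ℕ) (h : IsZero (P.complex.X n)) :
    IsZero (((Ext S (ModuleCat.{u} S) n).obj (op X)).obj M) := by
  refine IsZero.of_iso ?_ (P.isoExt n M)
  rw [← HomologicalComplex.exactAt_iff_isZero_homology, HomologicalComplex.exactAt_iff]
  refine ShortComplex.exact_of_isZero_X₂ _ ?_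
  rw [IsZero.iff_id_eq_zero]
  ext (x : _ ⟶ _)
  obtain rfl : x = 0 := h.eq_of_src _ _
  rfl
end Kos

namespace Kos
open localCohomology

/-- The diagram `t ↦ (u^(t+1), v^(t+1))` -/
def pw {S : Type u} [CommRing S] (u v : S) : ℕᵒᵖ ⥤ Ideal S where
  obj t := Ideal.span {u ^ (unop t + 1), v ^ (unop t + 1)}
  map {s t} w := ⟨⟨by
    have h : unop t ≤ unop s := w.unop.down.down
    rw [Ideal.span_le]
    rintro z (rfl | rfl)
    · exact Ideal.mem_of_dvd _ (pow_dvd_pow u (by omega : unop t + 1 ≤ unop s + 1))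
        (Ideal.subset_span (by simp))
    · exact Ideal.mem_of_dvd _ (pow_dvd_pow v (by omega : unop t + 1 ≤ unop s + 1))
        (Ideal.subset_span (by simp))⟩⟩

def pwRad {S : Type u} [CommRing S] (u v : S) : ℕᵒᵖ ⥤ SelfLERadical (Ideal.span {u, v}) :=
  ObjectProperty.lift _ (pw u v) fun k => by
    change _ ≤ (Ideal.span {u ^ (unop k + 1), v ^ (unop k + 1)}).radical
    rw [Ideal.span_le]
    rintro z (rfl | rfl)
    · exact ⟨unop k + 1, Ideal.subset_span (by simp)⟩
    · exact ⟨unop k + 1, Ideal.subset_span (by simp)⟩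

instance pwRad_initial {S : Type u} [CommRing S] [hR : IsNoetherian S S] (u v : S) :
    Functor.Initial (pwRad u v) where
  out J' := by
    apply +allowSynthFailures zigzag_isConnected
    · obtain ⟨k, hk⟩ := Ideal.exists_pow_le_of_le_radical_of_fg J'.2 (isNoetherian_def.mp hR _)
      have hk2 : Ideal.span {u ^ (k + 1), v ^ (k + 1)} ≤ J'.1 := by
        refine le_trans ?_ ((Ideal.pow_le_pow_right (Nat.le_succ k)).trans hk)
        rw [Ideal.span_le]
        rintro z (rfl | rfl)
        · exact Ideal.pow_mem_pow (Ideal.subset_span (by simp)) _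
        · exact Ideal.pow_mem_pow (Ideal.subset_span (by simp)) _
      exact ⟨CostructuredArrow.mk (⟨⟨⟨hk2⟩⟩⟩ : (pwRad u v).obj (op k) ⟶ J')⟩
    · intro j1 j2
      apply Relation.ReflTransGen.single
      rcases le_total (unop j1.left) (unop j2.left) with h | h
      · right; exact ⟨CostructuredArrow.homMk (homOfLE h).op rfl⟩
      · left; exact ⟨CostructuredArrow.homMk (homOfLE h).op rfl⟩

noncomputable def pwIso {S : Type u} [CommRing S] [IsNoetherian S S] (u v : S) (i : ℕ) :
    localCohomology (Ideal.span {u, v}) i ≅ ofDiagram.{u, 0} (pw u v) i :=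
  (isoSelfLERadical (Ideal.span {u, v}) i).symm ≪≫
    (localCohomology.isoOfFinal.{u, u, 0} (pwRad u v)
      (selfLERadicalDiagram.{u} (Ideal.span {u, v})) i).symm ≪≫
      HasColimit.isoOfNatIso.{0, 0, u + 1, u + 1} (Iso.refl.{u + 1, u + 1} _)

theorem good_pow {S : Type u} [CommRing S] [IsDomain S] (u v : S) (hu : Prime u) (huv : ¬ u ∣ v)
    (k : ℕ) : Good (u ^ k) (v ^ k) where
  inj r _ h := (mul_eq_zero.1 h).resolve_right (pow_ne_zero _ hu.ne_zero)
  ex r s h := by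
    have h1 : u ^ k ∣ s * v ^ k := ⟨-r, by linear_combination h⟩
    obtain ⟨c, rfl⟩ := hu.pow_dvd_of_dvd_mul_right k (fun h => huv (hu.dvd_of_dvd_pow h)) h1
    refine ⟨-c, ?_, by ring⟩
    apply mul_left_cancel₀ (pow_ne_zero k hu.ne_zero)
    linear_combination h

theorem isZero_colim {S : Type u} [CommRing S] (I : ℕᵒᵖ ⥤ Ideal S) (i : ℕ)
    (h : ∀ t M, IsZero (((diagram I i).obj t).obj M)) (M : ModuleCat.{u} S) :
    IsZero ((ofDiagram.{u, 0} I i).obj M) := by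
  have := hasColimitDiagram.{u, 0} I i
  have h1 : IsZero (colimit (diagram I i)) := by
    rw [IsZero.iff_id_eq_zero]
    apply colimit.hom_ext
    intro j
    apply IsZero.eq_of_src
    exact Functor.isZero _ (h j)
  exact (Functor.isZero_iff _).1 h1 M

theorem colim_rep_zero {S : Type u} [CommRing S] (I : ℕᵒᵖ ⥤ Ideal S) (i : ℕ) (M : ModuleCat.{u} S)
    (t : ℕ) (c : ((diagram I i).obj (op (op t))).obj M)
    (h : Subsingleton ((ofDiagram.{u, 0} I i).obj M)) :
    ∃ (s : ℕ) (w : (op s : ℕᵒᵖ) ⟶ op t), ((diagram I i).map w.op).app M c = 0 := by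
  have := hasColimitDiagram.{u, 0} I i
  let ev := (evaluation (ModuleCat.{u} S) (ModuleCat.{u} S)).obj M
  have hc : IsColimit (ev.mapCocone (colimit.cocone (diagram I i))) :=
    isColimitOfPreserves ev (colimit.isColimit _)
  have := ModuleCat.FilteredColimits.forget_preservesFilteredColimits (R := S)
  have := preservesFilteredColimitsOfSize_shrink.{0, u, 0, u} (forget (ModuleCat.{u} S))
  have : PreservesColimitsOfShape ℕᵒᵖᵒᵖ (forget (ModuleCat.{u} S)) :=
    PreservesFilteredColimitsOfSize.preserves_filtered_colimits _
  obtain ⟨k, f, g, hfg⟩ := Concrete.isColimit_exists_of_rep_eq (F := diagram I i ⋙ ev) hc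
    (i := op (op t)) (j := op (op t)) c (0 : ((diagram I i).obj (op (op t))).obj M) (h.elim _ _)
  refine ⟨k.unop.unop, f.unop, ?_⟩
  exact hfg.trans (map_zero _)

end Kos

theorem cd_span_uv_quotient_eq_two {S : Type u} [CommRing S] [IsNoetherianRing S] [IsLocalRing S]
    (x y u v : S)
    (hgen : IsLocalRing.maximalIdeal S = Ideal.span {x, y, u, v})
    (hdim : ringKrullDim S = 4) :
    Nontrivial ((localCohomology (Ideal.span {u, v}) 2).obj
        (ModuleCat.of S (S ⧸ Ideal.span {x * u + y * v}))) ∧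
      ∀ i : ℕ, 2 < i →
        Subsingleton ((localCohomology (Ideal.span {u, v}) i).obj
          (ModuleCat.of S (S ⧸ Ideal.span {x * u + y * v}))) := by
  obtain ⟨hD, hu, huv⟩ := prime_uv x y u v hgen hdim
  have : IsNoetherian S S := inferInstance
  constructor
  · rw [← not_subsingleton_iff_nontrivial]
    intro hsub
    set M := ModuleCat.of S (S ⧸ Ideal.span {x * u + y * v}) with hM
    have hsub2 : Subsingleton ((localCohomology.ofDiagram.{u, 0} (Kos.pw u v) 2).obj M) :=
      ((Kos.pwIso u v 2).app M).toLinearEquiv.symm.toEquiv.subsingleton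
    have g0 := Kos.good_pow u v hu huv (0 + 1)
    have hz (a b : S) : (Kos.cx a b).d 3 2 = 0 := Kos.cx_d a b 2
    obtain ⟨c, hc⟩ := Kos.ext_class M (Kos.res g0) (hz _ _)
      (ModuleCat.ofHom (Submodule.mkQ (Ideal.span {x * u + y * v})))
    obtain ⟨s, w, hw⟩ := Kos.colim_rep_zero (Kos.pw u v) 2 M 0 c hsub2
    have gs := Kos.good_pow u v hu huv (s + 1)
    have e1 (p : S) : p ^ (s + 1) = p ^ (0 + 1) * p ^ s := by ring
    have gs' : Kos.Good (u ^ (0 + 1) * u ^ s) (v ^ (0 + 1) * v ^ s) := by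
      rw [← e1, ← e1]; exact gs
    have hle : Ideal.span {u ^ (0 + 1) * u ^ s, v ^ (0 + 1) * v ^ s} ≤
        Ideal.span {u ^ (0 + 1), v ^ (0 + 1)} := by
      rw [← e1, ← e1]; exact ((Kos.pw u v).map w).down.down
    have key := hc _ _ (Kos.res gs') (Kos.hom _ _ _ _) (Kos.res_comm g0 gs' hle) (hz _ _)
    have hw2 : ((Ext S (ModuleCat.{u} S) 2).map (Quiver.Hom.op (ModuleCat.ofHom
        (Submodule.mapQ (Ideal.span {u ^ (0 + 1) * u ^ s, v ^ (0 + 1) * v ^ s})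
          (Ideal.span {u ^ (0 + 1), v ^ (0 + 1)}) LinearMap.id hle)))).app M c = 0 := by
      clear key hz gs'
      have gen : ∀ (I J : Ideal S) (h : I = (Kos.pw u v).obj (op s)) 
          (hle : I ≤ Ideal.span {u ^ (0 + 1), v ^ (0 + 1)}),
          ((Ext S (ModuleCat.{u} S) 2).map (Quiver.Hom.op (ModuleCat.ofHom
          (Submodule.mapQ I (Ideal.span {u ^ (0 + 1), v ^ (0 + 1)}) LinearMap.id hle)))).app M c = 0 := by
        rintro I J rfl hle
        exact hw
      exact gen _ ⊥ (by rw [← e1, ← e1]; rfl) hle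
    obtain ⟨g, hg⟩ := key hw2
    have hd21 : (Kos.res gs').complex.d 2 1 =
        Kos.d (u ^ (0 + 1) * u ^ s) (v ^ (0 + 1) * v ^ s) 1 := Kos.cx_d _ _ 1
    rw [hd21] at hg
    let g' : S × S →ₗ[S] S ⧸ Ideal.span {x * u + y * v} := ModuleCat.Hom.hom g
    have hg1 : Submodule.mkQ (Ideal.span {x * u + y * v}) (1 * (u ^ s * v ^ s)) =
        g' (Kos.l2 (u ^ (0 + 1) * u ^ s) (v ^ (0 + 1) * v ^ s) 1) :=
      congrArg (fun t => (ModuleCat.Hom.hom t) (1 : S)) hg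
    have hpair : Kos.l2 (u ^ (0 + 1) * u ^ s) (v ^ (0 + 1) * v ^ s) 1 =
        v ^ (s + 1) • ((1 : S), (0 : S)) + u ^ (s + 1) • ((0 : S), (-1 : S)) := by
      rw [e1, e1]
      simp [Kos.l2]
    rw [hpair, map_add, map_smul, map_smul] at hg1
    obtain ⟨p, hp⟩ := Submodule.mkQ_surjective _ (g' (1, 0))
    obtain ⟨q, hq⟩ := Submodule.mkQ_surjective _ (g' (0, -1))
    rw [← hp, ← hq, ← map_smul, ← map_smul, ← map_add] at hg1
    have hmem := (Submodule.Quotient.eq _).1 hg1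
    obtain ⟨r, hr⟩ := Ideal.mem_span_singleton'.1 hmem
    apply monomial_main x y u v hgen hdim s
    have hfin : (u * v) ^ s = q * u ^ (s + 1) + (p * v ^ (s + 1) + r * (x * u + y * v)) := by
      simp only [smul_eq_mul] at hr
      rw [mul_pow]
      linear_combination -hr
    rw [hfin]
    refine Ideal.add_mem _ (Ideal.mul_mem_left _ _ (Ideal.subset_span (by simp)))
      (Ideal.add_mem _ (Ideal.mul_mem_left _ _ (Ideal.subset_span (by simp)))
        (Ideal.mul_mem_left _ _ (Ideal.subset_span (by simp))))
  · intro i hi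
    rw [← ModuleCat.isZero_iff_subsingleton] 
    refine IsZero.of_iso ?_ ((Kos.pwIso u v i).app _)
    apply Kos.isZero_colim
    intro t M
    refine Kos.ext_zero (Kos.res (Kos.good_pow u v hu huv (unop (unop t) + 1))) i ?_
    obtain ⟨j, rfl⟩ : ∃ j, i = j + 3 := ⟨i - 3, by omega⟩
    exact ModuleCat.isZero_of_subsingleton (ModuleCat.of S PUnit)
end

section
/- Let (S, n) be a regular local ring of dimension 4, let x, y, u, v be a regular system of parameters for S, and set a := x·u + y·v. Then the support of the S-module H^2_{(u,v)S}(S/aS) is exactly {n}. -/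
universe u

set_option linter.unusedSectionVars false

section partA
open IsLocalRing

theorem aux_davis {R : Type*} [CommRing R] (s : Finset (Ideal R)) (hp : ∀ P ∈ s, P.IsPrime)
    (hinc : ∀ P ∈ s, ∀ Q ∈ s, P ≤ Q → P = Q) (x : R) (J : Ideal R)
    (h : ∀ P ∈ s, ¬ (Ideal.span {x} ⊔ J ≤ P)) : ∃ c ∈ J, ∀ P ∈ s, x + c ∉ P := by
  classical
  let A := s.filter (fun P => x ∈ P)
  let B := s.filter (fun P => x ∉ P)
  let K : Ideal R := J ⊓ B.inf id
  have hK : ¬ ((K : Set R) ⊆ ⋃ P ∈ (↑A : Set (Ideal R)), (P : Set R)) := by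
    rw [Ideal.subset_union_prime (f := fun P : Ideal R => P) ⊥ ⊥
      (fun i hi _ _ => hp i (Finset.mem_filter.1 hi).1)]
    rintro ⟨P, hPA, hKP⟩
    obtain ⟨hPs, hxP⟩ := Finset.mem_filter.1 hPA
    have hPp := hp P hPs
    rcases (Ideal.IsPrime.inf_le hPp).1 hKP with h1 | h1
    · exact h P hPs (sup_le ((Ideal.span_singleton_le_iff_mem _).2 hxP) h1)
    · obtain ⟨Q, hQ, hQP⟩ := (Ideal.IsPrime.inf_le' hPp).1 h1
      obtain ⟨hQs, hxQ⟩ := Finset.mem_filter.1 hQ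
      exact hxQ (hinc Q hQs P hPs hQP ▸ hxP)
  obtain ⟨c, hcK, hc⟩ := Set.not_subset.1 hK
  refine ⟨c, hcK.1, fun P hP hmem => ?_⟩
  by_cases hx : x ∈ P
  · refine hc ?_
    simp only [Set.mem_iUnion]
    exact ⟨P, Finset.mem_coe.2 (Finset.mem_filter.2 ⟨hP, hx⟩), (P.add_mem_iff_right hx).1 hmem⟩
  · have : c ∈ P := (Finset.inf_le (f := id) (Finset.mem_filter.2 ⟨hP, hx⟩) : B.inf id ≤ P) hcK.2
    exact hx ((P.add_mem_iff_left this).1 hmem)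

theorem aux_cancel (k n : ℕ) (a : WithBot ℕ∞) (h : ((n + k : ℕ) : WithBot ℕ∞) ≤ a + (k : ℕ)) :
    (n : WithBot ℕ∞) ≤ a := by
  induction a using WithBot.recBotCoe with
  | bot => exact absurd h (by simp [-Nat.cast_add])
  | coe a =>
    induction a using ENat.recTopCoe with
    | top => exact le_top
    | coe a =>
      norm_cast at h ⊢
      omega

theorem aux_spanFinrank {R : Type*} [CommRing R] (l : List R) :
    (Ideal.ofList l).spanFinrank ≤ l.length := by
  classical
  have h : (Ideal.ofList l) = Submodule.span R (l.toFinset : Set R) := by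
    simp [Ideal.ofList, Ideal.span]
  rw [h]
  refine (Submodule.spanFinrank_span_le_ncard_of_finite (Finset.finite_toSet _)).trans ?_
  rw [Set.ncard_coe_finset]
  exact List.toFinset_card_le l

theorem aux_domain (d : ℕ) : ∀ {R : Type u} [CommRing R] [IsNoetherianRing R] [IsLocalRing R]
    (l : List R), l.length = d → maximalIdeal R = Ideal.ofList l →
    (l.length : WithBot ℕ∞) ≤ ringKrullDim R → IsDomain R := by
  induction d with
  | zero =>
    intro R _ _ _ l hl hm _
    obtain rfl := List.length_eq_zero_iff.1 hl
    rw [Ideal.ofList_nil, ← isField_iff_maximalIdeal_eq] at hm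
    exact hm.isDomain
  | succ d ih =>
    intro R _ _ _ l hl hm hd
    obtain ⟨r, rs, rfl⟩ := List.exists_cons_of_length_eq_add_one hl
    rw [Ideal.ofList_cons] at hm
    have hfin := minimalPrimes.finite_of_isNoetherianRing R
    obtain ⟨c, hc, hrc⟩ := aux_davis hfin.toFinset
      (fun P hP => (hfin.mem_toFinset.1 hP).1.1)
      (fun P hP Q hQ hPQ => by
        have h1 := hfin.mem_toFinset.1 hP
        have h2 := hfin.mem_toFinset.1 hQ
        exact le_antisymm hPQ (h2.2 h1.1 hPQ)) r (Ideal.ofList rs) (by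
        intro P hP hle
        have h1 := hfin.mem_toFinset.1 hP
        have := h1.1.1
        rw [← hm] at hle
        have hPm : P = maximalIdeal R := le_antisymm (le_maximalIdeal this.ne_top) hle
        have : P.height = 0 := Ideal.height_eq_zero_iff.2 h1
        rw [← maximalIdeal_height_eq_ringKrullDim, ← hPm, this, hl] at hd
        norm_cast at hd)
    set t := r + c with ht
    have hm' : maximalIdeal R = Ideal.span {t} ⊔ Ideal.ofList rs := by
      rw [hm]
      apply le_antisymm
      · refine sup_le ((Ideal.span_singleton_le_iff_mem _).2 ?_) le_sup_right
        have : r = t - c := by simp [ht]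
        rw [this]
        exact sub_mem (Ideal.mem_sup_left (Ideal.mem_span_singleton_self _)) (Ideal.mem_sup_right hc)
      · refine sup_le ((Ideal.span_singleton_le_iff_mem _).2 ?_) le_sup_right
        exact add_mem (Ideal.mem_sup_left (Ideal.mem_span_singleton_self _)) (Ideal.mem_sup_right hc)
    have htm : t ∈ maximalIdeal R := by
      rw [hm']; exact Ideal.mem_sup_left (Ideal.mem_span_singleton_self _)
    have hne : Ideal.span {t} ≠ ⊤ := by
      rw [Ne, Ideal.span_singleton_eq_top]; exact htm
    have : Nontrivial (R ⧸ Ideal.span {t}) := Ideal.Quotient.nontrivial_iff.2 hne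
    have : IsLocalRing (R ⧸ Ideal.span {t}) :=
      IsLocalRing.of_surjective' _ Ideal.Quotient.mk_surjective
    have hdom : IsDomain (R ⧸ Ideal.span {t}) := by
      refine ih (rs.map (Ideal.Quotient.mk (Ideal.span {t}))) (by simpa using hl) ?_ ?_
      · rw [← Ideal.map_ofList, ← IsLocalRing.map_maximalIdeal_of_surjective _
          (Ideal.Quotient.mk_surjective (I := Ideal.span {t})), hm', Ideal.map_sup,
          Ideal.map_quotient_self, bot_sup_eq]
      · have h1 := ringKrullDim_le_ringKrullDim_quotient_add_card ({t} : Finset R)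
          (by simpa [IsLocalRing.ringJacobson_eq_maximalIdeal] using htm)
        have h2 := hd.trans h1
        rw [Finset.coe_singleton] at h2
        simp only [List.length_cons, Finset.card_singleton, List.length_map] at h2 ⊢
        exact aux_cancel 1 _ _ h2
    have hprime : (Ideal.span {t}).IsPrime := (Ideal.Quotient.isDomain_iff_prime _).1 hdom
    obtain ⟨q, hq, hqt⟩ := Ideal.exists_minimalPrimes_le (bot_le : (⊥ : Ideal R) ≤ Ideal.span {t})
    have hqp := hq.1.1
    have htq : t ∉ q := hrc q (hfin.mem_toFinset.2 hq)
    have : q = ⊥ := by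
      refine Submodule.eq_bot_of_le_smul_of_le_jacobson_bot (Ideal.span {t}) q
        (IsNoetherian.noetherian _) ?_ ?_
      · intro z hz
        obtain ⟨w, rfl⟩ := Ideal.mem_span_singleton'.1 (hqt hz)
        have hw : w ∈ q := (hqp.mem_or_mem hz).resolve_right htq
        rw [mul_comm]
        exact Ideal.mul_mem_mul (Ideal.mem_span_singleton_self _) hw
      · rw [IsLocalRing.jacobson_eq_maximalIdeal _ bot_ne_top]
        exact (Ideal.span_singleton_le_iff_mem _).2 htm
    subst this
    exact IsDomain.of_bot_isPrime R

theorem aux_prime {R : Type u} [CommRing R] [IsNoetherianRing R] [IsLocalRing R]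
    (l₁ l₂ : List R) (hm : maximalIdeal R = Ideal.ofList (l₁ ++ l₂))
    (hd : ((l₁ ++ l₂).length : WithBot ℕ∞) ≤ ringKrullDim R) : (Ideal.ofList l₁).IsPrime := by
  rw [Ideal.ofList_append] at hm
  have hle : Ideal.ofList l₁ ≤ maximalIdeal R := hm ▸ le_sup_left
  have hne : Ideal.ofList l₁ ≠ ⊤ := fun h => Ideal.IsPrime.ne_top' (top_le_iff.1 (h ▸ hle))
  have : Nontrivial (R ⧸ Ideal.ofList l₁) := Ideal.Quotient.nontrivial_iff.2 hne
  have : IsLocalRing (R ⧸ Ideal.ofList l₁) :=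
    IsLocalRing.of_surjective' _ Ideal.Quotient.mk_surjective
  rw [← Ideal.Quotient.isDomain_iff_prime]
  refine aux_domain _ (l₂.map (Ideal.Quotient.mk (Ideal.ofList l₁))) rfl ?_ ?_
  · rw [← Ideal.map_ofList, ← IsLocalRing.map_maximalIdeal_of_surjective _
          (Ideal.Quotient.mk_surjective (I := Ideal.ofList l₁)), hm, Ideal.map_sup,
          Ideal.map_quotient_self, bot_sup_eq]
  · have h1 := ringKrullDim_le_ringKrullDim_quotient_add_spanFinrank (Ideal.ofList l₁)
      (by rwa [IsLocalRing.ringJacobson_eq_maximalIdeal])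
    have h2 : ((l₂.length + l₁.length : ℕ) : WithBot ℕ∞) ≤
        ringKrullDim (R ⧸ Ideal.ofList l₁) + (l₁.length : ℕ) := by
      rw [add_comm l₂.length, ← List.length_append]
      refine (hd.trans h1).trans ?_
      gcongr
      exact aux_spanFinrank l₁
    rw [List.length_map]
    exact aux_cancel _ _ _ h2

theorem aux_notMem {R : Type u} [CommRing R] [IsNoetherianRing R] [IsLocalRing R]
    (l₁ l₂ : List R) (r : R) (hm : maximalIdeal R = Ideal.ofList (l₁ ++ r :: l₂))
    (hd : ((l₁ ++ r :: l₂).length : WithBot ℕ∞) ≤ ringKrullDim R) : r ∉ Ideal.ofList l₁ := by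
  intro hr
  have hm' : maximalIdeal R = Ideal.ofList (l₁ ++ l₂) := by
    rw [hm, Ideal.ofList_append, Ideal.ofList_append, Ideal.ofList_cons, ← sup_assoc,
      sup_eq_left.2 ((Ideal.span_singleton_le_iff_mem _).2 hr)]
  have h1 := hd.trans (ringKrullDim_le_spanFinrank_maximalIdeal R)
  rw [hm'] at h1
  have h2 := aux_spanFinrank (l₁ ++ l₂)
  have h3 : (l₁ ++ r :: l₂).length ≤ (Ideal.ofList (l₁ ++ l₂)).spanFinrank := by exact_mod_cast h1
  simp at h2 h3
  omega

theorem aux_koszul_exact {R : Type*} [CommRing R] [IsDomain R] {u v : R} (hu : Prime u)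
    (huv : ¬ u ∣ v) (n : ℕ) (a b : R) (h : a * u ^ n + b * v ^ n = 0) :
    ∃ c, a = -(c * v ^ n) ∧ b = c * u ^ n := by
  have h1 : u ^ n ∣ b * v ^ n := ⟨-a, by linear_combination h⟩
  have h2 : u ^ n ∣ b :=
    hu.pow_dvd_of_dvd_mul_right n (fun h => huv (hu.dvd_of_dvd_pow h)) h1
  obtain ⟨c, rfl⟩ := h2
  refine ⟨c, ?_, mul_comm _ _⟩
  have : u ^ n * (a + c * v ^ n) = 0 := by linear_combination h
  rcases mul_eq_zero.1 this with h | h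
  · exact absurd h (pow_ne_zero _ hu.ne_zero)
  · linear_combination h

theorem aux_monomial_domain {R : Type*} [CommRing R] [IsDomain R] [IsLocalRing R] {u v : R}
    (hu : Prime u) (huv : ¬ u ∣ v) (hv : v ∈ IsLocalRing.maximalIdeal R) (n : ℕ) (a b : R)
    (h : (u * v) ^ n = a * u ^ (n + 1) + b * v ^ (n + 1)) : False := by
  have h1 : u ^ n ∣ b * v ^ (n + 1) := ⟨v ^ n - a * u, by linear_combination -h + mul_pow u v n⟩
  obtain ⟨c, rfl⟩ := hu.pow_dvd_of_dvd_mul_right n (fun h => huv (hu.dvd_of_dvd_pow h)) h1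
  have h2 : u ^ n * (v ^ n * (1 - c * v) - a * u) = 0 := by
    linear_combination h - mul_pow u v n
  have h3 := (mul_eq_zero.1 h2).resolve_left (pow_ne_zero _ hu.ne_zero)
  have h4 : IsUnit (1 - c * v) := by
    by_contra hn
    have h5 : c * v ∈ IsLocalRing.maximalIdeal R := Ideal.mul_mem_left _ _ hv
    have := add_mem ((IsLocalRing.mem_maximalIdeal _).2 hn) h5
    rw [sub_add_cancel] at this
    exact (Ideal.ne_top_iff_one _).1 (Ideal.IsPrime.ne_top') this
  have h6 : u ∣ v ^ n * (1 - c * v) := ⟨a, by linear_combination h3⟩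
  rcases hu.dvd_or_dvd h6 with h | h
  · exact huv (hu.dvd_of_dvd_pow h)
  · exact hu.not_isUnit (isUnit_of_dvd_unit h h4)

/-- consequences of regularity used below -/
theorem aux_regular {S : Type u} [CommRing S] [IsNoetherianRing S]
    [IsLocalRing S] (x y u v : S)
    (hgen : IsLocalRing.maximalIdeal S = Ideal.span {x, y, u, v})
    (hdim : ringKrullDim S = 4) :
    (∀ (n : ℕ) (a b : S), a * u ^ n + b * v ^ n = 0 → ∃ c, a = -(c * v ^ n) ∧ b = c * u ^ n) ∧
    u ≠ 0 ∧ IsDomain S ∧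
    (∀ (n : ℕ) (a b p q : S),
      (u * v) ^ n = a * u ^ (n + 1) + b * v ^ (n + 1) + p * x + q * y → False) := by
  have hm1 : maximalIdeal S = Ideal.ofList [u, v, x, y] := by
    rw [hgen]; simp only [Ideal.ofList]; congr 1; ext z; simp; tauto
  have hm2 : maximalIdeal S = Ideal.ofList [x, y, u, v] := by
    rw [hgen]; simp only [Ideal.ofList]; congr 1; ext z; simp
  have hd : ((4 : ℕ) : WithBot ℕ∞) ≤ ringKrullDim S := by rw [hdim]; rfl
  have hdom : IsDomain S := aux_domain 4 [u, v, x, y] rfl hm1 hd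
  have hu1 := aux_prime [u] [v, x, y] hm1 hd
  have hu0 := aux_notMem [] [v, x, y] u hm1 hd
  have hv1 := aux_notMem [u] [x, y] v hm1 hd
  rw [Ideal.ofList_singleton] at hu1 hv1
  rw [Ideal.ofList_nil, Ideal.mem_bot] at hu0
  have hup : Prime u := (Ideal.span_singleton_prime hu0).1 hu1
  have huv : ¬ u ∣ v := fun h => hv1 (Ideal.mem_span_singleton.2 h)
  refine ⟨fun n a b h => aux_koszul_exact hup huv n a b h, hu0, hdom, ?_⟩
  intro n a b p q h
  have hQ := aux_prime [x, y] [u, v] hm2 hd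
  have hQ' := aux_prime [x, y, u] [v] hm2 hd
  have huQ := aux_notMem [x, y] [v] u hm2 hd
  have hvQ := aux_notMem [x, y, u] [] v hm2 hd
  set Q := Ideal.ofList [x, y] with hQdef
  have hxQ : x ∈ Q := Ideal.subset_span (by simp)
  have hyQ : y ∈ Q := Ideal.subset_span (by simp)
  have hQ'eq : Ideal.ofList [x, y, u] = Q ⊔ Ideal.span {u} := by
    rw [hQdef, ← Ideal.ofList_singleton, ← Ideal.ofList_append]; rfl
  rw [hQ'eq] at hQ' hvQ
  have : IsDomain (S ⧸ Q) := (Ideal.Quotient.isDomain_iff_prime _).2 hQ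
  have : IsLocalRing (S ⧸ Q) :=
    IsLocalRing.of_surjective' _ Ideal.Quotient.mk_surjective
  have hdvd : ∀ z : S, Ideal.Quotient.mk Q u ∣ Ideal.Quotient.mk Q z ↔ z ∈ Q ⊔ Ideal.span {u} := by
    intro z
    rw [← Ideal.mem_span_singleton, ← Set.image_singleton, ← Ideal.map_span,
      ← Ideal.mem_comap, Ideal.comap_map_of_surjective _ Ideal.Quotient.mk_surjective,
      ← RingHom.ker_eq_comap_bot, Ideal.mk_ker, sup_comm]
  refine aux_monomial_domain (R := S ⧸ Q) (u := Ideal.Quotient.mk Q u) (v := Ideal.Quotient.mk Q v)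
    ⟨?_, ?_, ?_⟩ ?_ ?_ n (Ideal.Quotient.mk Q a) (Ideal.Quotient.mk Q b) ?_
  · rwa [Ne, Ideal.Quotient.eq_zero_iff_mem]
  · intro hun
    have := hun.dvd (a := (Ideal.Quotient.mk Q) 1)
    rw [hdvd] at this
    exact hQ'.ne_top ((Ideal.eq_top_iff_one _).2 this)
  · intro α β
    obtain ⟨α, rfl⟩ := Ideal.Quotient.mk_surjective α
    obtain ⟨β, rfl⟩ := Ideal.Quotient.mk_surjective β
    rw [← map_mul, hdvd, hdvd, hdvd]
    exact hQ'.mem_or_mem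
  · rwa [hdvd]
  · rw [← IsLocalRing.map_maximalIdeal_of_surjective _
          (Ideal.Quotient.mk_surjective (I := Q))]
    refine Ideal.mem_map_of_mem _ ?_
    rw [hgen]
    exact Ideal.subset_span (by simp)
  · rw [← map_mul, ← map_pow, h]
    simp [Ideal.Quotient.eq_zero_iff_mem.2 hxQ, Ideal.Quotient.eq_zero_iff_mem.2 hyQ]

end partA

section partB
open CategoryTheory Limits

section kappa
universe v₁ v₂ u₁ u₂
variable {C : Type u₁} [Category.{v₁} C] [Abelian C] [EnoughProjectives C] {D : Type u₂} [Category.{v₂} D]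
  [Abelian D] (F : C ⥤ D) [F.Additive]

/-- homology equals cycles in top degree -/
noncomputable def auxIso {X : C} (P : ProjectiveResolution X) (hP : IsZero (P.complex.X 3)) :
    ((F.mapHomologicalComplex _).obj P.complex).cycles 2 ≅
      ((F.mapHomologicalComplex _).obj P.complex).homology 2 :=
  ((F.mapHomologicalComplex _).obj P.complex).isoHomologyπ 3 2 (by simp)
    ((F.map_isZero hP).eq_of_src _ _)

/-- the derived functor as homology -/
noncomputable def auxIso1 {X : C} (P : ProjectiveResolution X) :
    (F.leftDerived 2).obj X ≅ ((F.mapHomologicalComplex _).obj P.complex).homology 2 :=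
  P.isoLeftDerivedObj F 2

/-- inclusion of cycles -/
noncomputable def auxI {X : C} (P : ProjectiveResolution X) :
    ((F.mapHomologicalComplex _).obj P.complex).cycles 2 ⟶ F.obj (P.complex.X 2) :=
  ((F.mapHomologicalComplex _).obj P.complex).iCycles 2

/-- The inclusion of the second derived functor in `F P₂`. -/
noncomputable def auxKappa {X : C} (P : ProjectiveResolution X) (hP : IsZero (P.complex.X 3)) :
    (F.leftDerived 2).obj X ⟶ F.obj (P.complex.X 2) :=
  (auxIso1 F P).hom ≫ (auxIso F P hP).inv ≫ auxI F P

theorem auxI_mono {X : C} (P : ProjectiveResolution X) : Mono (auxI F P) :=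
  inferInstanceAs (Mono (((F.mapHomologicalComplex _).obj P.complex).iCycles 2))

theorem auxKappa_mono {X : C} (P : ProjectiveResolution X) (hP : IsZero (P.complex.X 3)) :
    Mono (auxKappa F P hP) := by
  have := auxI_mono F P
  unfold auxKappa
  infer_instance

theorem auxI_comp {X : C} (P : ProjectiveResolution X) :
    auxI F P ≫ F.map (P.complex.d 2 1) = 0 :=
  ((F.mapHomologicalComplex _).obj P.complex).iCycles_d 2 1

theorem auxKappa_comp {X : C} (P : ProjectiveResolution X) (hP : IsZero (P.complex.X 3)) :
    auxKappa F P hP ≫ F.map (P.complex.d 2 1) = 0 := by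
  unfold auxKappa
  rw [Category.assoc, Category.assoc, auxI_comp, comp_zero, comp_zero]

theorem auxI_exact {X : C} (P : ProjectiveResolution X) :
    (ShortComplex.mk _ _ (auxI_comp F P)).Exact :=
  ShortComplex.exact_of_f_is_kernel _
    (((F.mapHomologicalComplex _).obj P.complex).cyclesIsKernel 2 1 (by simp))

theorem auxKappa_exact {X : C} (P : ProjectiveResolution X) (hP : IsZero (P.complex.X 3)) :
    (ShortComplex.mk _ _ (auxKappa_comp F P hP)).Exact := by
  refine (ShortComplex.exact_iff_of_iso ?_).2 (auxI_exact F P)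
  refine ShortComplex.isoMk (auxIso1 F P ≪≫ (auxIso F P hP).symm)
    (Iso.refl _) (Iso.refl _) ?_ ?_
  · simp [auxKappa]
  · simp

theorem auxKappa_naturality {X Y : C} (f : X ⟶ Y) (P : ProjectiveResolution X)
    (Q : ProjectiveResolution Y) (hP : IsZero (P.complex.X 3)) (hQ : IsZero (Q.complex.X 3))
    (φ : P.complex ⟶ Q.complex) (comm : φ.f 0 ≫ Q.π.f 0 = P.π.f 0 ≫ f) :
    (F.leftDerived 2).map f ≫ auxKappa F Q hQ = auxKappa F P hP ≫ F.map (φ.f 2) := by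
  have h0 : (F.leftDerived 2).map f ≫ (auxIso1 F Q).hom =
      (auxIso1 F P).hom ≫ HomologicalComplex.homologyMap ((F.mapHomologicalComplex _).map φ) 2 :=
    ProjectiveResolution.isoLeftDerivedObj_hom_naturality f P Q φ comm F 2
  have h1 : (auxIso F P hP).hom ≫ HomologicalComplex.homologyMap ((F.mapHomologicalComplex _).map φ) 2 =
    HomologicalComplex.cyclesMap ((F.mapHomologicalComplex _).map φ) 2 ≫ (auxIso F Q hQ).hom :=
    HomologicalComplex.homologyπ_naturality ((F.mapHomologicalComplex _).map φ) 2
  have h2 : HomologicalComplex.cyclesMap ((F.mapHomologicalComplex _).map φ) 2 ≫ auxI F Q =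
      auxI F P ≫ F.map (φ.f 2) :=
    HomologicalComplex.cyclesMap_i ((F.mapHomologicalComplex _).map φ) 2
  have h3 : HomologicalComplex.homologyMap ((F.mapHomologicalComplex _).map φ) 2 ≫ (auxIso F Q hQ).inv
    = (auxIso F P hP).inv ≫ HomologicalComplex.cyclesMap ((F.mapHomologicalComplex _).map φ) 2 := by
    rw [Iso.comp_inv_eq, Category.assoc, Iso.eq_inv_comp]
    exact h1
  unfold auxKappa
  simp only [Category.assoc]
  rw [reassoc_of% h0, reassoc_of% h3, h2]
end kappa

section extQ
variable {S : Type u} [CommRing S]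

/-- cocycles to Ext -/
noncomputable def extQ {X : ModuleCat.{u} S} (P : ProjectiveResolution X)
    (hP : IsZero (P.complex.X 3)) (M : ModuleCat.{u} S) :
    ModuleCat.of S (P.complex.X 2 ⟶ M) ⟶ ((Ext S (ModuleCat.{u} S) 2).obj (Opposite.op X)).obj M :=
  (auxKappa (((linearYoneda S (ModuleCat.{u} S)).obj M).rightOp) P hP).unop

/-- precomposition with d -/
noncomputable def extD {X : ModuleCat.{u} S} (P : ProjectiveResolution X)
    (M : ModuleCat.{u} S) :
    ModuleCat.of S (P.complex.X 1 ⟶ M) ⟶ ModuleCat.of S (P.complex.X 2 ⟶ M) :=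
  ((linearYoneda S (ModuleCat.{u} S)).obj M).map (P.complex.d 2 1).op

theorem extQ_surjective {X : ModuleCat.{u} S} (P : ProjectiveResolution X)
    (hP : IsZero (P.complex.X 3)) (M : ModuleCat.{u} S) :
    Function.Surjective (extQ P hP M) := by
  rw [← ModuleCat.epi_iff_surjective]
  have := auxKappa_mono (((linearYoneda S (ModuleCat.{u} S)).obj M).rightOp) P hP
  exact unop_epi_of_mono _

theorem extD_extQ {X : ModuleCat.{u} S} (P : ProjectiveResolution X)
    (hP : IsZero (P.complex.X 3)) (M : ModuleCat.{u} S) : extD P M ≫ extQ P hP M = 0 :=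
  congrArg Quiver.Hom.unop
    (auxKappa_comp (((linearYoneda S (ModuleCat.{u} S)).obj M).rightOp) P hP)

theorem extQ_exact {X : ModuleCat.{u} S} (P : ProjectiveResolution X)
    (hP : IsZero (P.complex.X 3)) (M : ModuleCat.{u} S) :
    (ShortComplex.mk _ _ (extD_extQ P hP M)).Exact :=
  (auxKappa_exact (((linearYoneda S (ModuleCat.{u} S)).obj M).rightOp) P hP).unop

theorem extQ_eq_zero_iff {X : ModuleCat.{u} S} (P : ProjectiveResolution X)
    (hP : IsZero (P.complex.X 3)) (M : ModuleCat.{u} S) (z : P.complex.X 2 ⟶ M) :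
    extQ P hP M z = 0 ↔ ∃ w : P.complex.X 1 ⟶ M, P.complex.d 2 1 ≫ w = z :=
  ((ShortComplex.ShortExact.moduleCat_exact_iff_function_exact _).1 (extQ_exact P hP M)) z

theorem extQ_naturality {X Y : ModuleCat.{u} S} (f : X ⟶ Y) (P : ProjectiveResolution X)
    (Q : ProjectiveResolution Y) (hP : IsZero (P.complex.X 3)) (hQ : IsZero (Q.complex.X 3))
    (φ : P.complex ⟶ Q.complex) (comm : φ.f 0 ≫ Q.π.f 0 = P.π.f 0 ≫ f)
    (M : ModuleCat.{u} S) (z : Q.complex.X 2 ⟶ M) :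
    ((Ext S (ModuleCat.{u} S) 2).map f.op).app M (extQ Q hQ M z) = extQ P hP M (φ.f 2 ≫ z) := by
  have h := congrArg Quiver.Hom.unop (auxKappa_naturality
    (((linearYoneda S (ModuleCat.{u} S)).obj M).rightOp) f P Q hP hQ φ comm)
  exact congrArg (fun k => k.hom z) h
end extQ

section koszul
variable {S : Type u} [CommRing S]

/-- degree-wise modules -/
noncomputable def kosX (S : Type u) [CommRing S] : ℕ → ModuleCat.{u} S
  | 0 => ModuleCat.of S S
  | 1 => ModuleCat.of S (S × S)
  | 2 => ModuleCat.of S S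
  | _ + 3 => ModuleCat.of S PUnit

/-- first differential -/
def kosd0 (f g : S) : (S × S) →ₗ[S] S :=
  f • LinearMap.fst S S S + g • LinearMap.snd S S S

/-- second differential -/
def kosd1 (f g : S) : S →ₗ[S] (S × S) :=
  LinearMap.prod (-g • LinearMap.id) (f • LinearMap.id)

/-- differentials -/
noncomputable def kosd (f g : S) : (n : ℕ) → (kosX S (n + 1) ⟶ kosX S n)
  | 0 => ModuleCat.ofHom (kosd0 f g)
  | 1 => ModuleCat.ofHom (kosd1 f g)
  | 2 => 0
  | _ + 3 => 0

theorem kosd_sq (f g : S) : ∀ n, kosd f g (n + 1) ≫ kosd f g n = 0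
  | 0 => by
    change ModuleCat.ofHom (kosd1 f g) ≫ ModuleCat.ofHom (kosd0 f g) = 0
    rw [← ModuleCat.ofHom_comp]
    have : kosd0 f g ∘ₗ kosd1 f g = 0 := by
      ext; simp [kosd0, kosd1, mul_comm]
    rw [this]; rfl
  | 1 => zero_comp
  | 2 => zero_comp
  | _ + 3 => zero_comp

/-- Koszul complex -/
noncomputable def kosC (f g : S) : ChainComplex (ModuleCat.{u} S) ℕ :=
  ChainComplex.of (kosX S) (kosd f g) (kosd_sq f g)

theorem kosC_d (f g : S) (n : ℕ) : (kosC f g).d (n + 1) n = kosd f g n :=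
  ChainComplex.of_d _ _ n

theorem kosX_proj : ∀ n, Projective (kosX S n)
  | 0 => (IsProjective.iff_projective (R := S) S).1 inferInstance
  | 1 => (IsProjective.iff_projective (R := S) (S × S)).1 inferInstance
  | 2 => (IsProjective.iff_projective (R := S) S).1 inferInstance
  | _ + 3 => (IsProjective.iff_projective (R := S) PUnit).1 inferInstance

theorem kosX_zero (n : ℕ) : IsZero (kosX S (n + 3)) :=
  ModuleCat.isZero_of_subsingleton (ModuleCat.of S PUnit)

/-- augmentation -/
noncomputable def kosπ (J : Ideal S) : kosX S 0 ⟶ ModuleCat.of S (S ⧸ J) :=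
  ModuleCat.ofHom (Submodule.mkQ J)

theorem kosd_π (f g : S) (J : Ideal S) (hJ : J = Ideal.span {f, g}) :
    kosd f g 0 ≫ kosπ J = 0 := by
  change ModuleCat.ofHom (kosd0 f g) ≫ ModuleCat.ofHom (Submodule.mkQ J) = 0
  rw [← ModuleCat.ofHom_comp]
  have : Submodule.mkQ J ∘ₗ kosd0 f g = 0 := by
    ext
    · have : f ∈ J := hJ ▸ Ideal.subset_span (by simp)
      simpa [kosd0, Ideal.Quotient.eq_zero_iff_mem] using this
    · have : g ∈ J := hJ ▸ Ideal.subset_span (by simp)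
      simpa [kosd0, Ideal.Quotient.eq_zero_iff_mem] using this
  rw [this]; rfl

theorem kos_exact0 (f g : S) (J : Ideal S) (hJ : J = Ideal.span {f, g}) :
    (ShortComplex.mk _ _ (kosd_π f g J hJ)).Exact := by
  rw [ShortComplex.moduleCat_exact_iff]
  intro (a : S) ha
  have ha' : Submodule.mkQ J a = 0 := ha
  rw [Submodule.mkQ_apply, Submodule.Quotient.mk_eq_zero, hJ, Ideal.mem_span_pair] at ha'
  obtain ⟨p, q, h⟩ := ha'
  refine ⟨((p, q) : S × S), ?_⟩
  change kosd0 f g (p, q) = a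
  simp [kosd0, ← h, mul_comm]

theorem kos_exact1 (f g : S)
    (h : ∀ a b : S, a * f + b * g = 0 → ∃ c, a = -(c * g) ∧ b = c * f) :
    (ShortComplex.mk _ _ (kosd_sq f g 0)).Exact := by
  rw [ShortComplex.moduleCat_exact_iff]
  intro (p : S × S) hp
  have hp' : kosd0 f g p = 0 := hp
  obtain ⟨c, h1, h2⟩ := h p.1 p.2 (by
    simp [kosd0] at hp'
    linear_combination hp')
  refine ⟨(c : S), ?_⟩
  change kosd1 f g c = p
  ext <;> simp [kosd1, h1, h2, mul_comm]

theorem kos_exact2 (f g : S) (hf : ∀ c : S, c * f = 0 → c = 0) :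
    (ShortComplex.mk _ _ (kosd_sq f g 1)).Exact := by
  rw [ShortComplex.moduleCat_exact_iff]
  intro (p : S) hp
  have hp' : kosd1 f g p = 0 := hp
  have : p = 0 := hf p (by
    have := congrArg Prod.snd hp'
    simp [kosd1] at this
    linear_combination this)
  subst this
  exact ⟨PUnit.unit, rfl⟩

theorem kos_exact (f g : S) (hf : ∀ c : S, c * f = 0 → c = 0)
    (h : ∀ a b : S, a * f + b * g = 0 → ∃ c, a = -(c * g) ∧ b = c * f) (n : ℕ) :
    (kosC f g).ExactAt (n + 1) := by
  rw [HomologicalComplex.exactAt_iff' _ (n + 1 + 1) (n + 1) n (by simp) (by simp)]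
  have key : (ShortComplex.mk _ _ (kosd_sq f g n)).Exact := by
    match n with
    | 0 => exact kos_exact1 f g h
    | 1 => exact kos_exact2 f g hf
    | n + 2 => exact ShortComplex.exact_of_isZero_X₂ _ (kosX_zero n)
  refine (ShortComplex.exact_iff_of_iso ?_).2 key
  refine ShortComplex.isoMk (Iso.refl _) (Iso.refl _) (Iso.refl _) ?_ ?_
  · exact (Category.id_comp _).trans ((kosC_d f g (n + 1)).symm.trans (Category.comp_id _).symm)
  · exact (Category.id_comp _).trans ((kosC_d f g n).symm.trans (Category.comp_id _).symm)

/-- augmentation as chain map -/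
noncomputable def kosAug (f g : S) (J : Ideal S) (hJ : J = Ideal.span {f, g}) :
    kosC f g ⟶ (ChainComplex.single₀ _).obj (ModuleCat.of S (S ⧸ J)) :=
  (ChainComplex.toSingle₀Equiv _ _).symm ⟨kosπ J, by
    erw [kosC_d f g 0]; exact kosd_π f g J hJ⟩

theorem kosAug_f (f g : S) (J : Ideal S) (hJ : J = Ideal.span {f, g}) :
    (kosAug f g J hJ).f 0 = kosπ J := rfl

theorem kosAug_quasiIso (f g : S) (J : Ideal S) (hJ : J = Ideal.span {f, g})
    (hf : ∀ c : S, c * f = 0 → c = 0)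
    (h : ∀ a b : S, a * f + b * g = 0 → ∃ c, a = -(c * g) ∧ b = c * f) :
    QuasiIso (kosAug f g J hJ) := ⟨fun n => by
    cases n
    · rw [ChainComplex.quasiIsoAt₀_iff, ShortComplex.quasiIso_iff_of_zeros']
      · refine (ShortComplex.exact_and_epi_g_iff_of_iso ?_).2
          ⟨kos_exact0 f g J hJ, ?_⟩
        · refine ShortComplex.isoMk (Iso.refl _) (Iso.refl _) (Iso.refl _) ?_ ?_
          · exact (Category.id_comp _).trans ((kosC_d f g 0).symm.trans (Category.comp_id _).symm)
          · exact (Category.id_comp _).trans (Category.comp_id _).symm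
        · exact (ModuleCat.epi_iff_surjective _).2 (Submodule.mkQ_surjective J)
      all_goals rfl
    · rw [quasiIsoAt_iff_exactAt']
      · apply kos_exact f g hf h
      · apply ChainComplex.exactAt_succ_single_obj⟩

/-- Koszul resolution -/
noncomputable def kosRes (f g : S) (J : Ideal S) (hJ : J = Ideal.span {f, g})
    (hf : ∀ c : S, c * f = 0 → c = 0)
    (h : ∀ a b : S, a * f + b * g = 0 → ∃ c, a = -(c * g) ∧ b = c * f) :
    ProjectiveResolution (ModuleCat.of S (S ⧸ J)) where
  complex := kosC f g
  projective := kosX_proj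
  π := kosAug f g J hJ
  quasiIso := kosAug_quasiIso f g J hJ hf h

/-- comparison maps -/
noncomputable def kosφf (s t : S) : (n : ℕ) → (kosX S n ⟶ kosX S n)
  | 0 => 𝟙 _
  | 1 => ModuleCat.ofHom (LinearMap.prodMap (s • LinearMap.id) (t • LinearMap.id) : S × S →ₗ[S] S × S)
  | 2 => ModuleCat.ofHom ((s * t) • LinearMap.id : S →ₗ[S] S)
  | _ + 3 => 0

theorem kosφ_comm (f g s t f' g' : S) (hf : f' = s * f) (hg : g' = t * g) : ∀ n,
    kosφf s t (n + 1) ≫ kosd f g n = kosd f' g' n ≫ kosφf s t n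
  | 0 => by
    change ModuleCat.ofHom (LinearMap.prodMap (s • LinearMap.id) (t • LinearMap.id) : S × S →ₗ[S] S × S)
      ≫ ModuleCat.ofHom (kosd0 f g) = ModuleCat.ofHom (kosd0 f' g') ≫ 𝟙 _
    rw [Category.comp_id, ← ModuleCat.ofHom_comp]
    congr 1
    ext <;> simp [kosd0, hf, hg, mul_comm]
  | 1 => by
    change ModuleCat.ofHom ((s * t) • LinearMap.id : S →ₗ[S] S) ≫ ModuleCat.ofHom (kosd1 f g) =
      ModuleCat.ofHom (kosd1 f' g') ≫
      ModuleCat.ofHom (LinearMap.prodMap (s • LinearMap.id) (t • LinearMap.id) : S × S →ₗ[S] S × S)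
    rw [← ModuleCat.ofHom_comp, ← ModuleCat.ofHom_comp]
    congr 1
    ext <;> simp [kosd1, hf, hg] <;> ring
  | 2 => (kosX_zero 0).eq_of_src _ _
  | n + 3 => (kosX_zero _).eq_of_src _ _

/-- comparison chain map -/
noncomputable def kosφ (f g s t f' g' : S) (hf : f' = s * f) (hg : g' = t * g) :
    kosC f' g' ⟶ kosC f g :=
  ChainComplex.ofHom (X := kosC f' g') (Y := kosC f g) (kosφf s t) (fun n => by
    rw [kosC_d, kosC_d]; exact kosφ_comm f g s t f' g' hf hg n)
end koszul


section extmk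
variable {S : Type u} [CommRing S]

/-- element of Ext from an element of the module -/
noncomputable def extMk (f g : S) (J : Ideal S) (hJ : J = Ideal.span {f, g})
    (hf : ∀ c : S, c * f = 0 → c = 0)
    (h : ∀ a b : S, a * f + b * g = 0 → ∃ c, a = -(c * g) ∧ b = c * f)
    (M : ModuleCat.{u} S) (m : M) :
    ((Ext S (ModuleCat.{u} S) 2).obj (Opposite.op (ModuleCat.of S (S ⧸ J)))).obj M :=
  extQ (kosRes f g J hJ hf h) (kosX_zero 0) M
    (ModuleCat.ofHom (X := S) (LinearMap.toSpanSingleton S M m))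

theorem extMk_smul (f g : S) (J : Ideal S) (hJ : J = Ideal.span {f, g})
    (hf : ∀ c : S, c * f = 0 → c = 0)
    (h : ∀ a b : S, a * f + b * g = 0 → ∃ c, a = -(c * g) ∧ b = c * f)
    (M : ModuleCat.{u} S) (r : S) (m : M) :
    extMk f g J hJ hf h M (r • m) = r • extMk f g J hJ hf h M m := by
  unfold extMk
  have : (ModuleCat.ofHom (X := S) (LinearMap.toSpanSingleton S M (r • m))) =
    r • (ModuleCat.ofHom (X := S) (LinearMap.toSpanSingleton S M m)) := by
    ext; simp
  rw [this]
  exact map_smul (extQ (kosRes f g J hJ hf h) (kosX_zero 0) M).hom r _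

theorem extMk_surj (f g : S) (J : Ideal S) (hJ : J = Ideal.span {f, g})
    (hf : ∀ c : S, c * f = 0 → c = 0)
    (h : ∀ a b : S, a * f + b * g = 0 → ∃ c, a = -(c * g) ∧ b = c * f)
    (M : ModuleCat.{u} S) : Function.Surjective (extMk f g J hJ hf h M) := by
  intro z
  obtain ⟨w, rfl⟩ := extQ_surjective (kosRes f g J hJ hf h) (kosX_zero 0) M z
  let w' : ModuleCat.of S S ⟶ M := w
  refine ⟨w'.hom (1 : S), ?_⟩
  unfold extMk
  have : (ModuleCat.ofHom (X := S) (LinearMap.toSpanSingleton S M (w'.hom (1 : S)))) = w' := by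
    ext; simp
  rw [this]

theorem extMk_eq_zero_iff (f g : S) (J : Ideal S) (hJ : J = Ideal.span {f, g})
    (hf : ∀ c : S, c * f = 0 → c = 0)
    (h : ∀ a b : S, a * f + b * g = 0 → ∃ c, a = -(c * g) ∧ b = c * f)
    (M : ModuleCat.{u} S) (m : M) :
    extMk f g J hJ hf h M m = 0 ↔ ∃ p q : M, m = f • p + g • q := by
  refine (extQ_eq_zero_iff (kosRes f g J hJ hf h) (kosX_zero 0) M
    (ModuleCat.ofHom (X := S) (LinearMap.toSpanSingleton S M m))).trans ?_
  have hd : (kosRes f g J hJ hf h).complex.d 2 1 = ModuleCat.ofHom (kosd1 f g) := kosC_d f g 1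
  constructor
  · rintro ⟨w, hw⟩
    rw [hd] at hw
    let w' : ModuleCat.of S (S × S) ⟶ M := w
    have hw' : ModuleCat.ofHom (kosd1 f g) ≫ w' =
      (ModuleCat.ofHom (X := S) (LinearMap.toSpanSingleton S M m)) := hw
    have h1 := congrArg (fun k => k.hom (1 : S)) hw'
    refine ⟨w'.hom ((0, 1) : S × S), w'.hom ((-1, 0) : S × S), ?_⟩
    have h2 : w'.hom (kosd1 f g 1) = m := by
      have : w'.hom (kosd1 f g 1) = (1 : S) • m := h1
      simpa using this
    rw [← h2, ← map_smul, ← map_smul, ← map_add]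
    congr 1
    simp [kosd1]
  · rintro ⟨p, q, hm⟩
    let w' : ModuleCat.of S (S × S) ⟶ M := ModuleCat.ofHom
      (LinearMap.coprod (LinearMap.toSpanSingleton S M (-q)) (LinearMap.toSpanSingleton S M p))
    refine ⟨w', ?_⟩
    rw [hd]
    have hw' : ModuleCat.ofHom (kosd1 f g) ≫ w' =
      (ModuleCat.ofHom (X := S) (LinearMap.toSpanSingleton S M m)) := by
      ext
      simp [w', kosd1, hm, add_comm]
    exact hw'

theorem extMk_map (f g f' g' s t : S) (J J' : Ideal S) (hJ : J = Ideal.span {f, g})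
    (hf : ∀ c : S, c * f = 0 → c = 0)
    (h : ∀ a b : S, a * f + b * g = 0 → ∃ c, a = -(c * g) ∧ b = c * f)
    (hJ' : J' = Ideal.span {f', g'})
    (hf' : ∀ c : S, c * f' = 0 → c = 0)
    (h' : ∀ a b : S, a * f' + b * g' = 0 → ∃ c, a = -(c * g') ∧ b = c * f')
    (hs : f' = s * f) (ht : g' = t * g) (hle : J' ≤ J)
    (M : ModuleCat.{u} S) (m : M) :
    (((Ext S (ModuleCat.{u} S) 2).map (ModuleCat.ofHom
      (Submodule.mapQ J' J LinearMap.id hle)).op).app M) (extMk f g J hJ hf h M m) =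
      extMk f' g' J' hJ' hf' h' M ((s * t) • m) := by
  refine (extQ_naturality _ (kosRes f' g' J' hJ' hf' h') (kosRes f g J hJ hf h) (kosX_zero 0)
    (kosX_zero 0) (kosφ f g s t f' g' hs ht) ?_ M
    (ModuleCat.ofHom (X := S) (LinearMap.toSpanSingleton S M m))).trans ?_
  rotate_left
  · have : ModuleCat.ofHom ((s * t) • LinearMap.id : S →ₗ[S] S) ≫
      (ModuleCat.ofHom (X := S) (LinearMap.toSpanSingleton S M m)) =
      (ModuleCat.ofHom (X := S) (LinearMap.toSpanSingleton S M ((s * t) • m))) := by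
      ext; simp
    exact congrArg (extQ (kosRes f' g' J' hJ' hf' h') (kosX_zero 0) M) this
  · have : 𝟙 _ ≫ kosπ J = kosπ J' ≫ (ModuleCat.ofHom
      (Submodule.mapQ J' J LinearMap.id hle)) := by
      rw [Category.id_comp]
      change ModuleCat.ofHom _ = ModuleCat.ofHom _ ≫ ModuleCat.ofHom _
      rw [← ModuleCat.ofHom_comp, Submodule.mapQ_mkQ]
    exact this
end extmk
section diag
variable {S : Type u} [CommRing S]

theorem aux_span_mono (a b : S) {m n : ℕ} (h : m ≤ n) :
    Ideal.span {a ^ n, b ^ n} ≤ Ideal.span {a ^ m, b ^ m} := by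
  rw [Ideal.span_le]
  rintro z hz
  rcases hz with rfl | rfl
  · exact Ideal.mem_of_dvd _ (pow_dvd_pow a h) (Ideal.subset_span (by simp))
  · exact Ideal.mem_of_dvd _ (pow_dvd_pow b h) (Ideal.subset_span (by simp))

/-- the ideals `(a ^ n, b ^ n)` -/
def pairDiagram (a b : S) : ℕᵒᵖ ⥤ Ideal S where
  obj n := Ideal.span {a ^ n.unop, b ^ n.unop}
  map w := ⟨⟨aux_span_mono a b w.unop.down.down⟩⟩

/-- the same, valued in ideals with large radical -/
def pairLift (a b : S) : ℕᵒᵖ ⥤ localCohomology.SelfLERadical (Ideal.span {a, b}) :=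
  ObjectProperty.lift _ (pairDiagram a b) fun k => by
    change _ ≤ (Ideal.span {a ^ k.unop, b ^ k.unop}).radical
    rw [Ideal.span_le]
    rintro z hz
    rcases hz with rfl | rfl
    · exact ⟨k.unop, Ideal.subset_span (by simp)⟩
    · exact ⟨k.unop, Ideal.subset_span (by simp)⟩

theorem pairLift_initial (a b : S) : Functor.Initial (pairLift a b) where
  out J' := by
    apply +allowSynthFailures zigzag_isConnected
    · obtain ⟨k, hk⟩ := J'.2 (Ideal.subset_span (show a ∈ ({a, b} : Set S) by simp))
      obtain ⟨l, hl⟩ := J'.2 (Ideal.subset_span (show b ∈ ({a, b} : Set S) by simp))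
      have hle : Ideal.span {a ^ (k + l), b ^ (k + l)} ≤ J'.1 := by
        rw [Ideal.span_le]
        rintro z hz
        rcases hz with rfl | rfl
        · exact Ideal.mem_of_dvd _ (pow_dvd_pow a (Nat.le_add_right k l)) hk
        · exact Ideal.mem_of_dvd _ (pow_dvd_pow b (Nat.le_add_left l k)) hl
      exact ⟨CostructuredArrow.mk (⟨⟨⟨hle⟩⟩⟩ : (pairLift a b).obj (Opposite.op (k + l)) ⟶ J')⟩
    · intro j1 j2
      apply Relation.ReflTransGen.single
      rcases le_total (Opposite.unop j1.left) (Opposite.unop j2.left) with h | h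
      · right; exact ⟨CostructuredArrow.homMk (homOfLE h).op rfl⟩
      · left; exact ⟨CostructuredArrow.homMk (homOfLE h).op rfl⟩

/-- local cohomology along `(a ^ n, b ^ n)` -/
noncomputable def pairIso [IsNoetherianRing S] (a b : S) :
    localCohomology.ofDiagram.{u, 0} (pairDiagram a b) 2 ≅ localCohomology (Ideal.span {a, b}) 2 :=
  haveI := pairLift_initial a b
  (localCohomology.isoOfFinal.{u, u, 0} (pairLift a b)
    (localCohomology.selfLERadicalDiagram (Ideal.span {a, b})) 2) ≪≫
      localCohomology.isoSelfLERadical (Ideal.span {a, b}) 2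

/-- evaluated diagram -/
noncomputable def evDiag (a b : S) (M : ModuleCat.{u} S) : ℕᵒᵖᵒᵖ ⥤ ModuleCat.{u} S :=
  localCohomology.diagram (pairDiagram a b) 2 ⋙ (evaluation _ _).obj M

/-- evaluated cocone -/
noncomputable def evCocone (a b : S) (M : ModuleCat.{u} S) : Cocone (evDiag a b M) :=
  haveI := localCohomology.hasColimitDiagram.{u, 0} (pairDiagram a b) 2
  ((evaluation _ _).obj M).mapCocone (colimit.cocone (localCohomology.diagram (pairDiagram a b) 2))

/-- it is a colimit -/
noncomputable def evIsColimit (a b : S) (M : ModuleCat.{u} S) : IsColimit (evCocone a b M) :=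
  haveI := localCohomology.hasColimitDiagram.{u, 0} (pairDiagram a b) 2
  isColimitOfPreserves ((evaluation _ _).obj M)
    (colimit.isColimit (localCohomology.diagram (pairDiagram a b) 2))

/-- linear equivalence -/
noncomputable def evEquiv [IsNoetherianRing S] (a b : S) (M : ModuleCat.{u} S) :
    (evCocone a b M).pt ≃ₗ[S] (localCohomology (Ideal.span {a, b}) 2).obj M :=
  ((pairIso a b).app M).toLinearEquiv

theorem evPres (a b : S) (M : ModuleCat.{u} S) :
    PreservesColimit (evDiag a b M) (forget (ModuleCat.{u} S)) := by
  have := preservesSmallestFilteredColimits_of_preservesFilteredColimits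
    (forget (ModuleCat.{u} S))
  have := PreservesFilteredColimitsOfSize.preserves_filtered_colimits
    (F := forget (ModuleCat.{u} S)) ℕᵒᵖᵒᵖ
  infer_instance

theorem evCocone_rep (a b : S) (M : ModuleCat.{u} S) (z : (evCocone a b M).pt) :
    ∃ (n : ℕ) (e : (evDiag a b M).obj (Opposite.op (Opposite.op n))),
      (evCocone a b M).ι.app _ e = z := by
  have := evPres a b M
  obtain ⟨j, e, he⟩ := Concrete.isColimit_exists_rep (evDiag a b M) (evIsColimit a b M) z
  exact ⟨j.unop.unop, e, he⟩

theorem evCocone_zero (a b : S) (M : ModuleCat.{u} S) (n : ℕ)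
    (e : (evDiag a b M).obj (Opposite.op (Opposite.op n))) 
    (h : (evCocone a b M).ι.app _ e = 0) :
    ∃ (m : ℕ) (hm : n ≤ m), (evDiag a b M).map (homOfLE hm).op.op e = 0 := by
  have h0 : (evCocone a b M).ι.app (Opposite.op (Opposite.op n)) e =
      (evCocone a b M).ι.app (Opposite.op (Opposite.op n)) 0 := by rw [h, map_zero]
  have := evPres a b M
  obtain ⟨k, f, g, hfg⟩ := (Concrete.isColimit_rep_eq_iff_exists (evDiag a b M)
    (evIsColimit a b M) _ _).1 h0
  refine ⟨k.unop.unop, leOfHom f.unop.unop, ?_⟩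
  have e1 : f = (homOfLE (leOfHom f.unop.unop)).op.op := rfl
  rw [← e1, hfg, map_zero]

theorem evCocone_map (a b : S) (M : ModuleCat.{u} S) (n m : ℕ) (hm : n ≤ m)
    (e : (evDiag a b M).obj (Opposite.op (Opposite.op n))) :
    (evCocone a b M).ι.app (Opposite.op (Opposite.op m)) ((evDiag a b M).map (homOfLE hm).op.op e)
     = (evCocone a b M).ι.app _ e := by
  rw [← (evCocone a b M).w (homOfLE hm).op.op]
  rfl

end diag
section cls
variable {S : Type u} [CommRing S]

/-- class of an element of `M` in the direct limit -/
noncomputable def auxCls (a b : S)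
    (hu : ∀ (n : ℕ) (c : S), c * a ^ n = 0 → c = 0)
    (h : ∀ (n : ℕ) (p q : S), p * a ^ n + q * b ^ n = 0 → ∃ c, p = -(c * b ^ n) ∧ q = c * a ^ n)
    (M : ModuleCat.{u} S) (n : ℕ) (m : M) : (evCocone a b M).pt :=
  (evCocone a b M).ι.app (Opposite.op (Opposite.op n))
    (extMk (a ^ n) (b ^ n) (Ideal.span {a ^ n, b ^ n}) rfl (hu n) (h n) M m)

variable (a b : S)
    (hu : ∀ (n : ℕ) (c : S), c * a ^ n = 0 → c = 0)
    (h : ∀ (n : ℕ) (p q : S), p * a ^ n + q * b ^ n = 0 → ∃ c, p = -(c * b ^ n) ∧ q = c * a ^ n)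
    (M : ModuleCat.{u} S)

theorem auxCls_surj (z : (evCocone a b M).pt) : ∃ n m, auxCls a b hu h M n m = z := by
  obtain ⟨n, e, he⟩ := evCocone_rep a b M z
  obtain ⟨m, hm⟩ := extMk_surj (a ^ n) (b ^ n) (Ideal.span {a ^ n, b ^ n}) rfl (hu n) (h n) M e
  refine ⟨n, m, ?_⟩
  unfold auxCls
  rw [hm]
  exact he

theorem auxCls_smul (n : ℕ) (m : M) (r : S) :
    auxCls a b hu h M n (r • m) = r • auxCls a b hu h M n m := by
  unfold auxCls
  rw [extMk_smul]
  exact map_smul ((evCocone a b M).ι.app (Opposite.op (Opposite.op n))).hom r _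

theorem evDiag_map (n k : ℕ) (m : M) :
    (evDiag a b M).map (homOfLE (Nat.le_add_right n k)).op.op
      (extMk (a ^ n) (b ^ n) (Ideal.span {a ^ n, b ^ n}) rfl (hu n) (h n) M m) =
      extMk (a ^ (n + k)) (b ^ (n + k)) (Ideal.span {a ^ (n + k), b ^ (n + k)}) rfl (hu (n + k))
        (h (n + k)) M ((a ^ k * b ^ k) • m) :=
  extMk_map (a ^ n) (b ^ n) (a ^ (n + k)) (b ^ (n + k)) (a ^ k) (b ^ k)
    (Ideal.span {a ^ n, b ^ n}) (Ideal.span {a ^ (n + k), b ^ (n + k)}) rfl (hu n) (h n)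
    rfl (hu (n + k)) (h (n + k)) (by ring) (by ring)
    (aux_span_mono a b (Nat.le_add_right n k)) M m

theorem auxCls_eq_zero_iff (n : ℕ) (m : M) :
    auxCls a b hu h M n m = 0 ↔
      ∃ k, ∃ p q : M, (a ^ k * b ^ k) • m = a ^ (n + k) • p + b ^ (n + k) • q := by
  constructor
  · intro h0
    obtain ⟨N, hN, h1⟩ := evCocone_zero a b M n _ h0
    obtain ⟨k, rfl⟩ := Nat.exists_eq_add_of_le hN
    refine ⟨k, ?_⟩
    have h2 := (evDiag_map a b hu h M n k m).symm.trans h1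
    exact (extMk_eq_zero_iff _ _ _ _ _ _ _ _).1 h2
  · rintro ⟨k, h1⟩
    have h2 := (extMk_eq_zero_iff (a ^ (n + k)) (b ^ (n + k))
      (Ideal.span {a ^ (n + k), b ^ (n + k)}) rfl (hu (n + k)) (h (n + k)) M _).2 h1
    have h3 := (evDiag_map a b hu h M n k m).trans h2
    refine (evCocone_map a b M n (n + k) (Nat.le_add_right n k) _).symm.trans ?_
    exact (congrArg ((evCocone a b M).ι.app (Opposite.op (Opposite.op (n + k)))) h3).trans
      (map_zero ((evCocone a b M).ι.app (Opposite.op (Opposite.op (n + k)))).hom)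

end cls

theorem aux_support {S : Type u} [CommRing S] [IsNoetherianRing S]
    [IsLocalRing S] (x y a b : S)
    (hu : ∀ (n : ℕ) (c : S), c * a ^ n = 0 → c = 0)
    (h : ∀ (n : ℕ) (p q : S), p * a ^ n + q * b ^ n = 0 → ∃ c, p = -(c * b ^ n) ∧ q = c * a ^ n)
    (hmon : ∀ (n : ℕ) (c d p q : S),
      (a * b) ^ n = c * a ^ (n + 1) + d * b ^ (n + 1) + p * x + q * y → False)
    (hgen : IsLocalRing.maximalIdeal S = Ideal.span {x, y, a, b}) :
    Module.support S ((localCohomology (Ideal.span {a, b}) 2).obj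
        (ModuleCat.of S (S ⧸ Ideal.span {x * a + y * b}))) =
      {IsLocalRing.closedPoint S} := by
  rw [← (evEquiv a b _).support_eq]
  set M := ModuleCat.of S (S ⧸ Ideal.span {x * a + y * b}) with hM
  have hrel : ∀ m : M, (x * a) • m = (- (y * b)) • m := by
    intro m
    obtain ⟨s, rfl⟩ := Ideal.Quotient.mk_surjective (I := Ideal.span {x * a + y * b}) m
    change Ideal.Quotient.mk (Ideal.span {x * a + y * b}) ((x * a) * s) =
      Ideal.Quotient.mk (Ideal.span {x * a + y * b}) (-(y * b) * s)
    rw [Ideal.Quotient.eq]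
    exact Ideal.mem_span_singleton'.2 ⟨s, by ring⟩
  have hrel1 : ∀ (n : ℕ) (m : M), ((x * a) ^ n) • m = ((- (y * b)) ^ n) • m := by
    intro n
    induction n with
    | zero => intro m; simp
    | succ n ih =>
      intro m
      rw [pow_succ, pow_succ, mul_smul _ (x * a), mul_smul _ (-(y * b)), hrel, ih]
  have hkill : ∀ z : (evCocone a b M).pt, ∃ n : ℕ, x ^ n • z = 0 ∧ y ^ n • z = 0 ∧
      a ^ n • z = 0 ∧ b ^ n • z = 0 := by
    intro z
    obtain ⟨n, m, rfl⟩ := auxCls_surj a b hu h M z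
    refine ⟨n, ?_, ?_, ?_, ?_⟩
    · rw [← auxCls_smul, auxCls_eq_zero_iff]
      refine ⟨n, 0, (-y) ^ n • m, ?_⟩
      rw [smul_zero, zero_add, smul_smul, smul_smul]
      calc (a ^ n * b ^ n * x ^ n) • m = (b ^ n) • ((x * a) ^ n) • m := by
            rw [smul_smul]; congr 1; ring
        _ = _ := by
            rw [hrel1, smul_smul]; congr 1
            rw [neg_mul_eq_neg_mul, mul_pow]; ring
    · rw [← auxCls_smul, auxCls_eq_zero_iff]
      refine ⟨n, (-x) ^ n • m, 0, ?_⟩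
      rw [smul_zero, add_zero, smul_smul, smul_smul]
      calc (a ^ n * b ^ n * y ^ n) • m = ((-1) ^ n * a ^ n) • ((- (y * b)) ^ n) • m := by
            rw [smul_smul]; congr 1
            rw [neg_pow (y * b), mul_pow]
            have : ((-1 : S)) ^ n * (-1) ^ n = 1 := by rw [← mul_pow]; simp
            linear_combination (-(a ^ n * b ^ n * y ^ n)) * this
        _ = _ := by
            rw [← hrel1, smul_smul]; congr 1
            rw [neg_pow x, mul_pow]; ring
    · rw [← auxCls_smul, auxCls_eq_zero_iff]
      exact ⟨0, m, 0, by simp⟩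
    · rw [← auxCls_smul, auxCls_eq_zero_iff]
      exact ⟨0, 0, m, by simp⟩
  have hne : ∃ z : (evCocone a b M).pt, z ≠ 0 := by
    refine ⟨auxCls a b hu h M 1 (Ideal.Quotient.mk (Ideal.span {x * a + y * b}) 1), ?_⟩
    rw [Ne, auxCls_eq_zero_iff]
    rintro ⟨k, p, q, hpq⟩
    obtain ⟨p, rfl⟩ := Ideal.Quotient.mk_surjective (I := Ideal.span {x * a + y * b}) p
    obtain ⟨q, rfl⟩ := Ideal.Quotient.mk_surjective (I := Ideal.span {x * a + y * b}) q
    have hpq' : Ideal.Quotient.mk (Ideal.span {x * a + y * b}) ((a ^ k * b ^ k) * 1) =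
      Ideal.Quotient.mk (Ideal.span {x * a + y * b}) (a ^ (1 + k) * p + b ^ (1 + k) * q) := hpq
    rw [Ideal.Quotient.eq] at hpq'
    obtain ⟨c, hc⟩ := Ideal.mem_span_singleton'.1 hpq'
    refine hmon k p q (c * a) (c * b) ?_
    rw [mul_pow]
    linear_combination -hc
  have hsub : ∀ p ∈ Module.support S (evCocone a b M).pt, p = IsLocalRing.closedPoint S := by
    intro p hp
    rw [Module.mem_support_iff_exists_annihilator] at hp
    obtain ⟨z, hz⟩ := hp
    obtain ⟨n, h1, h2, h3, h4⟩ := hkill z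
    have key : ∀ r : S, r ^ n • z = 0 → r ∈ p.asIdeal := fun r hr =>
      p.2.mem_of_pow_mem n (hz ((Submodule.mem_annihilator_span_singleton z _).2 hr))
    have hle : IsLocalRing.maximalIdeal S ≤ p.asIdeal := by
      rw [hgen, Ideal.span_le]
      rintro w (rfl | rfl | rfl | rfl)
      exacts [key _ h1, key _ h2, key _ h3, key _ h4]
    ext1
    exact ((IsLocalRing.maximalIdeal.isMaximal S).eq_of_le p.2.ne_top hle).symm
  obtain ⟨z, hz⟩ := hne
  have hnt : Nontrivial (evCocone a b M).pt := ⟨z, 0, hz⟩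
  obtain ⟨p, hp⟩ := (Module.nonempty_support_iff (R := S) (M := (evCocone a b M).pt)).2 hnt
  refine Set.Subset.antisymm hsub ?_
  rintro w rfl
  rw [← hsub p hp]
  exact hp

end partB

/-- Let `(S, n)` be a regular local ring of dimension 4 with regular system of
parameters `x, y, u, v`, and set `a := x*u + y*v`.  Then the support of the `S`-module
`H^2_{(u,v)S}(S/aS)` is exactly `{n}` (the closed point of `Spec S`). -/
theorem support_localCohomology_two_eq_closedPoint {S : Type u} [CommRing S] [IsNoetherianRing S]
    [IsLocalRing S] (x y u v : S)
    (hgen : IsLocalRing.maximalIdeal S = Ideal.span {x, y, u, v})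
    (hdim : ringKrullDim S = 4) :
    Module.support S ((localCohomology (Ideal.span {u, v}) 2).obj
        (ModuleCat.of S (S ⧸ Ideal.span {x * u + y * v}))) =
      {IsLocalRing.closedPoint S} := by
  obtain ⟨h, hu, hdom, hmon⟩ := aux_regular x y u v hgen hdim
  exact aux_support x y u v
    (fun n c hc => (mul_eq_zero.1 hc).resolve_right (pow_ne_zero n hu)) h hmon hgen
end

section
/- Let (S, n, k) be a regular local ring of dimension 4, let x, y, u, v be a regular system of parameters for S, and set a := x·u + y·v. Then the socle Soc_S H^2_{(u,v)S}(S/aS) = (0 :_{H^2_{(u,v)S}(S/aS)} n) is an infinite dimensional k-vector space. -/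
universe u

section P0
open IsLocalRing

theorem pow_decomp {R : Type u} [CommRing R] (x v : R) (N : ℕ) :
    ∀ z ∈ Ideal.span {x, v} ^ (N + 1), ∃ w ∈ Ideal.span {x, v} ^ N, ∃ c, z = x * w + c * v ^ (N + 1) := by
  induction N with
  | zero =>
    intro z hz
    rw [zero_add, pow_one] at hz
    obtain ⟨a, b, rfl⟩ := Ideal.mem_span_pair.mp hz
    exact ⟨a, by simp, b, by ring⟩
  | succ N ih =>
    intro z hz
    rw [pow_succ] at hz
    refine Submodule.mul_induction_on hz ?_ ?_
    · intro a ha b hb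
      obtain ⟨w, hw, c, hc⟩ := ih a ha
      obtain ⟨α, β, rfl⟩ := Ideal.mem_span_pair.mp hb
      refine ⟨α * a + β * (w * v), ?_, c * β, ?_⟩
      · refine Ideal.add_mem _ (Ideal.mul_mem_left _ _ ha) (Ideal.mul_mem_left _ _ ?_)
        rw [pow_succ]
        exact Ideal.mul_mem_mul hw (Ideal.subset_span (by simp))
      · have e : a * (α * x + β * v) = x * (α * a) + β * v * a := by ring
        rw [e]
        nth_rw 2 [hc]
        ring
    · rintro _ _ ⟨w, hw, c, rfl⟩ ⟨w', hw', c', rfl⟩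
      exact ⟨w + w', Ideal.add_mem _ hw hw', c + c', by ring⟩

theorem pow_reg {R : Type u} [CommRing R] (K : Ideal R) (v : R) (hv : ∀ b, v * b ∈ K → b ∈ K) (n : ℕ) :
    ∀ b, v ^ n * b ∈ K → b ∈ K := by
  induction n with
  | zero => intro b hb; simpa using hb
  | succ n ih =>
    intro b hb
    exact hv b (ih _ (by rw [← mul_assoc, ← pow_succ]; exact hb))

/-- Lemma C -/
theorem reg_pow {R : Type u} [CommRing R] (J : Ideal R) (x v z : R)
    (hx : ∀ b, x * b ∈ J → b ∈ J) (hv : ∀ b, v * b ∈ J ⊔ Ideal.span {x} → b ∈ J ⊔ Ideal.span {x})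
    (hz : ∀ b, z * b ∈ J ⊔ Ideal.span {x, v} → b ∈ J ⊔ Ideal.span {x, v}) (q : ℕ) :
    ∀ b, z * b ∈ J ⊔ Ideal.span {x, v} ^ q → b ∈ J ⊔ Ideal.span {x, v} ^ q := by
  have hxI : x ∈ Ideal.span {x, v} := Ideal.subset_span (by simp)
  have hvI : v ∈ Ideal.span {x, v} := Ideal.subset_span (by simp)
  have hJx : J ⊔ Ideal.span {x} ≤ J ⊔ Ideal.span {x, v} :=
    sup_le_sup le_rfl (Ideal.span_mono (by simp))
  induction q with
  | zero => intro b _; simp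
  | succ q ih =>
    intro b hb
    have hb1 : b ∈ J ⊔ Ideal.span {x, v} ^ q :=
      ih b ((sup_le_sup (le_refl J) (Ideal.pow_le_pow_right (I := Ideal.span {x, v}) (Nat.le_succ q)) :
        J ⊔ Ideal.span {x, v} ^ (q + 1) ≤ J ⊔ Ideal.span {x, v} ^ q) hb)
    rcases q with _ | q
    · rw [zero_add, pow_one] at hb ⊢; exact hz b hb
    obtain ⟨j, hj, t, ht, htb⟩ := Submodule.mem_sup.mp hb
    obtain ⟨w, hw, c, rfl⟩ := pow_decomp x v _ t ht
    obtain ⟨j1, hj1, t1, ht1, rfl⟩ := Submodule.mem_sup.mp hb1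
    obtain ⟨b', hb', d, rfl⟩ := pow_decomp x v _ t1 ht1
    have h1 : z * d - c * v ∈ J ⊔ Ideal.span {x} := by
      apply pow_reg _ v hv (q + 1)
      have e : v ^ (q + 1) * (z * d - c * v) = (j - z * j1) + (w - z * b') * x := by
        linear_combination -htb
      rw [e]
      exact Submodule.add_mem_sup (J.sub_mem hj (J.mul_mem_left _ hj1))
        (Ideal.mul_mem_left _ _ (Ideal.mem_span_singleton_self x))
    have hd : d ∈ J ⊔ Ideal.span {x, v} := by
      apply hz
      have e : z * d = (z * d - c * v) + c * v := by ring
      rw [e]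
      exact Ideal.add_mem _ (hJx h1) (Ideal.mul_mem_left _ _ (Submodule.mem_sup_right hvI))
    obtain ⟨j2, hj2, t2, ht2, h2⟩ := Submodule.mem_sup.mp h1
    obtain ⟨e, rfl⟩ := Ideal.mem_span_singleton'.mp ht2
    have h3 : z * b' + e * v ^ (q + 1) - w ∈ J := by
      apply hx
      have e : x * (z * b' + e * v ^ (q + 1) - w) = j - z * j1 - v ^ (q+1) * j2 := by
        linear_combination v ^ (q+1) * h2 - htb
      rw [e]
      exact J.sub_mem (J.sub_mem hj (J.mul_mem_left _ hj1)) (J.mul_mem_left _ hj2)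
    have h4 : b' ∈ J ⊔ Ideal.span {x, v} ^ (q + 1) := by
      apply ih
      have e : z * b' = (z * b' + e * v ^ (q + 1) - w) + (w - e * v ^ (q + 1)) := by ring
      rw [e]
      exact Submodule.add_mem_sup h3 (Ideal.sub_mem _ hw (Ideal.mul_mem_left _ _ (Ideal.pow_mem_pow hvI _)))
    obtain ⟨j3, hj3, t3, ht3, rfl⟩ := Submodule.mem_sup.mp h4
    obtain ⟨j4, hj4, t4, ht4, rfl⟩ := Submodule.mem_sup.mp hd
    have e : j1 + (x * (j3 + t3) + (j4 + t4) * v ^ (q + 1)) =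
      (j1 + x * j3 + v ^ (q+1) * j4) + (x * t3 + t4 * v ^ (q+1)) := by ring
    rw [e]
    refine Submodule.add_mem_sup ?_ ?_
    · exact J.add_mem (J.add_mem hj1 (J.mul_mem_left _ hj3)) (J.mul_mem_left _ hj4)
    · rw [pow_succ' (Ideal.span {x, v})]
      exact Ideal.add_mem _ (Ideal.mul_mem_mul hxI ht3) (Ideal.mul_mem_mul ht4 (Ideal.pow_mem_pow hvI _))

/-- Lemma A -/
theorem quasi_reg {R : Type u} [CommRing R] (J : Ideal R) (x v : R)
    (hx : ∀ b, x * b ∈ J → b ∈ J) (hv : ∀ b, v * b ∈ J ⊔ Ideal.span {x} → b ∈ J ⊔ Ideal.span {x})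
    (N : ℕ) : ∀ c : ℕ → R, ∑ i ∈ Finset.range (N + 1), c i * x ^ i * v ^ (N - i) ∈ J ⊔ Ideal.span {x, v} ^ (N + 1) →
    ∀ i ≤ N, c i ∈ J ⊔ Ideal.span {x, v} := by
  have hxI : x ∈ Ideal.span {x, v} := Ideal.subset_span (by simp)
  have hvI : v ∈ Ideal.span {x, v} := Ideal.subset_span (by simp)
  have hJx : J ⊔ Ideal.span {x} ≤ J ⊔ Ideal.span {x, v} :=
    sup_le_sup le_rfl (Ideal.span_mono (by simp))
  induction N with
  | zero =>
    intro c hc i hi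
    obtain rfl : i = 0 := by omega
    simpa using hc
  | succ N ih =>
    intro c hc
    obtain ⟨j, hj, t, ht, htb⟩ := Submodule.mem_sup.mp hc
    obtain ⟨w, hw, e, rfl⟩ := pow_decomp x v _ t ht
    rw [Finset.sum_range_succ'] at htb
    have hs : ∑ k ∈ Finset.range (N + 1), c (k + 1) * x ^ (k + 1) * v ^ (N + 1 - (k + 1)) =
        x * ∑ k ∈ Finset.range (N + 1), c (k + 1) * x ^ k * v ^ (N - k) := by
      rw [Finset.mul_sum]
      refine Finset.sum_congr rfl fun k _ => ?_
      rw [Nat.add_sub_add_right]; ring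
    rw [hs] at htb
    set σ := ∑ k ∈ Finset.range (N + 1), c (k + 1) * x ^ k * v ^ (N - k) with hσ
    simp only [pow_zero, mul_one, Nat.sub_zero] at htb
    have h1 : c 0 - e * v ∈ J ⊔ Ideal.span {x} := by
      apply pow_reg _ v hv (N + 1)
      have e : v ^ (N + 1) * (c 0 - e * v) = j + (w - σ) * x := by linear_combination -htb
      rw [e]
      exact Submodule.add_mem_sup hj (Ideal.mul_mem_left _ _ (Ideal.mem_span_singleton_self x))
    have hc0 : c 0 ∈ J ⊔ Ideal.span {x, v} := by
      have e : c 0 = (c 0 - e * v) + e * v := by ring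
      rw [e]
      exact Ideal.add_mem _ (hJx h1) (Ideal.mul_mem_left _ _ (Submodule.mem_sup_right hvI))
    obtain ⟨j2, hj2, t2, ht2, h2⟩ := Submodule.mem_sup.mp h1
    obtain ⟨f, rfl⟩ := Ideal.mem_span_singleton'.mp ht2
    have h3 : σ + f * v ^ (N + 1) - w ∈ J := by
      apply hx
      have e : x * (σ + f * v ^ (N + 1) - w) = j - v ^ (N+1) * j2 := by
        linear_combination v ^ (N+1) * h2 - htb
      rw [e]
      exact J.sub_mem hj (J.mul_mem_left _ hj2)
    have h4 : σ ∈ J ⊔ Ideal.span {x, v} ^ (N + 1) := by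
      have e : σ = (σ + f * v ^ (N + 1) - w) + (w - f * v ^ (N + 1)) := by ring
      rw [e]
      exact Submodule.add_mem_sup h3 (Ideal.sub_mem _ hw (Ideal.mul_mem_left _ _ (Ideal.pow_mem_pow hvI _)))
    have h5 := ih (fun k => c (k + 1)) h4
    intro i hi
    rcases i with _ | i
    · exact hc0
    · exact h5 i (by omega)

theorem decompE {S : Type u} [CommRing S] (x y u v : S)
    (hx : ∀ b, x * b = 0 → b = 0) (hv : ∀ b, v * b ∈ Ideal.span {x} → b ∈ Ideal.span {x})
    (hy : ∀ b, y * b ∈ Ideal.span {x, v} → b ∈ Ideal.span {x, v})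
    (hx' : ∀ b, x * b ∈ Ideal.span {y} → b ∈ Ideal.span {y})
    (hv' : ∀ b, v * b ∈ Ideal.span {y, x} → b ∈ Ideal.span {y, x})
    (hu' : ∀ b, u * b ∈ Ideal.span {y, x, v} → b ∈ Ideal.span {y, x, v}) (q : ℕ)
    (β : S) (hβ : β ∈ Ideal.span {x, v} ^ q) (hβ2 : β ∈ Ideal.span {u, y}) :
    ∃ β' ∈ Ideal.span {x, v} ^ q, ∃ β'' ∈ Ideal.span {x, v} ^ q, β = y * β' + u * β'' := by
  obtain ⟨d, c, rfl⟩ := Ideal.mem_span_pair.mp hβ2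
  have C1 := reg_pow (Ideal.span {y}) x v u hx' (by rw [← Ideal.span_insert]; exact hv')
    (by rw [← Ideal.span_insert]; exact hu') q d (by
      have e : u * d = (-c) * y + (d * u + c * y) := by ring
      rw [e]
      exact Submodule.add_mem_sup (Ideal.mul_mem_left _ _ (Ideal.mem_span_singleton_self y)) hβ)
  obtain ⟨j, hj, β'', hβ'', rfl⟩ := Submodule.mem_sup.mp C1
  obtain ⟨δ, rfl⟩ := Ideal.mem_span_singleton'.mp hj
  have C2 := reg_pow ⊥ x v y (by simpa using hx) (by simpa using hv) (by simpa using hy) q (c + u * δ) (by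
      have e : y * (c + u * δ) = ((δ * y + β'') * u + c * y) - u * β'' := by ring
      rw [e, bot_sup_eq]
      exact Ideal.sub_mem _ hβ (Ideal.mul_mem_left _ _ hβ''))
  rw [bot_sup_eq] at C2
  exact ⟨_, C2, β'', hβ'', by ring⟩

theorem lemB {S : Type u} [CommRing S] (x y u v : S)
    (hx : ∀ b, x * b = 0 → b = 0) (hv : ∀ b, v * b ∈ Ideal.span {x} → b ∈ Ideal.span {x})
    (hy : ∀ b, y * b ∈ Ideal.span {x, v} → b ∈ Ideal.span {x, v})
    (hx' : ∀ b, x * b ∈ Ideal.span {y} → b ∈ Ideal.span {y})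
    (hv' : ∀ b, v * b ∈ Ideal.span {y, x} → b ∈ Ideal.span {y, x})
    (hu' : ∀ b, u * b ∈ Ideal.span {y, x, v} → b ∈ Ideal.span {y, x, v})
    (hu0 : ∀ b, u * b = 0 → b = 0)
    (hvu : ∀ b, v * b ∈ Ideal.span {u} → b ∈ Ideal.span {u})
    (hyu : ∀ b, y * b ∈ Ideal.span {u} → b ∈ Ideal.span {u})
    (hvuy : ∀ b, v * b ∈ Ideal.span {u, y} → b ∈ Ideal.span {u, y}) (p : ℕ) :
    ∀ (q : ℕ) (b α β γ : S), β ∈ Ideal.span {x, v} ^ q →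
      b * u ^ p * v = α * u ^ (p + 1) + β * v ^ (p + 1) + γ * (x * u + y * v) →
      b ∈ Ideal.span {u, y} ⊔ Ideal.span {x, v} ^ (q + p) := by
  induction p with
  | zero =>
    intro q b α β γ hβ h
    have h1 : b - β - γ * y ∈ Ideal.span {u} := by
      apply hvu
      rw [Ideal.mem_span_singleton']
      exact ⟨α + γ * x, by linear_combination -h⟩
    obtain ⟨t, ht⟩ := Ideal.mem_span_singleton'.mp h1
    have e : b = (t * u + γ * y) + β := by linear_combination -ht
    rw [e]
    exact Submodule.add_mem_sup (Ideal.mem_span_pair.mpr ⟨t, γ, rfl⟩) hβ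
  | succ p ih =>
    intro q b α β γ hβ h
    have h1 : β * v ^ (p + 1) + γ * y ∈ Ideal.span {u} := by
      apply hvu
      rw [Ideal.mem_span_singleton']
      exact ⟨b * u ^ p * v - α * u ^ (p + 1) - γ * x, by linear_combination h⟩
    obtain ⟨t, ht⟩ := Ideal.mem_span_singleton'.mp h1
    have h2 : β ∈ Ideal.span {u, y} := by
      apply pow_reg _ v hvuy (p + 1)
      exact Ideal.mem_span_pair.mpr ⟨t, -γ, by linear_combination ht⟩
    obtain ⟨β', hβ', β'', hβ'', rfl⟩ := decompE x y u v hx hv hy hx' hv' hu' q β hβ h2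
    have h3 : β' * v ^ (p + 1) + γ ∈ Ideal.span {u} := by
      apply hyu
      rw [Ideal.mem_span_singleton']
      exact ⟨t - β'' * v ^ (p + 1), by linear_combination ht⟩
    obtain ⟨γ', hγ'⟩ := Ideal.mem_span_singleton'.mp h3
    have h4 := ih (q + 1) b α (β'' * v - β' * x) γ' (by
      rw [pow_succ]
      exact Ideal.sub_mem _ (Ideal.mul_mem_mul hβ'' (Ideal.subset_span (by simp)))
        (Ideal.mul_mem_mul hβ' (Ideal.subset_span (by simp)))) (by
      rw [← sub_eq_zero]
      apply hu0
      linear_combination h - hγ' * (x * u + y * v))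
    rwa [show q + (p + 1) = q + 1 + p by omega]

theorem dom_aux (n : ℕ) : ∀ (R : Type u) [CommRing R] [IsNoetherianRing R] [IsLocalRing R]
    (g : Fin n → R), maximalIdeal R = Ideal.span (Set.range g) → (n : WithBot ℕ∞) ≤ ringKrullDim R →
    IsDomain R := by
  induction n with
  | zero =>
    intro R _ _ _ g hg _
    have : maximalIdeal R = ⊥ := by rw [hg]; simp
    have hF : IsField R := isField_iff_maximalIdeal_eq.mpr this
    exact hF.isDomain
  | succ n ih =>
    intro R _ _ _ g hg hd
    have hht : (maximalIdeal R).height ≠ 0 := by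
      intro h0
      rw [← maximalIdeal_height_eq_ringKrullDim, h0] at hd
      have : ((n+1 : ℕ) : WithBot ℕ∞) ≤ ((0:ℕ) : WithBot ℕ∞) := by simp at hd
      have := Nat.cast_le.mp this
      omega
    have hnotmin : ∀ q ∈ minimalPrimes R, ¬ maximalIdeal R ≤ q := by
      intro q hq hle
      have hqp : q.IsPrime := hq.1.1
      have : q = maximalIdeal R := le_antisymm (le_maximalIdeal hqp.ne_top) hle
      subst this
      exact hht (Ideal.height_eq_zero_iff.mpr hq)
    have hsq : ¬ maximalIdeal R ≤ maximalIdeal R ^ 2 := by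
      intro hle
      have hbot : maximalIdeal R = ⊥ := by
        apply Submodule.eq_bot_of_le_smul_of_le_jacobson_bot (maximalIdeal R)
        · exact IsNoetherian.noetherian _
        · simpa [pow_two] using hle
        · exact maximalIdeal_le_jacobson _
      obtain ⟨q, hq, hqle⟩ := Ideal.exists_minimalPrimes_le (I := (⊥ : Ideal R)) (J := maximalIdeal R) bot_le
      exact hnotmin q hq (by rw [hbot]; exact bot_le)
    have hfin := minimalPrimes.finite_of_isNoetherianRing R
    have hav : ¬ ((maximalIdeal R : Set R) ⊆ ⋃ i ∈ (↑(insert (maximalIdeal R ^ 2) hfin.toFinset) : Set (Ideal R)), (i : Set R)) := by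
      rw [Ideal.subset_union_prime (f := fun i : Ideal R => i) (maximalIdeal R ^ 2) (maximalIdeal R ^ 2)]
      · rintro ⟨i, hi, hle⟩
        simp only [Finset.mem_insert, Set.Finite.mem_toFinset] at hi
        rcases hi with rfl | hi
        · exact hsq hle
        · exact hnotmin i hi hle
      · intro i hi hne _
        simp only [Finset.mem_insert, Set.Finite.mem_toFinset] at hi
        rcases hi with rfl | hi
        · exact absurd rfl hne
        · exact hi.1.1
    obtain ⟨x, hxm, hx⟩ := Set.not_subset.mp hav
    simp only [Finset.coe_insert, Set.Finite.coe_toFinset, Set.mem_insert_iff, Set.mem_iUnion, not_exists] at hx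
    have hx2 : x ∉ maximalIdeal R ^ 2 := fun h => hx _ (Or.inl rfl) h
    have hxq : ∀ q ∈ minimalPrimes R, x ∉ q := fun q hq h => hx q (Or.inr hq) h
    have hxm' : x ∈ maximalIdeal R := hxm
    obtain ⟨a, ha⟩ := Ideal.mem_span_range_iff_exists_fun.mp (hg ▸ hxm')
    have hgm : ∀ i, g i ∈ maximalIdeal R := fun i => by rw [hg]; exact Ideal.subset_span ⟨i, rfl⟩
    obtain ⟨i, hi⟩ : ∃ i, a i ∉ maximalIdeal R := by
      by_contra hcon
      push Not at hcon
      apply hx2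
      rw [← ha, pow_two]
      exact Ideal.sum_mem _ fun i _ => Ideal.mul_mem_mul (hcon i) (hgm i)
    have hu : IsUnit (a i) := by simpa using hi
    have hne : Ideal.span {x} ≠ (⊤ : Ideal R) := by
      intro h
      have : Ideal.span {x} ≤ maximalIdeal R := by simpa [Ideal.span_le] using hxm'
      exact (maximalIdeal.isMaximal R).ne_top (top_le_iff.mp (h ▸ this))
    have : Nontrivial (R ⧸ Ideal.span {x}) := Ideal.Quotient.nontrivial_iff.mpr hne
    have : IsLocalRing (R ⧸ Ideal.span {x}) := IsLocalRing.of_surjective' _ Ideal.Quotient.mk_surjective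
    have hdom : IsDomain (R ⧸ Ideal.span {x}) := by
      apply ih (R ⧸ Ideal.span {x}) (fun j => Ideal.Quotient.mk _ (g (i.succAbove j)))
      · rw [← map_maximalIdeal_of_surjective _ Ideal.Quotient.mk_surjective]
        apply le_antisymm
        · rw [hg, Ideal.map_span, Ideal.span_le]
          rintro _ ⟨_, ⟨k, rfl⟩, rfl⟩
          by_cases hk : k = i
          · subst hk
            have h0 : (Ideal.Quotient.mk (Ideal.span {x})) x = 0 := by
              rw [Ideal.Quotient.eq_zero_iff_mem]; exact Ideal.mem_span_singleton_self x
            rw [Fin.sum_univ_succAbove _ k] at ha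
            conv at h0 => lhs; arg 2; rw [← ha]
            rw [map_add, map_mul, map_sum] at h0
            have h1 : (Ideal.Quotient.mk (Ideal.span {x})) (a k) * (Ideal.Quotient.mk (Ideal.span {x})) (g k) ∈ Ideal.span (Set.range fun j => Ideal.Quotient.mk (Ideal.span {x}) (g (k.succAbove j))) := by
              rw [eq_neg_of_add_eq_zero_left h0]
              apply Submodule.neg_mem
              refine Ideal.sum_mem _ fun j _ => ?_
              rw [map_mul]
              exact Ideal.mul_mem_left _ _ (Ideal.subset_span ⟨j, rfl⟩)
            exact (Ideal.unit_mul_mem_iff_mem _ (hu.map _)).mp h1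
          · obtain ⟨j, rfl⟩ := Fin.exists_succAbove_eq hk
            exact Ideal.subset_span ⟨j, rfl⟩
        · rw [Ideal.span_le]
          rintro _ ⟨j, rfl⟩
          exact Ideal.mem_map_of_mem _ (hgm _)
      · have h := ringKrullDim_le_ringKrullDim_quotient_add_encard ({x} : Set R) (by
          simpa [IsLocalRing.ringJacobson_eq_maximalIdeal] using hxm')
        simp only [Set.encard_singleton] at h
        have h2 := hd.trans h
        push_cast at h2
        exact ENat.WithBot.add_le_add_one_right_iff.mp h2
    have hp : (Ideal.span {x}).IsPrime := (Ideal.Quotient.isDomain_iff_prime _).mp hdom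
    obtain ⟨q, hq, hqle⟩ := Ideal.exists_minimalPrimes_le (I := (⊥ : Ideal R)) (J := Ideal.span {x}) bot_le
    have hqp : q.IsPrime := hq.1.1
    have hqbot : q = ⊥ := by
      apply Submodule.eq_bot_of_le_smul_of_le_jacobson_bot (maximalIdeal R)
      · exact IsNoetherian.noetherian _
      · intro b hb
        obtain ⟨c, rfl⟩ := Ideal.mem_span_singleton'.mp (hqle hb)
        rw [mul_comm]
        exact Submodule.smul_mem_smul hxm' ((hqp.mem_or_mem hb).resolve_right (hxq q hq))
      · exact maximalIdeal_le_jacobson _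
    subst hqbot
    exact IsDomain.of_bot_isPrime R

theorem prime_sub {S : Type u} [CommRing S] [IsNoetherianRing S] [IsLocalRing S] (s : Finset S) (n : ℕ)
    (b : Fin n → S) (hgen : maximalIdeal S = Ideal.span (↑s ∪ Set.range b))
    (hd : ((n + s.card : ℕ) : WithBot ℕ∞) ≤ ringKrullDim S) : (Ideal.span (s : Set S)).IsPrime := by
  have hle : Ideal.span (s : Set S) ≤ maximalIdeal S := by
    rw [hgen]; exact Ideal.span_mono Set.subset_union_left
  have hne : Ideal.span (s : Set S) ≠ ⊤ := fun h =>
    (maximalIdeal.isMaximal S).ne_top (top_le_iff.mp (h ▸ hle))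
  have : Nontrivial (S ⧸ Ideal.span (s : Set S)) := Ideal.Quotient.nontrivial_iff.mpr hne
  have : IsLocalRing (S ⧸ Ideal.span (s : Set S)) := IsLocalRing.of_surjective' _ Ideal.Quotient.mk_surjective
  apply (Ideal.Quotient.isDomain_iff_prime _).mp
  apply dom_aux n _ (fun j => Ideal.Quotient.mk _ (b j))
  · rw [← map_maximalIdeal_of_surjective _ Ideal.Quotient.mk_surjective, hgen, Ideal.span_union,
      Ideal.map_sup, Ideal.map_quotient_self, bot_sup_eq, Ideal.map_span, ← Set.range_comp]
    rfl
  · have h := ringKrullDim_le_ringKrullDim_quotient_add_card s (by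
      rw [IsLocalRing.ringJacobson_eq_maximalIdeal]
      exact fun z hz => hle (Ideal.subset_span hz))
    have h2 := hd.trans h
    push_cast at h2
    exact ENat.WithBot.add_le_add_natCast_right_iff.mp h2

theorem not_three {S : Type u} [CommRing S] [IsNoetherianRing S] [IsLocalRing S] (p q r : S)
    (hdim : ringKrullDim S = 4) : maximalIdeal S ≠ Ideal.span {p, q, r} := by
  classical
  intro h
  have h1 := ringKrullDim_le_spanFinrank_maximalIdeal S
  rw [hdim, h] at h1
  have h2 := Submodule.spanFinrank_span_le_ncard_of_finite (R := S) (s := ({p, q, r} : Set S)) (by simp)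
  have h3 : ({p, q, r} : Set S).ncard ≤ 3 := by
    have := Finset.card_le_three (a := p) (b := q) (c := r)
    rw [← Set.ncard_coe_finset] at this
    simpa using this
  have h4 : ((4 : ℕ) : WithBot ℕ∞) ≤ ((Submodule.spanFinrank (Ideal.span {p, q, r}) : ℕ) : WithBot ℕ∞) := by
    exact_mod_cast h1
  have h5 := Nat.cast_le.mp h4
  have : (Ideal.span {p, q, r}).spanFinrank ≤ 3 := h2.trans h3
  omega

/-- the regular sequence facts -/
theorem reg_facts {S : Type u} [CommRing S] [IsNoetherianRing S] [IsLocalRing S] (p q r s : S)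
    (hgen : maximalIdeal S = Ideal.span {p, q, r, s}) (hdim : ringKrullDim S = 4) :
    (∀ b, p * b = 0 → b = 0) ∧ (∀ b, q * b ∈ Ideal.span {p} → b ∈ Ideal.span {p}) ∧
    (∀ b, r * b ∈ Ideal.span {p, q} → b ∈ Ideal.span {p, q}) ∧
    (∀ b, s * b ∈ Ideal.span {p, q, r} → b ∈ Ideal.span {p, q, r}) := by
  classical
  have hp4 : p ∉ Ideal.span {q, r, s} := fun h => not_three q r s hdim (by
    rw [hgen, Ideal.span_insert p, sup_eq_right, Ideal.span_singleton_le_iff_mem]; exact h)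
  have hq4 : q ∉ Ideal.span {p, r, s} := fun h => not_three p r s hdim (by
    rw [hgen, Set.insert_comm, Ideal.span_insert q, sup_eq_right, Ideal.span_singleton_le_iff_mem]; exact h)
  have hr4 : r ∉ Ideal.span {p, q, s} := fun h => not_three p q s hdim (by
    rw [hgen, Set.insert_comm q, Set.insert_comm p, Ideal.span_insert r, sup_eq_right, Ideal.span_singleton_le_iff_mem]; exact h)
  have hs4 : s ∉ Ideal.span {p, q, r} := fun h => not_three p q r hdim (by
    rw [hgen, Set.pair_comm r, Set.insert_comm q, Set.insert_comm p, Ideal.span_insert s, sup_eq_right, Ideal.span_singleton_le_iff_mem]; exact h)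
  have key : ∀ (A : Finset S) (n : ℕ) (b : Fin n → S), ({p, q, r, s} : Set S) = ↑A ∪ Set.range b → n + A.card ≤ 4 →
      (Ideal.span (A : Set S)).IsPrime := by
    intro A n b h1 h2
    apply prime_sub A n b (by rw [← h1, hgen])
    rw [hdim]
    exact_mod_cast h2
  have P0 := key ∅ 4 ![p, q, r, s] (by simp; ext; simp; tauto) (by simp)
  have P1 := key {p} 3 ![q, r, s] (by simp; ext; simp; tauto) (by simp)
  have P2 := key {p, q} 2 ![r, s] (by simp; ext; simp; tauto) (by have := Finset.card_le_two (a := p) (b := q); omega)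
  have P3 := key {p, q, r} 1 ![s] (by simp; ext; simp; tauto) (by have := Finset.card_le_three (a := p) (b := q) (c := r); omega)
  simp only [Finset.coe_insert, Finset.coe_singleton, Finset.coe_empty, Ideal.span_empty] at P0 P1 P2 P3
  refine ⟨fun b hb => ?_, fun b hb => (P1.mem_or_mem hb).resolve_left fun h => hq4 (Ideal.span_mono (by simp) h),
    fun b hb => (P2.mem_or_mem hb).resolve_left fun h => hr4 (Ideal.span_mono (by intro z; simp; tauto) h),
    fun b hb => (P3.mem_or_mem hb).resolve_left hs4⟩
  have : p * b ∈ (⊥ : Ideal S) := by simpa using hb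
  rcases P0.mem_or_mem this with h | h
  · exact absurd (Ideal.zero_mem _) (by rw [Ideal.mem_bot] at h; exact h ▸ hp4)
  · simpa using h

theorem final_alg {S : Type u} [CommRing S] [IsNoetherianRing S] [IsLocalRing S] (x y u v : S)
    (hgen : maximalIdeal S = Ideal.span {x, y, u, v}) (hdim : ringKrullDim S = 4) (N : ℕ) (c : ℕ → S)
    (h : (∑ i ∈ Finset.range (N + 1), c i * x ^ i * v ^ (N - i)) * u ^ (N + 1) * v ∈
      Ideal.span {u ^ (N + 2), v ^ (N + 2), x * u + y * v}) :
    ∀ i ≤ N, c i ∈ maximalIdeal S := by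
  have perm : ∀ p q r s : S, ({x, y, u, v} : Set S) = {p, q, r, s} → maximalIdeal S = Ideal.span {p, q, r, s} :=
    fun p q r s e => by rw [hgen, e]
  obtain ⟨f1, f2, f3, -⟩ := reg_facts x v y u (perm _ _ _ _ (by ext; simp; tauto)) hdim
  obtain ⟨-, g2, g3, g4⟩ := reg_facts y x v u (perm _ _ _ _ (by ext; simp; tauto)) hdim
  obtain ⟨k1, k2, -, -⟩ := reg_facts u v y x (perm _ _ _ _ (by ext; simp; tauto)) hdim
  obtain ⟨-, l2, l3, -⟩ := reg_facts u y v x (perm _ _ _ _ (by ext; simp; tauto)) hdim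
  obtain ⟨-, -, m3, m4⟩ := reg_facts u y x v (perm _ _ _ _ (by ext; simp; tauto)) hdim
  obtain ⟨α, t, ht, h1⟩ := Ideal.mem_span_insert.mp h
  obtain ⟨β, γ, rfl⟩ := Ideal.mem_span_pair.mp ht
  have h2 := lemB x y u v f1 f2 f3 g2 g3 g4 k1 k2 l2 l3 (N + 1) 0 _ α β γ (by simp) (by
    rw [h1]; ring)
  rw [zero_add] at h2
  have e3 : Ideal.span {u, y} ⊔ Ideal.span {x} = Ideal.span {u, y, x} := by
    rw [← Ideal.span_union]; congr 1; ext; simp; tauto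
  have e4 : Ideal.span {u, y} ⊔ Ideal.span {x, v} = maximalIdeal S := by
    rw [← Ideal.span_union, hgen]; congr 1; ext; simp; tauto
  have h3 := quasi_reg (Ideal.span {u, y}) x v m3 (by rw [e3]; exact m4) N c h2
  rwa [e4] at h3

theorem k1 {S : Type u} [CommRing S] (x w u v : S) (i k : ℕ) : x * (x ^ i * v ^ k * u ^ (i + k + 1) * v) = (u ^ k * v ^ (k + 1)) * ((x * u) ^ (i + 1) - (w * v) ^ (i + 1)) +
      (u ^ k * w ^ (i + 1)) * v ^ (i + k + 2) := by ring
theorem k2 {S : Type u} [CommRing S] (x y u v : S) (i k : ℕ) : y * (x ^ i * v ^ k * u ^ (i + k + 1) * v) = (x ^ i * v ^ k * u ^ (i + k + 1)) * (x * u + y * v) +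
      (- x ^ (i + 1) * v ^ k) * u ^ (i + k + 2) := by ring
theorem k3 {S : Type u} [CommRing S] (x w u v : S) (i k : ℕ) :  u * (x ^ i * v ^ k * u ^ (i + k + 1) * v) = (x ^ i * v ^ k * v) * u ^ (i + k + 2) := by ring
theorem k4 {S : Type u} [CommRing S] (x w u v : S) (i k : ℕ) : v * (x ^ i * v ^ k * u ^ (i + k + 1) * v) = (u ^ (k + 1) * v ^ (k + 2)) * ((x * u) ^ i - (w * v) ^ i) +
      (u ^ (k + 1) * w ^ i) * v ^ (i + k + 2) := by ring
theorem k5 {S : Type u} [CommRing S] (x w u v : S) (E : Ideal S) (ha : x * u - w * v ∈ E) (j : ℕ) : (x * u) ^ j - (w * v) ^ j ∈ E := by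
    obtain ⟨t, ht⟩ := sub_dvd_pow_sub_pow (x * u) (w * v) j
    rw [ht]
    exact E.mul_mem_right _ ha
theorem k6 {S : Type u} [CommRing S] (x y u v m z : S) (E : Ideal S) (m1 : x * m ∈ E) (m2 : y * m ∈ E) (m3 : u * m ∈ E)
  (m4 : v * m ∈ E) (hz : z ∈ Ideal.span {x, y, u, v}) : z * m ∈ E := by
  induction hz using Submodule.span_induction with
  | mem x hx => 
    simp only [Set.mem_insert_iff, Set.mem_singleton_iff] at hx
    rcases hx with rfl | rfl | rfl | rfl <;> assumption
  | zero => simp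
  | add a b _ _ ha hb => rw [add_mul]; exact E.add_mem ha hb
  | smul a b _ hb => rw [smul_eq_mul, mul_assoc]; exact E.mul_mem_left _ hb

theorem kill_alg_aux {S : Type u} [CommRing S] [IsLocalRing S] (x y u v : S)
    (hgen : maximalIdeal S = Ideal.span {x, y, u, v}) (k i : ℕ) (E : Ideal S)
    (hu : u ^ (i + k + 2) ∈ E) (hv : v ^ (i + k + 2) ∈ E) (ha : x * u + y * v ∈ E) (z : S)
    (hz : z ∈ maximalIdeal S) :
    z * (x ^ i * v ^ k * u ^ (i + k + 1) * v) ∈ E := by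
  have ha' : x * u - (-y) * v ∈ E := by rwa [neg_mul, sub_neg_eq_add]
  refine k6 x y u v _ z E ?_ ?_ ?_ ?_ (hgen ▸ hz)
  · rw [k1 x (-y) u v i k]
    exact E.add_mem (E.mul_mem_left _ (k5 x (-y) u v E ha' _)) (E.mul_mem_left _ hv)
  · rw [k2]
    exact E.add_mem (E.mul_mem_left _ ha) (E.mul_mem_left _ hu)
  · rw [k3 x (-y)]
    exact E.mul_mem_left _ hu
  · rw [k4 x (-y) u v i k]
    exact E.add_mem (E.mul_mem_left _ (k5 x (-y) u v E ha' _)) (E.mul_mem_left _ hv)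

theorem kill_alg {S : Type u} [CommRing S] [IsLocalRing S] (x y u v : S)
    (hgen : maximalIdeal S = Ideal.span {x, y, u, v}) (N i : ℕ) (hi : i ≤ N) (z : S) (hz : z ∈ maximalIdeal S) :
    z * (x ^ i * v ^ (N - i) * u ^ (N + 1) * v) ∈
      Ideal.span {u ^ (N + 2), v ^ (N + 2), x * u + y * v} := by
  have h := kill_alg_aux x y u v hgen (N - i) i (Ideal.span {u ^ (N + 2), v ^ (N + 2), x * u + y * v})
  rw [Nat.add_sub_cancel' hi] at h
  exact h (Ideal.subset_span (by simp)) (Ideal.subset_span (by simp)) (Ideal.subset_span (by simp)) z hz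
end P0

section P1
open CategoryTheory Limits

section gen
variable {C : Type*} [Category* C] {D : Type*} [Category* D] [Abelian C] [HasProjectiveResolutions C] [Abelian D]

noncomputable def tauIso (K : ChainComplex D ℕ) (hd : K.d 3 2 = 0) : K.cycles 2 ≅ K.homology 2 :=
  have : IsIso (K.homologyπ 2) := K.isIso_homologyπ 3 2 (by simp) hd
  asIso (K.homologyπ 2)

lemma tauIso_hom (K : ChainComplex D ℕ) (hd : K.d 3 2 = 0) : (tauIso K hd).hom = K.homologyπ 2 := rfl

noncomputable def tau (K : ChainComplex D ℕ) (hd : K.d 3 2 = 0) : K.homology 2 ⟶ K.X 2 :=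
  (tauIso K hd).inv ≫ K.iCycles 2

lemma tau_nat (K L : ChainComplex D ℕ) (hK : K.d 3 2 = 0) (hL : L.d 3 2 = 0) (φ : K ⟶ L) :
    HomologicalComplex.homologyMap φ 2 ≫ tau L hL = tau K hK ≫ φ.f 2 := by
  rw [← cancel_epi (tauIso K hK).hom]
  simp only [tau, Category.assoc, Iso.hom_inv_id_assoc]
  rw [tauIso_hom, HomologicalComplex.homologyπ_naturality_assoc, ← tauIso_hom L hL,
    Iso.hom_inv_id_assoc, HomologicalComplex.cyclesMap_i]

lemma tau_d (K : ChainComplex D ℕ) (hK : K.d 3 2 = 0) : tau K hK ≫ K.d 2 1 = 0 := by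
  simp [tau]

lemma tau_exact (K : ChainComplex D ℕ) (hK : K.d 3 2 = 0) : (ShortComplex.mk _ _ (tau_d K hK)).Exact := by
  have h : (ShortComplex.mk _ _ (K.iCycles_d 2 1)).Exact :=
    ShortComplex.exact_of_f_is_kernel _ (K.cyclesIsKernel 2 1 (by simp))
  refine (ShortComplex.exact_iff_of_iso ?_).2 h
  refine ShortComplex.isoMk (tauIso K hK).symm (Iso.refl _) (Iso.refl _) ?_ ?_
  · simp [tau]
  · simp 

lemma map_d32 {X : C} (P : ProjectiveResolution X) (F : C ⥤ D) [F.Additive] (hd : P.complex.d 3 2 = 0) :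
   ((F.mapHomologicalComplex (ComplexShape.down ℕ)).obj P.complex).d 3 2 = 0 := by
  change F.map (P.complex.d 3 2) = 0
  rw [hd, F.map_zero]

noncomputable def psiD {X : C} (P : ProjectiveResolution X) (F : C ⥤ D) [F.Additive] (hd : P.complex.d 3 2 = 0) :
    (F.leftDerived 2).obj X ⟶ F.obj (P.complex.X 2) :=
  (P.isoLeftDerivedObj F 2).hom ≫ tau ((F.mapHomologicalComplex (ComplexShape.down ℕ)).obj P.complex) (map_d32 P F hd)

lemma psiD_nat {X Y : C} (f : X ⟶ Y) (P : ProjectiveResolution X) (Q : ProjectiveResolution Y)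
    (φ : P.complex ⟶ Q.complex) (comm : φ.f 0 ≫ Q.π.f 0 = P.π.f 0 ≫ f)
    (F : C ⥤ D) [F.Additive] (hP : P.complex.d 3 2 = 0) (hQ : Q.complex.d 3 2 = 0) :
    (F.leftDerived 2).map f ≫ psiD Q F hQ = psiD P F hP ≫ F.map (φ.f 2) := by
  have h := ProjectiveResolution.isoLeftDerivedObj_hom_naturality f P Q φ comm F 2
  have h2 := tau_nat _ _ (map_d32 P F hP) (map_d32 Q F hQ) ((F.mapHomologicalComplex (ComplexShape.down ℕ)).map φ)
  have h3 : ((F.leftDerived 2).map f ≫ (Q.isoLeftDerivedObj F 2).hom) ≫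
      tau ((F.mapHomologicalComplex (ComplexShape.down ℕ)).obj Q.complex) (map_d32 Q F hQ) =
      (P.isoLeftDerivedObj F 2).hom ≫ (tau ((F.mapHomologicalComplex (ComplexShape.down ℕ)).obj P.complex) (map_d32 P F hP) ≫
        ((F.mapHomologicalComplex (ComplexShape.down ℕ)).map φ).f 2) := by
    exact ((congrArg (fun t => t ≫ tau ((F.mapHomologicalComplex (ComplexShape.down ℕ)).obj Q.complex)
      (map_d32 Q F hQ)) h).trans (Category.assoc _ _ _)).trans
      (congrArg (fun t => (P.isoLeftDerivedObj F 2).hom ≫ t) h2)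
  exact ((Category.assoc _ _ _).symm.trans h3).trans (Category.assoc _ _ _).symm

lemma psiD_d {X : C} (P : ProjectiveResolution X) (F : C ⥤ D) [F.Additive] (hd : P.complex.d 3 2 = 0) :
    psiD P F hd ≫ F.map (P.complex.d 2 1) = 0 := by
  have := tau_d ((F.mapHomologicalComplex (ComplexShape.down ℕ)).obj P.complex) (map_d32 P F hd)
  refine (Category.assoc _ _ _).trans ?_
  refine (congrArg (fun t => (P.isoLeftDerivedObj F 2).hom ≫ t) this).trans comp_zero

lemma psiD_exact {X : C} (P : ProjectiveResolution X) (F : C ⥤ D) [F.Additive] (hd : P.complex.d 3 2 = 0) :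
    (ShortComplex.mk _ _ (psiD_d P F hd)).Exact := by
  refine (ShortComplex.exact_iff_of_iso ?_).2 (tau_exact ((F.mapHomologicalComplex (ComplexShape.down ℕ)).obj P.complex) (map_d32 P F hd))
  refine ShortComplex.isoMk (P.isoLeftDerivedObj F 2) (Iso.refl _) (Iso.refl _) ?_ ?_
  · exact (Category.comp_id _).symm
  · exact (Category.id_comp _).trans (Category.comp_id _).symm
end gen

section ext
variable {S : Type u} [CommRing S]

/-- The functor `Hom(-, Y)`. -/
noncomputable abbrev homF (Y : ModuleCat.{u} S) : ModuleCat.{u} S ⥤ (ModuleCat.{u} S)ᵒᵖ :=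
  ((linearYoneda S (ModuleCat.{u} S)).obj Y).rightOp

noncomputable def phi {X : ModuleCat.{u} S} (P : ProjectiveResolution X) (hd : P.complex.d 3 2 = 0) (Y : ModuleCat.{u} S) :
    ModuleCat.of S (P.complex.X 2 ⟶ Y) ⟶ ((Ext S (ModuleCat.{u} S) 2).obj (Opposite.op X)).obj Y :=
  (psiD P (homF Y) hd).unop

lemma phi_nat {X X' : ModuleCat.{u} S} (f : X ⟶ X') (P : ProjectiveResolution X) (Q : ProjectiveResolution X')
    (φ : P.complex ⟶ Q.complex) (comm : φ.f 0 ≫ Q.π.f 0 = P.π.f 0 ≫ f)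
    (hP : P.complex.d 3 2 = 0) (hQ : Q.complex.d 3 2 = 0) (Y : ModuleCat.{u} S) (m : Q.complex.X 2 ⟶ Y) :
    (((Ext S (ModuleCat.{u} S) 2).map f.op).app Y).hom ((phi Q hQ Y).hom m) = (phi P hP Y).hom (φ.f 2 ≫ m) := by
  have h := congrArg Quiver.Hom.unop (psiD_nat f P Q φ comm (homF Y) hP hQ)
  exact congrArg (fun t => t.hom m) h

lemma phi_zero {X : ModuleCat.{u} S} (P : ProjectiveResolution X) (hd : P.complex.d 3 2 = 0) (Y : ModuleCat.{u} S)
    (m : P.complex.X 2 ⟶ Y) (hm : (phi P hd Y).hom m = 0) : ∃ t : P.complex.X 1 ⟶ Y, P.complex.d 2 1 ≫ t = m := by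
  have h := (ShortComplex.moduleCat_exact_iff _).1 (psiD_exact P (homF Y) hd).unop m hm
  exact h

lemma phi_zero' {X : ModuleCat.{u} S} (P : ProjectiveResolution X) (hd : P.complex.d 3 2 = 0) (Y : ModuleCat.{u} S)
    (t : P.complex.X 1 ⟶ Y) : (phi P hd Y).hom (P.complex.d 2 1 ≫ t) = 0 := by
  have h := congrArg Quiver.Hom.unop (psiD_d P (homF Y) hd)
  exact congrArg (fun s => s.hom t) h
end ext
end P1

section P2
open CategoryTheory Limits
section
variable {C : Type*} [Category* C] [Abelian C]

lemma pres_quasi (K : ChainComplex C ℕ) (Z : C) (f : K.X 0 ⟶ Z) (hf : K.d 1 0 ≫ f = 0)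
   (h0 : (ShortComplex.mk _ _ hf).Exact) (he : Epi f) (h : ∀ n, (ShortComplex.mk (K.d (n+2) (n+1)) (K.d (n+1) n) (K.d_comp_d _ _ _)).Exact) :
   QuasiIso ((ChainComplex.toSingle₀Equiv K Z).symm ⟨f, hf⟩) := ⟨fun n => by
    cases n
    · rw [ChainComplex.quasiIsoAt₀_iff, ShortComplex.quasiIso_iff_of_zeros']
      · have e : ((ChainComplex.toSingle₀Equiv K Z).symm ⟨f, hf⟩).f 0 = f := by simp
        have : ∀ g : K.X 0 ⟶ Z, ∀ (h : g = f) (hg :  K.d 1 0 ≫ g = 0), (ShortComplex.mk _ _ hg).Exact ∧ Epi g := by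
          rintro _ rfl _; exact ⟨h0, he⟩
        exact this _ e _
      · exact K.shape _ _ (by simp)
      all_goals rfl
    · rw [quasiIsoAt_iff_exactAt']
      · rw [HomologicalComplex.exactAt_iff' _ (_ + 1 + 1) (_ + 1) _ (by simp; rfl) (by simp; rfl)]
        exact h _
      · apply ChainComplex.exactAt_succ_single_obj⟩

noncomputable def pres (K : ChainComplex C ℕ) (hK : ∀ n, Projective (K.X n)) (Z : C) (f : K.X 0 ⟶ Z) (hf : K.d 1 0 ≫ f = 0)
   (h0 : (ShortComplex.mk _ _ hf).Exact) (he : Epi f) (h : ∀ n, (ShortComplex.mk (K.d (n+2) (n+1)) (K.d (n+1) n) (K.d_comp_d _ _ _)).Exact) : ProjectiveResolution Z where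
  complex := K
  projective := hK
  π := (ChainComplex.toSingle₀Equiv K Z).symm ⟨f, hf⟩
  quasiIso := pres_quasi K Z f hf h0 he h

lemma pres_π (K : ChainComplex C ℕ) (hK : ∀ n, Projective (K.X n)) (Z : C) (f : K.X 0 ⟶ Z) (hf : K.d 1 0 ≫ f = 0)
   (h0 : (ShortComplex.mk _ _ hf).Exact) (he : Epi f) (h : ∀ n, (ShortComplex.mk (K.d (n+2) (n+1)) (K.d (n+1) n) (K.d_comp_d _ _ _)).Exact) :
   (pres K hK Z f hf h0 he h).π.f 0 = f := ChainComplex.toSingle₀Equiv_symm_apply_f_zero f hf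
end
end P2

section P3
open CategoryTheory Limits
section
variable {S : Type u} [CommRing S]

def kX (S : Type u) [CommRing S] : ℕ → ModuleCat.{u} S
  | 0 => ModuleCat.of S S
  | 1 => ModuleCat.of S (S × S)
  | 2 => ModuleCat.of S S
  | _ + 3 => ModuleCat.of S PUnit

def kd1 (p q : S) : (S × S) →ₗ[S] S := LinearMap.coprod (LinearMap.lsmul S S p) (LinearMap.lsmul S S q)
def kd2 (p q : S) : S →ₗ[S] S × S := LinearMap.prod (LinearMap.lsmul S S (-q)) (LinearMap.lsmul S S p)

def kd (p q : S) : ∀ n, kX S (n + 1) ⟶ kX S n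
  | 0 => ModuleCat.ofHom (kd1 p q)
  | 1 => ModuleCat.ofHom (kd2 p q)
  | 2 => ModuleCat.ofHom (0 : PUnit.{u+1} →ₗ[S] S)
  | _ + 3 => ModuleCat.ofHom (0 : PUnit.{u+1} →ₗ[S] PUnit.{u+1})

lemma kd_comp (p q : S) : ∀ n, kd p q (n + 1) ≫ kd p q n = 0
  | 0 => by
    have : (kd1 p q).comp (kd2 p q) = 0 := by
      ext; simp [kd1, kd2, mul_comm]
    exact congrArg ModuleCat.ofHom this
  | 1 => by
    exact congrArg ModuleCat.ofHom (LinearMap.comp_zero (kd2 p q))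
  | 2 => congrArg ModuleCat.ofHom (LinearMap.comp_zero (0 : PUnit.{u+1} →ₗ[S] S))
  | _ + 3 => congrArg ModuleCat.ofHom (LinearMap.comp_zero (0 : PUnit.{u+1} →ₗ[S] PUnit.{u+1}))

lemma kX_proj : ∀ n, Projective (kX S n)
  | 0 => (inferInstance : Projective (ModuleCat.of S S))
  | 1 => (inferInstance : Projective (ModuleCat.of S (S × S)))
  | 2 => (inferInstance : Projective (ModuleCat.of S S))
  | _ + 3 => (inferInstance : Projective (ModuleCat.of S PUnit))

noncomputable def kC (p q : S) : ChainComplex (ModuleCat.{u} S) ℕ := ChainComplex.of (kX S) (kd p q) (kd_comp p q)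

lemma kC_d (p q : S) (n : ℕ) : (kC p q).d (n + 1) n = kd p q n := ChainComplex.of_d _ _ _

def kmap (s t : S) : ∀ n, kX S n ⟶ kX S n
  | 0 => ModuleCat.ofHom LinearMap.id
  | 1 => ModuleCat.ofHom (LinearMap.prodMap (LinearMap.lsmul S S s) (LinearMap.lsmul S S t))
  | 2 => ModuleCat.ofHom (LinearMap.lsmul S S (s * t))
  | _ + 3 => ModuleCat.ofHom (0 : PUnit.{u+1} →ₗ[S] PUnit.{u+1})

lemma kmap_comm (p q s t : S) : ∀ n, kmap s t (n + 1) ≫ kd p q n = kd (p * s) (q * t) n ≫ kmap s t n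
  | 0 => by
    have : (kd1 p q).comp (LinearMap.prodMap (LinearMap.lsmul S S s) (LinearMap.lsmul S S t)) = LinearMap.id.comp (kd1 (p * s) (q * t)) := by
      ext <;> simp [kd1]
    exact congrArg ModuleCat.ofHom this
  | 1 => by
    have : (kd2 p q).comp (LinearMap.lsmul S S (s * t)) = (LinearMap.prodMap (LinearMap.lsmul S S s) (LinearMap.lsmul S S t)).comp (kd2 (p * s) (q * t)) := by
      ext <;> simp [kd2] <;> ring
    exact congrArg ModuleCat.ofHom this
  | 2 => congrArg ModuleCat.ofHom ((LinearMap.comp_zero (0 : PUnit.{u+1} →ₗ[S] S)).trans (LinearMap.comp_zero (LinearMap.lsmul S S (s * t))).symm)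
  | _ + 3 => congrArg ModuleCat.ofHom (LinearMap.comp_zero (0 : PUnit.{u+1} →ₗ[S] PUnit.{u+1}))

noncomputable def kCmap (p q s t : S) : kC (p * s) (q * t) ⟶ kC p q where
  f := kmap s t
  comm' := by
    rintro _ n rfl
    rw [kC_d, kC_d]
    exact kmap_comm p q s t n

lemma k_exact (p q : S) (hp : ∀ b, p * b = 0 → b = 0) (hq : ∀ b, q * b ∈ Ideal.span {p} → b ∈ Ideal.span {p}) :
    ∀ n, (ShortComplex.mk (kd p q (n+1)) (kd p q n) (kd_comp p q n)).Exact
  | 0 => by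
    rw [ShortComplex.moduleCat_exact_iff]
    rintro ⟨a, b⟩ h
    have h : p * a + q * b = 0 := h
    have hb : b ∈ Ideal.span {p} := hq b (by
      rw [Ideal.mem_span_singleton]; exact ⟨-a, by linear_combination h⟩)
    obtain ⟨c, rfl⟩ := Ideal.mem_span_singleton.1 hb
    have h2 := hp (a + q * c) (by linear_combination h)
    refine ⟨c, ?_⟩
    exact Prod.ext (show -q * c = a by linear_combination - h2) rfl
  | 1 => by
    rw [ShortComplex.moduleCat_exact_iff]
    intro (a : S) h
    have h : ((-q * a, p * a) : S × S) = 0 := h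
    exact ⟨PUnit.unit, (hp a (congrArg Prod.snd h)).symm⟩
  | 2 => by
    rw [ShortComplex.moduleCat_exact_iff]
    rintro ⟨⟩ h
    exact ⟨PUnit.unit, rfl⟩
  | _ + 3 => by
    rw [ShortComplex.moduleCat_exact_iff]
    rintro ⟨⟩ h
    exact ⟨PUnit.unit, rfl⟩

def kaug (p q : S) : kX S 0 ⟶ ModuleCat.of S (S ⧸ Ideal.span {p, q}) := ModuleCat.ofHom (Submodule.mkQ _)

lemma kaug_d (p q : S) : kd p q 0 ≫ kaug p q = 0 := by
  have : (Submodule.mkQ (Ideal.span {p, q})).comp (kd1 p q) = 0 := by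
    ext
    · simp only [kd1, LinearMap.comp_apply, LinearMap.inl_apply]
      exact (Submodule.Quotient.mk_eq_zero _).2 (by
        simpa using Ideal.subset_span (by simp))
    · exact (Submodule.Quotient.mk_eq_zero _).2 (by
        simpa [kd1] using Ideal.subset_span (by simp))
  exact congrArg ModuleCat.ofHom this

lemma kaug_exact (p q : S) : (ShortComplex.mk _ _ (kaug_d p q)).Exact := by
  rw [ShortComplex.moduleCat_exact_iff]
  intro (a : S) h
  have h : a ∈ Ideal.span {p, q} := (Submodule.Quotient.mk_eq_zero _).1 h
  obtain ⟨b, c, h⟩ := Ideal.mem_span_pair.1 h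
  exact ⟨(b, c), (show p * b + q * c = a by rw [← h]; ring)⟩

lemma kaug_epi (p q : S) : Epi (kaug p q) := by
  rw [ModuleCat.epi_iff_surjective]
  exact Submodule.mkQ_surjective _

noncomputable def kP (p q : S) (hp : ∀ b, p * b = 0 → b = 0) (hq : ∀ b, q * b ∈ Ideal.span {p} → b ∈ Ideal.span {p}) :
    ProjectiveResolution (ModuleCat.of S (S ⧸ Ideal.span {p, q})) :=
  pres (kC p q) kX_proj _ (kaug p q) (by rw [kC_d]; exact kaug_d p q) (by
    have := kaug_exact p q
    simp only [kC_d]; exact this) (kaug_epi p q) (fun n => by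
      have := k_exact p q hp hq n
      simp only [kC_d]; exact this)
end
end P3

section P4
open CategoryTheory Limits
section
variable {S : Type u} [CommRing S]

structure KReg (p q : S) : Prop where
  hp : ∀ b, p * b = 0 → b = 0
  hq : ∀ b, q * b ∈ Ideal.span {p} → b ∈ Ideal.span {p}

noncomputable def kPr (p q : S) (h : KReg p q) : ProjectiveResolution (ModuleCat.of S (S ⧸ Ideal.span {p, q})) :=
  kP p q h.hp h.hq

lemma kPr_d3 (p q : S) (h : KReg p q) : (kPr p q h).complex.d 3 2 = 0 := kC_d p q 2

lemma kPr_π (p q : S) (h : KReg p q) : (kPr p q h).π.f 0 = kaug p q := by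
  have h0 : (kC p q).d 1 0 ≫ kaug p q = 0 := by rw [kC_d]; exact kaug_d p q
  have h1 := ChainComplex.toSingle₀Equiv_symm_apply_f_zero (C := kC p q) (kaug p q) h0
  exact h1

noncomputable def kg (a b : S) : ModuleCat.of S S ⟶ ModuleCat.of S (S ⧸ Ideal.span {a}) :=
  ModuleCat.ofHom (LinearMap.toSpanSingleton S _ (Ideal.Quotient.mk _ b))

noncomputable abbrev E2 (X : ModuleCat.{u} S) (a : S) : ModuleCat.{u} S :=
  ((Ext S (ModuleCat.{u} S) 2).obj (Opposite.op X)).obj (ModuleCat.of S (S ⧸ Ideal.span {a}))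

noncomputable def Phi (p q : S) (h : KReg p q) (a : S) : S →ₗ[S] E2 (ModuleCat.of S (S ⧸ Ideal.span {p, q})) a where
  toFun b := (phi (kPr p q h) (kPr_d3 p q h) (ModuleCat.of S (S ⧸ Ideal.span {a}))).hom (kg a b)
  map_add' b c := by
    have : kg a (b + c) = kg a b + kg a c := by
      apply ModuleCat.hom_ext
      apply LinearMap.ext_ring
      simp [kg]
    exact (congrArg _ this).trans (map_add _ _ _)
  map_smul' r b := by
    have : kg a (r • b) = r • kg a b := by
      apply ModuleCat.hom_ext
      apply LinearMap.ext_ring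
      simp [kg, Algebra.smul_def]
    exact (congrArg _ this).trans (map_smul _ _ _)

lemma Phi_zero (p q : S) (h : KReg p q) (a b : S) (hb : Phi p q h a b = 0) : b ∈ Ideal.span {p, q, a} := by
  obtain ⟨t, ht⟩ := phi_zero _ (kPr_d3 p q h) _ _ hb
  have ht : (kC p q).d 2 1 ≫ t = kg a b := ht
  rw [kC_d] at ht
  let t' : S × S →ₗ[S] S ⧸ Ideal.span {a} := ModuleCat.Hom.hom t
  have h1 : t' (-q, p) = Ideal.Quotient.mk _ b := by
    have h2 : t' (-q * 1, p * 1) = (1 : S) • (Ideal.Quotient.mk (Ideal.span {a}) b) := congrArg (fun s => (ModuleCat.Hom.hom s) (1 : S)) ht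
    simpa using h2
  obtain ⟨c, hc⟩ := Ideal.Quotient.mk_surjective (t' (1, 0))
  obtain ⟨d, hd⟩ := Ideal.Quotient.mk_surjective (t' (0, 1))
  have h3 : ((-q, p) : S × S) = (-q) • (1, 0) + p • (0, 1) := by simp
  rw [h3, map_add, map_smul, map_smul, ← hc, ← hd] at h1
  have h4 : Ideal.Quotient.mk (Ideal.span {a}) (-q * c + p * d - b) = 0 := by
    rw [map_sub, sub_eq_zero, ← h1, map_add, map_mul, map_mul]
    simp [Algebra.smul_def]
  rw [Ideal.Quotient.eq_zero_iff_mem] at h4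
  obtain ⟨e, he⟩ := Ideal.mem_span_singleton.1 h4
  have : b = d * p + (-c * q + (- e) * a) := by linear_combination -he
  rw [this]
  refine Ideal.add_mem _ ?_ (Ideal.add_mem _ ?_ ?_) <;> exact Ideal.mul_mem_left _ _ (Ideal.subset_span (by simp))

lemma Phi_zero' (p q : S) (h : KReg p q) (a b : S) (hb : b ∈ Ideal.span {p, q, a}) : Phi p q h a b = 0 := by
  obtain ⟨d, z, hz, rfl⟩ := Ideal.mem_span_insert.1 hb
  obtain ⟨c, e, rfl⟩ := Ideal.mem_span_pair.1 hz
  let t' : S × S →ₗ[S] S ⧸ Ideal.span {a} := LinearMap.coprod (LinearMap.toSpanSingleton S _ (Ideal.Quotient.mk _ (-c)))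
     (LinearMap.toSpanSingleton S _ (Ideal.Quotient.mk _ d))
  let t : kX S 1 ⟶ ModuleCat.of S (S ⧸ Ideal.span {a}) := ModuleCat.ofHom t'
  have h1 : kd p q 1 ≫ t = kg a (d * p + (c * q + e * a)) := by
    have : t'.comp (kd2 p q) = LinearMap.toSpanSingleton S _ (Ideal.Quotient.mk _ (d * p + (c * q + e * a))) := by
      apply LinearMap.ext_ring
      have ha : Ideal.Quotient.mk (Ideal.span {a}) a = 0 := Ideal.Quotient.eq_zero_iff_mem.2 (Ideal.mem_span_singleton_self a)
      simp [t', kd2, Algebra.smul_def, ha]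
      ring
    exact congrArg ModuleCat.ofHom this
  have h2 := phi_zero' _ (kPr_d3 p q h) _ t
  have h3 : (kPr p q h).complex.d 2 1 ≫ t = kg a (d * p + (c * q + e * a)) := by
    refine Eq.trans ?_ h1
    exact congrArg (fun s => s ≫ t) (kC_d p q 1)
  exact (congrArg _ h3.symm).trans h2

lemma Phi_nat (p q s t : S) (h : KReg p q) (h' : KReg (p * s) (q * t)) (a b : S)
   (hle : Ideal.span {p * s, q * t} ≤ Ideal.span {p, q}) :
   (((Ext S (ModuleCat.{u} S) 2).map (Quiver.Hom.op (ModuleCat.ofHom (Submodule.mapQ (Ideal.span {p * s, q * t}) (Ideal.span {p, q}) LinearMap.id hle)))).app (ModuleCat.of S (S ⧸ Ideal.span {a}))).hom (Phi p q h a b)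
     = Phi (p * s) (q * t) h' a (s * t * b) := by
  have h1 := phi_nat (ModuleCat.ofHom (Submodule.mapQ (Ideal.span {p * s, q * t}) (Ideal.span {p, q}) LinearMap.id hle))
    (kPr _ _ h') (kPr _ _ h) (kCmap p q s t) (by
      refine (congrArg (fun z => (kCmap p q s t).f 0 ≫ z) (kPr_π p q h)).trans (Eq.trans ?_ (congrArg (fun z => z ≫ ModuleCat.ofHom (Submodule.mapQ (Ideal.span {p * s, q * t}) (Ideal.span {p, q}) LinearMap.id hle)) (kPr_π _ _ h')).symm)
      rfl) (kPr_d3 _ _ h') (kPr_d3 _ _ h) (ModuleCat.of S (S ⧸ Ideal.span {a})) (kg a b)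
  refine h1.trans ?_
  have h2 : (LinearMap.toSpanSingleton S _ (Ideal.Quotient.mk (Ideal.span {a}) b)).comp (LinearMap.lsmul S S (s * t)) =
     LinearMap.toSpanSingleton S _ (Ideal.Quotient.mk _ (s * t * b)) := by
    apply LinearMap.ext_ring
    simp [Algebra.smul_def]
  exact congrArg (phi (kPr _ _ h') (kPr_d3 _ _ h') (ModuleCat.of S (S ⧸ Ideal.span {a}))).hom (congrArg ModuleCat.ofHom h2)
end
end P4

section P5
open CategoryTheory Limits Opposite
section
variable {S : Type u} [CommRing S]

lemma uv_le (u v : S) {n m : ℕ} (h : n ≤ m) : Ideal.span {u ^ m, v ^ m} ≤ Ideal.span {u ^ n, v ^ n} := by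
  rw [Ideal.span_le]
  rintro z (rfl | rfl)
  · exact Ideal.mem_of_dvd _ (pow_dvd_pow u h) (Ideal.subset_span (by simp))
  · exact Ideal.mem_of_dvd _ (pow_dvd_pow v h) (Ideal.subset_span (by simp))

def uvD (u v : S) : ℕᵒᵖ ⥤ Ideal S where
  obj t := Ideal.span {u ^ unop t, v ^ unop t}
  map w := ⟨⟨uv_le u v w.unop.down.down⟩⟩

def uvL (u v : S) : ℕᵒᵖ ⥤ localCohomology.SelfLERadical (Ideal.span {u, v}) :=
  ObjectProperty.lift _ (uvD u v) fun k => by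
    change _ ≤ (Ideal.span {u ^ unop k, v ^ unop k}).radical
    rw [Ideal.span_le]
    rintro z (rfl | rfl)
    · exact ⟨unop k, Ideal.subset_span (by simp)⟩
    · exact ⟨unop k, Ideal.subset_span (by simp)⟩

instance uvL_initial [IsNoetherianRing S] (u v : S) : Functor.Initial (uvL u v) where
  out J' := by
    apply +allowSynthFailures zigzag_isConnected
    · obtain ⟨k, hk⟩ := Ideal.exists_pow_le_of_le_radical_of_fg J'.2 (IsNoetherian.noetherian _)
      have hk' : Ideal.span {u ^ k, v ^ k} ≤ J'.1 := by
        refine le_trans ?_ hk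
        rw [Ideal.span_le]
        rintro z (rfl | rfl)
        · exact Ideal.pow_mem_pow (Ideal.subset_span (by simp)) _
        · exact Ideal.pow_mem_pow (Ideal.subset_span (by simp)) _
      exact ⟨CostructuredArrow.mk (⟨⟨⟨hk'⟩⟩⟩ : (uvL u v).obj (op k) ⟶ J')⟩
    · intro j1 j2
      apply Relation.ReflTransGen.single
      rcases le_total (unop j1.left) (unop j2.left) with h | h
      · right; exact ⟨CostructuredArrow.homMk (homOfLE h).op rfl⟩
      · left; exact ⟨CostructuredArrow.homMk (homOfLE h).op rfl⟩

noncomputable def lcIso [IsNoetherianRing S] (u v : S) : localCohomology.ofDiagram.{u, 0} (uvD u v) 2 ≅ localCohomology (Ideal.span {u, v}) 2 :=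
  (localCohomology.isoOfFinal.{u, u, 0} (uvL u v) (localCohomology.selfLERadicalDiagram (Ideal.span {u, v})) 2) ≪≫
   localCohomology.isoSelfLERadical (Ideal.span {u, v}) 2

noncomputable abbrev uvF (u v : S) (Y : ModuleCat.{u} S) : ℕᵒᵖᵒᵖ ⥤ ModuleCat.{u} S :=
  localCohomology.diagram (uvD u v) 2 ⋙ (evaluation _ _).obj Y

noncomputable def uvC (u v : S) (Y : ModuleCat.{u} S) : Cocone (uvF u v Y) :=
  ((evaluation _ _).obj Y).mapCocone (colimit.cocone (localCohomology.diagram (uvD u v) 2))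

noncomputable def uvCis (u v : S) (Y : ModuleCat.{u} S) : IsColimit (uvC u v Y) :=
  isColimitOfPreserves _ (colimit.isColimit _)

lemma uvC_pt (u v : S) (Y : ModuleCat.{u} S) : (uvC u v Y).pt = (localCohomology.ofDiagram.{u, 0} (uvD u v) 2).obj Y := rfl

lemma uv_zero (u v : S) (Y : ModuleCat.{u} S) (n : ℕ) (x : (uvF u v Y).obj (op (op n)))
   (hx : ((uvC u v Y).ι.app (op (op n))).hom x = 0) : ∃ (d : ℕ), ((uvF u v Y).map (homOfLE (Nat.le_add_right n d)).op.op).hom x = 0 := by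
  have i0 : PreservesFilteredColimitsOfSize.{u, u} (forget (ModuleCat.{u} S)) := inferInstance
  have i1 : PreservesFilteredColimitsOfSize.{0, 0} (forget (ModuleCat.{u} S)) :=
    preservesFilteredColimitsOfSize_shrink _
  have i2 : PreservesColimitsOfShape ℕᵒᵖᵒᵖ (forget (ModuleCat.{u} S)) := i1.preserves_filtered_colimits _
  have h := (Concrete.isColimit_rep_eq_iff_exists (uvF u v Y) (uvCis u v Y) x (0 : (uvF u v Y).obj (op (op n)))).1 (by
    exact hx.trans (map_zero _).symm)
  obtain ⟨k, f, g, hfg⟩ := h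
  have hk : n ≤ unop (unop k) := f.unop.unop.down.down
  obtain ⟨d, hd⟩ := Nat.exists_eq_add_of_le hk
  obtain ⟨k⟩ := k
  obtain ⟨k⟩ := k
  dsimp at hd
  subst hd
  refine ⟨d, ?_⟩
  have : f = (homOfLE (Nat.le_add_right n d)).op.op := Subsingleton.elim _ _
  rw [← this]
  exact hfg.trans (map_zero _)
end
end P5

section P6
open CategoryTheory Limits Opposite IsLocalRing
section
variable {S : Type u} [CommRing S]

lemma uv_map (u v a : S) (n d : ℕ) (b : S) (h : KReg (u ^ n) (v ^ n)) (h' : KReg (u ^ (n + d)) (v ^ (n + d))) :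
    ((uvF u v (ModuleCat.of S (S ⧸ Ideal.span {a}))).map (homOfLE (Nat.le_add_right n d)).op.op).hom
      (Phi (u ^ n) (v ^ n) h a b) = Phi (u ^ (n + d)) (v ^ (n + d)) h' a (u ^ d * v ^ d * b) := by
  have key : ∀ (p q p' q' s t : S) (_ : p' = p * s) (_ : q' = q * t) (h : KReg p q) (h' : KReg p' q')
     (hle : Ideal.span {p', q'} ≤ Ideal.span {p, q}),
     (((Ext S (ModuleCat.{u} S) 2).map (Quiver.Hom.op (ModuleCat.ofHom (Submodule.mapQ (Ideal.span {p', q'}) (Ideal.span {p, q}) LinearMap.id hle)))).app (ModuleCat.of S (S ⧸ Ideal.span {a}))).hom (Phi p q h a b)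
     = Phi p' q' h' a (s * t * b) := by
    rintro p q _ _ s t rfl rfl h h' hle
    exact Phi_nat p q s t h h' a b hle
  exact key _ _ _ _ _ _ (pow_add u n d) (pow_add v n d) h h' (uv_le u v (Nat.le_add_right n d))

theorem exists_Psi [IsNoetherianRing S] (u v a : S) (h : ∀ n, KReg (u ^ n) (v ^ n)) :
    ∃ Ψ : ℕ → (S →ₗ[S] (localCohomology (Ideal.span {u, v}) 2).obj (ModuleCat.of S (S ⧸ Ideal.span {a}))),
      (∀ n d b, Ψ n b = Ψ (n + d) (u ^ d * v ^ d * b)) ∧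
      (∀ n b, b ∈ Ideal.span {u ^ n, v ^ n, a} → Ψ n b = 0) ∧
      (∀ n b, Ψ n b = 0 → ∃ d, u ^ d * v ^ d * b ∈ Ideal.span {u ^ (n + d), v ^ (n + d), a}) := by
  let Y := ModuleCat.of S (S ⧸ Ideal.span {a})
  let e : (uvC u v Y).pt ≅ (localCohomology (Ideal.span {u, v}) 2).obj Y := (lcIso u v).app Y
  have he : ∀ z, e.hom.hom z = 0 → z = 0 := by
    intro z hz
    have : e.inv.hom (e.hom.hom z) = z := by
      exact congrArg (fun t => t.hom z) e.hom_inv_id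
    rw [← this, hz, map_zero]
  let Ψ0 : ∀ n : ℕ, S →ₗ[S] (uvC u v Y).pt := fun n =>
    ((uvC u v Y).ι.app (op (op n))).hom.comp (Phi (u ^ n) (v ^ n) (h n) a)
  refine ⟨fun n => e.hom.hom.comp (Ψ0 n), ?_, ?_, ?_⟩
  · intro n d b
    have : Ψ0 n b = Ψ0 (n + d) (u ^ d * v ^ d * b) := by
      have h1 := (uvC u v Y).w (homOfLE (Nat.le_add_right n d)).op.op
      have h2 := congrArg (fun t => t.hom (Phi (u ^ n) (v ^ n) (h n) a b)) h1
      refine h2.symm.trans ?_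
      exact congrArg ((uvC u v Y).ι.app (op (op (n + d)))).hom (uv_map u v a n d b (h n) (h (n + d)))
    exact congrArg e.hom.hom this
  · intro n b hb
    have : Ψ0 n b = 0 :=
      (congrArg ((uvC u v Y).ι.app (op (op n))).hom (Phi_zero' _ _ (h n) a b hb)).trans (map_zero _)
    exact (congrArg e.hom.hom this).trans (map_zero _)
  · intro n b hb
    obtain ⟨d, hd⟩ := uv_zero u v Y n _ (he _ hb)
    exact ⟨d, Phi_zero _ _ (h (n + d)) _ _ ((uv_map u v a n d b (h n) (h (n + d))).symm.trans hd)⟩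

theorem kreg_pow (u v : S) (hu : ∀ b, u * b = 0 → b = 0) (hv : ∀ b, v * b ∈ Ideal.span {u} → b ∈ Ideal.span {u}) (n : ℕ) :
    KReg (u ^ n) (v ^ n) := by
  have h1 : ∀ n b, u ^ n * b = 0 → b = 0 := by
    intro n
    induction n with
    | zero => intro b hb; simpa using hb
    | succ n ih => intro b hb; exact ih b (hu _ (by rw [← hb]; ring))
  have h2 : ∀ n b, v * b ∈ Ideal.span {u ^ n} → b ∈ Ideal.span {u ^ n} := by
    intro n
    induction n with
    | zero => intro b _; simp
    | succ n ih =>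
      intro b hb
      obtain ⟨c, hc⟩ := Ideal.mem_span_singleton.1 hb
      obtain ⟨e, rfl⟩ := Ideal.mem_span_singleton.1 (hv b (Ideal.mem_span_singleton.2 ⟨u ^ n * c, by rw [hc]; ring⟩))
      have h3 := hu (v * e - u ^ n * c) (by linear_combination hc)
      obtain ⟨f, rfl⟩ := Ideal.mem_span_singleton.1 (ih e (Ideal.mem_span_singleton.2 ⟨c, by linear_combination h3⟩))
      exact Ideal.mem_span_singleton.2 ⟨f, by ring⟩
  exact ⟨h1 n, fun b hb => pow_reg _ v (h2 n) n b hb⟩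
end
end P6


/-- Let `(S, n, k)` be a regular local ring of dimension 4 with regular system
of parameters `x, y, u, v`, and set `a := x*u + y*v`.  Then the socle
`Soc_S H^2_{(u,v)S}(S/aS) = (0 :_{H^2_{(u,v)S}(S/aS)} n)` is an infinite dimensional
`k`-vector space, where `k = S/n` is the residue field.  (The socle is realized as
`Submodule.torsionBySet`, which carries a canonical `S/n`-module structure; being infinite
dimensional is expressed as not being a finite `S/n`-module.) -/
theorem socle_localCohomology_infinite_dimensional {S : Type u} [CommRing S] [IsNoetherianRing S]
    [IsLocalRing S] (x y u v : S)
    (hgen : IsLocalRing.maximalIdeal S = Ideal.span {x, y, u, v})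
    (hdim : ringKrullDim S = 4) :
    ¬ Module.Finite (S ⧸ IsLocalRing.maximalIdeal S)
      (Submodule.torsionBySet S
        ((localCohomology (Ideal.span {u, v}) 2).obj
          (ModuleCat.of S (S ⧸ Ideal.span {x * u + y * v})))
        (IsLocalRing.maximalIdeal S : Set S)) := by
  have hreg := reg_facts u v x y (by rw [hgen]; congr 1; ext; simp; tauto) hdim
  obtain ⟨Ψ, hΨ1, hΨ2, hΨ3⟩ := exists_Psi u v (x * u + y * v) (kreg_pow u v hreg.1 hreg.2.1)
  have hΨ1' : ∀ i n, i ≤ n → Ψ (i + 2) (x ^ i * u ^ (i + 1) * v) =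
      Ψ (n + 2) (x ^ i * v ^ (n - i) * u ^ (n + 1) * v) := by
    intro i n hin
    obtain ⟨d, rfl⟩ := Nat.exists_eq_add_of_le hin
    rw [hΨ1 (i + 2) d, Nat.add_sub_cancel_left, add_right_comm]
    congr 1
    ring
  have hs : ∀ i, Ψ (i + 2) (x ^ i * u ^ (i + 1) * v) ∈ Submodule.torsionBySet S
        ((localCohomology (Ideal.span {u, v}) 2).obj
          (ModuleCat.of S (S ⧸ Ideal.span {x * u + y * v})))
        (IsLocalRing.maximalIdeal S : Set S) := by
    intro i
    rw [Submodule.mem_torsionBySet_iff]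
    rintro ⟨z, hz⟩
    change z • Ψ (i + 2) (x ^ i * u ^ (i + 1) * v) = 0
    rw [hΨ1' i i le_rfl, ← map_smul]
    exact hΨ2 _ _ (kill_alg x y u v hgen i i le_rfl z hz)
  intro hfin
  letI : Field (S ⧸ IsLocalRing.maximalIdeal S) := Ideal.Quotient.field _
  have hli : LinearIndependent (S ⧸ IsLocalRing.maximalIdeal S) (fun i : ℕ => (⟨_, hs i⟩ : Submodule.torsionBySet S
        ((localCohomology (Ideal.span {u, v}) 2).obj
          (ModuleCat.of S (S ⧸ Ideal.span {x * u + y * v})))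
        (IsLocalRing.maximalIdeal S : Set S))) := by
    rw [linearIndependent_iff']
    intro t g hg i hi
    classical
    choose c0 hc0 using fun j => Ideal.Quotient.mk_surjective (g j)
    obtain ⟨M, hM⟩ : ∃ M, t ⊆ Finset.range (M + 1) := by
      obtain ⟨M, hM⟩ := t.exists_nat_subset_range
      exact ⟨M, hM.trans (Finset.range_mono (Nat.le_succ _))⟩
    have h1 : ∑ j ∈ t, c0 j • Ψ (j + 2) (x ^ j * u ^ (j + 1) * v) = 0 := by
      have := congrArg Subtype.val hg
      rw [Submodule.coe_sum] at this
      refine Eq.trans (Finset.sum_congr rfl fun j _ => ?_) this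
      rw [← hc0 j]
      rfl
    let c : ℕ → S := fun j => if j ∈ t then c0 j else 0
    have hN : ∀ N, M ≤ N → ∑ j ∈ t, c0 j • Ψ (j + 2) (x ^ j * u ^ (j + 1) * v) =
        Ψ (N + 2) ((∑ j ∈ Finset.range (N + 1), c j * x ^ j * v ^ (N - j)) * u ^ (N + 1) * v) := by
      intro N hMN
      have hsub : t ⊆ Finset.range (N + 1) := hM.trans (Finset.range_mono (by omega))
      rw [Finset.sum_mul, Finset.sum_mul, map_sum, ← Finset.sum_subset hsub]
      · refine Finset.sum_congr rfl fun j hj => ?_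
        have hjN : j ≤ N := Nat.lt_succ_iff.1 (Finset.mem_range.1 (hsub hj))
        rw [hΨ1' j N hjN, ← map_smul]
        simp only [c, if_pos hj, smul_eq_mul]
        congr 1
        ring
      · intro j _ hj
        simp [c, hj]
    have h2 := (hN M le_rfl).symm.trans h1
    obtain ⟨d, hd⟩ := hΨ3 _ _ h2
    have h3 := final_alg x y u v hgen hdim (M + d) c (by
      rw [add_right_comm M 2 d] at hd
      convert hd using 1
      rw [Finset.sum_mul, Finset.sum_mul, Finset.sum_mul, Finset.sum_mul, Finset.mul_sum]
      symm
      have hsub : Finset.range (M + 1) ⊆ Finset.range (M + d + 1) := Finset.range_mono (by omega)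
      rw [← Finset.sum_subset hsub]
      · refine Finset.sum_congr rfl fun j hj => ?_
        have hjM : j ≤ M := Nat.lt_succ_iff.1 (Finset.mem_range.1 hj)
        rw [show M + d - j = (M - j) + d by omega]
        ring
      · intro j _ hj
        have : j ∉ t := fun h => hj (hM h)
        simp [c, this])
    have hi2 := Finset.mem_range.1 (hM hi)
    have h4 := h3 i (by omega)
    simp only [c, if_pos hi] at h4
    rw [← hc0 i]
    exact Ideal.Quotient.eq_zero_iff_mem.2 h4
  exact (inferInstance : Infinite ℕ).not_finite hli.finite
end
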